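/- If Σ₂E is not contained in i.o.-NP/poly, then for every natural number k there is a language A ∈ Σ₂SubEXP such that A ∉ NSIZE(n^k); that is, polynomial-size nondeterministic circuit lower bounds for Σ₂E translate downward to fixed-polynomial-size nondeterministic circuit lower bounds for Σ₂SubEXP. -/

import Mathlib

namespace Paper

/-! ## Bitstrings and languages -/

abbrev Bitstring := List Bool
abbrev Language := Set Bitstring

/-- A self-delimiting duplication encoding of a bitstring, used for pairing. -/
def encodeBits : Bitstring → Bitstring
  | [] => []
  | b :: l => b :: b :: encodeBits l

/-- An injective pairing function on bitstrings. -/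
def pair (x y : Bitstring) : Bitstring :=
  encodeBits x ++ [true, false] ++ encodeBits y

/-! ## Deterministic Turing machines (one two-way infinite tape) -/

/-- A deterministic Turing machine with state space `Fin (states+1)` and tape
alphabet `Fin (symbols+3)`, whose first three symbols are blank, bit `0`, bit `1`.
The transition returns (new state, written symbol, move-right?). -/
structure TM where
  states : ℕ
  symbols : ℕ
  start : Fin (states + 1)
  accept : Fin (states + 1)
  reject : Fin (states + 1)
  trans : Fin (states + 1) → Fin (symbols + 3) → Fin (states + 1) × Fin (symbols + 3) × Bool

def TM.blank (M : TM) : Fin (M.symbols + 3) := ⟨0, by omega⟩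
def TM.b0 (M : TM) : Fin (M.symbols + 3) := ⟨1, by omega⟩
def TM.b1 (M : TM) : Fin (M.symbols + 3) := ⟨2, by omega⟩
def TM.sym (M : TM) (b : Bool) : Fin (M.symbols + 3) := if b then M.b1 else M.b0

/-- A configuration of a Turing machine. -/
structure Cfg (M : TM) where
  state : Fin (M.states + 1)
  tape : ℤ → Fin (M.symbols + 3)
  head : ℤ

/-- The initial configuration on input `x`. -/
def initCfg (M : TM) (x : Bitstring) : Cfg M where
  state := M.start
  tape := fun i => if 0 ≤ i ∧ i < (x.length : ℤ) then M.sym (x.getD i.toNat false) else M.blank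
  head := 0

/-- One computation step; halting configurations are fixed points. -/
def stepCfg (M : TM) (c : Cfg M) : Cfg M :=
  if c.state = M.accept ∨ c.state = M.reject then c
  else
    let out := M.trans c.state (c.tape c.head)
    { state := out.1
      tape := fun i => if i = c.head then out.2.1 else c.tape i
      head := if out.2.2 then c.head + 1 else c.head - 1 }

/-- The configuration reached after `t` steps on input `x`. -/
def runTM (M : TM) (x : Bitstring) (t : ℕ) : Cfg M := (stepCfg M)^[t] (initCfg M x)

def tmAccepts (M : TM) (x : Bitstring) (t : ℕ) : Prop := (runTM M x t).state = M.accept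

def tmHalted (M : TM) (c : Cfg M) : Prop := c.state = M.accept ∨ c.state = M.reject

def symToBit (M : TM) (s : Fin (M.symbols + 3)) : Option Bool :=
  if s = M.b1 then some true else if s = M.b0 then some false else none

/-- The output of `M` on `x` after `t` steps: the maximal block of bit symbols
starting at cell `0`. -/
def tmOutput (M : TM) (x : Bitstring) (t : ℕ) : Bitstring :=
  (((List.range t).map fun i => symToBit M ((runTM M x t).tape (i : ℤ))).takeWhile
      fun o => o.isSome).map fun o => o.getD false

/-- `M` decides the language `L` within time `t`. -/
def DecidesInTime (M : TM) (L : Language) (t : ℕ → ℕ) : Prop :=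
  ∀ x : Bitstring,
    (x ∈ L → (runTM M x (t x.length)).state = M.accept) ∧
    (x ∉ L → (runTM M x (t x.length)).state = M.reject)

/-- `L` is decidable in deterministic polynomial time. -/
def PolyDecidable (L : Language) : Prop :=
  ∃ (c : ℕ) (M : TM), DecidesInTime M L fun n => (n + 2) ^ c

/-- `M` computes the function `f` within time `t` (halting in the accept state). -/
def ComputesInTime (M : TM) (f : Bitstring → Bitstring) (t : ℕ → ℕ) : Prop :=
  ∀ x : Bitstring,
    (runTM M x (t x.length)).state = M.accept ∧ tmOutput M x (t x.length) = f x

def PolyComputable (f : Bitstring → Bitstring) : Prop :=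
  ∃ (c : ℕ) (M : TM), ComputesInTime M f fun n => (n + 2) ^ c

/-- Polynomial-time many-one reducibility. -/
def PolyReducible (A B : Language) : Prop :=
  ∃ f : Bitstring → Bitstring, PolyComputable f ∧ ∀ x, x ∈ A ↔ f x ∈ B

/-- `M` decides `L` in space `s`: it halts with the correct answer and its head
never leaves the cells at distance at most `s n` from the origin. -/
def DecidesInSpace (M : TM) (L : Language) (s : ℕ → ℕ) : Prop :=
  ∀ x : Bitstring,
    (∃ T : ℕ, tmHalted M (runTM M x T) ∧ ((runTM M x T).state = M.accept ↔ x ∈ L)) ∧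
    ∀ t : ℕ, (runTM M x t).head.natAbs ≤ s x.length

def PSPACE : Set Language :=
  {L | ∃ (c : ℕ) (M : TM), DecidesInSpace M L fun n => (n + 2) ^ c}

/-! ## Quantifier-defined classes: NP, coNP, Σ₂-time, with advice -/

def InNP (L : Language) : Prop :=
  ∃ (c : ℕ) (M : TM), ∀ x : Bitstring,
    x ∈ L ↔ ∃ y : Bitstring, y.length ≤ (x.length + 2) ^ c ∧
      tmAccepts M (pair x y) ((x.length + 2) ^ c)

def InCoNP (L : Language) : Prop := InNP Lᶜ

/-- Acceptance of a Σ₂ (∃∀) machine given by the deterministic predicate-machine `M`,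
constant `c`, time bound `t` and advice/auxiliary string `w` on input `x`. -/
def Sig2Accepts (M : TM) (c : ℕ) (t : ℕ) (x w : Bitstring) : Prop :=
  ∃ y : Bitstring, y.length ≤ t ∧ ∀ z : Bitstring, z.length ≤ t →
    tmAccepts M (pair x (pair w (pair y z))) (c * t + c)

/-- `Σ₂TIME(t)/a` : Σ₂ machines running in time `O(t)` with `a` bits of advice. -/
def Sigma2TimeAdv (t a : ℕ → ℕ) : Set Language :=
  {L | ∃ (c : ℕ) (M : TM) (adv : ℕ → Bitstring), (∀ n, (adv n).length ≤ a n) ∧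
      ∀ x : Bitstring, x ∈ L ↔ Sig2Accepts M c (t x.length) x (adv x.length)}

def Sigma2Time (t : ℕ → ℕ) : Set Language := Sigma2TimeAdv t fun _ => 0

def Sigma2P : Set Language := {L | ∃ k : ℕ, L ∈ Sigma2Time fun n => (n + 2) ^ k}

def Sigma2E : Set Language := {L | ∃ k : ℕ, L ∈ Sigma2Time fun n => 2 ^ (k * (n + 1))}

/-- `2^(n^ε)`. -/
noncomputable def texp (ε : ℝ) (n : ℕ) : ℕ := 2 ^ (Nat.ceil ((n : ℝ) ^ ε))

/-- `n^ε` (rounded up), used as an advice bound. -/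
noncomputable def aexp (ε : ℝ) (n : ℕ) : ℕ := Nat.ceil ((n : ℝ) ^ ε)

noncomputable def Sigma2SubEXP : Set Language :=
  {L | ∀ ε : ℝ, 0 < ε → L ∈ Sigma2Time (texp ε)}

/-- `NP/poly`. -/
def NPpoly : Set Language :=
  {L | ∃ (c : ℕ) (M : TM) (adv : ℕ → Bitstring), (∀ n, (adv n).length ≤ (n + 2) ^ c) ∧
      ∀ x : Bitstring, x ∈ L ↔ ∃ y : Bitstring, y.length ≤ (x.length + 2) ^ c ∧
        tmAccepts M (pair x (pair (adv x.length) y)) ((x.length + 2) ^ c)}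

/-- Two languages agree on all strings of length `n`. -/
def AgreeAt (A B : Language) (n : ℕ) : Prop :=
  ∀ x : Bitstring, x.length = n → (x ∈ A ↔ x ∈ B)

/-- The infinitely-often version of a class of languages. -/
def ioClass (C : Set Language) : Set Language :=
  {L | ∃ A ∈ C, {n : ℕ | AgreeAt L A n}.Infinite}

/-! ## Counting over random strings -/

open Classical in
/-- The number of bitstrings `r` of length `m` satisfying `P`. -/
noncomputable def countTrue (m : ℕ) (P : Bitstring → Prop) : ℕ :=
  (Finset.univ.filter fun r : Fin m → Bool => P (List.ofFn r)).card

open Classical in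
/-- Classical characteristic function of a language. -/
noncomputable def chi (L : Language) (q : Bitstring) : Bool := decide (q ∈ L)

/-! ## Promise problems, prAM and prAugAM -/

/-- A promise problem: a pair of (intended to be disjoint) sets of yes- and no-instances. -/
structure PromiseProblem where
  Y : Language
  N : Language

def PromiseProblem.swap (P : PromiseProblem) : PromiseProblem := ⟨P.N, P.Y⟩

/-- `R` (a set of coded triples `⟨x, r, w⟩`, `r` the random string, `w` Merlin's witness)
together with the randomness-exponent `k` is an Arthur–Merlin relation for `P` with
thresholds 2/3 and 1/3. -/
def IsPrAMRelation (P : PromiseProblem) (R : Language) (k : ℕ) : Prop :=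
  PolyDecidable R ∧
    ∀ x : Bitstring,
      (x ∈ P.Y → 2 * 2 ^ ((x.length + 1) ^ k) ≤
        3 * countTrue ((x.length + 1) ^ k) fun r => ∃ w : Bitstring, pair x (pair r w) ∈ R) ∧
      (x ∈ P.N → 3 * countTrue ((x.length + 1) ^ k)
          (fun r => ∃ w : Bitstring, pair x (pair r w) ∈ R) ≤ 2 ^ ((x.length + 1) ^ k))

def InPrAM (P : PromiseProblem) : Prop := ∃ (R : Language) (k : ℕ), IsPrAMRelation P R k

/-- The augmented Arthur–Merlin class of Aydinlioğlu and van Melkebeek, for promise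
problems: a prAM verifier and a coNP verifier must both accept Merlin's first move. -/
def InPrAugAM (P : PromiseProblem) : Prop :=
  ∃ (c : ℕ) (G : PromiseProblem) (V : Language), InPrAM G ∧ InCoNP V ∧
    ∀ x : Bitstring,
      (x ∈ P.Y → ∃ y : Bitstring, y.length = x.length ^ c ∧
        pair x y ∈ G.Y ∧ pair x y ∈ V) ∧
      (x ∈ P.N → ∀ y : Bitstring, y.length = x.length ^ c →
        pair x y ∈ G.N ∨ pair x y ∉ V)

/-- Languages in AugAM. -/
def InAugAM (L : Language) : Prop := InPrAugAM ⟨L, Lᶜ⟩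

/-- An augmented Arthur–Merlin protocol deciding the language `L` when the verifiers
are given the advice bit `adv n` (prepended to the input) for inputs of length `n`. -/
def AugAMWithAdvice (adv : ℕ → Bool) (L : Language) : Prop :=
  ∃ (c : ℕ) (G : PromiseProblem) (V : Language), InPrAM G ∧ InCoNP V ∧
    ∀ x : Bitstring,
      (x ∈ L → ∃ y : Bitstring, y.length = x.length ^ c ∧
        pair (adv x.length :: x) y ∈ G.Y ∧ pair (adv x.length :: x) y ∈ V) ∧
      (x ∉ L → ∀ y : Bitstring, y.length = x.length ^ c →
        pair (adv x.length :: x) y ∈ G.N ∨ pair (adv x.length :: x) y ∉ V)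

/-- `AugAM/1`. -/
def InAugAMAdv1 (L : Language) : Prop := ∃ adv : ℕ → Bool, AugAMWithAdvice adv L

/-- `(coAugAM ∩ AugAM)/1` with a single shared advice bit. -/
def InAugAMCoAdv1 (L : Language) : Prop :=
  ∃ adv : ℕ → Bool, AugAMWithAdvice adv L ∧ AugAMWithAdvice adv Lᶜ

/-- A language agrees with a promise problem. -/
def AgreesWith (A : Language) (P : PromiseProblem) : Prop :=
  (∀ x ∈ P.Y, x ∈ A) ∧ ∀ x ∈ P.N, x ∉ A

/-- A promise problem is solvable in a class of languages. -/
def PromiseInClass (C : Set Language) (P : PromiseProblem) : Prop :=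
  ∃ A ∈ C, AgreesWith A P

/-- A language agrees with a promise problem on infinitely many input lengths. -/
def IoAgreesWith (A : Language) (P : PromiseProblem) : Prop :=
  {n : ℕ | ∀ x : Bitstring, x.length = n →
    (x ∈ P.Y → x ∈ A) ∧ (x ∈ P.N → x ∉ A)}.Infinite

/-! ## Boolean circuits (DAGs given by lists of gates) -/

inductive GateOp where
  | const (b : Bool)
  | input (i : ℕ)
  | not (a : ℕ)
  | and (a b : ℕ)
  | or (a b : ℕ)

/-- Evaluate one gate given the input `x` and the values `vals` of earlier gates. -/
def GateOp.eval (x vals : List Bool) : GateOp → Bool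
  | .const b => b
  | .input i => x.getD i false
  | .not a => !(vals.getD a false)
  | .and a b => (vals.getD a false) && (vals.getD b false)
  | .or a b => (vals.getD a false) || (vals.getD b false)

def evalGates (x : List Bool) : List GateOp → List Bool → List Bool
  | [], vals => vals
  | g :: gs, vals => evalGates x gs (vals ++ [g.eval x vals])

/-- A Boolean circuit: a list of gates, each referring to earlier gates by index. -/
structure Circuit where
  gates : List GateOp

def Circuit.size (C : Circuit) : ℕ := C.gates.length
def Circuit.values (C : Circuit) (x : List Bool) : List Bool := evalGates x C.gates []
def Circuit.evalAt (C : Circuit) (x : List Bool) (i : ℕ) : Bool := (C.values x).getD i false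
/-- The output of the circuit: the value of its last gate. -/
def Circuit.eval (C : Circuit) (x : List Bool) : Bool := (C.values x).getLastD false

/-! ## Nondeterministic and single-valued circuits -/

/-- A nondeterministic circuit: a circuit on `n + w` inputs, the last `w` of which
are witness bits. -/
structure NDCircuit where
  w : ℕ
  C : Circuit

def NDCircuit.size (D : NDCircuit) : ℕ := D.C.size
def NDCircuit.Accepts (D : NDCircuit) (x : Bitstring) : Prop :=
  ∃ y : Bitstring, y.length = D.w ∧ D.C.eval (x ++ y) = true

/-- `NSIZE(s)`: decidable length-wise by nondeterministic circuits of size `s n`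
(for all but finitely many `n`; every finite slice has some circuit anyway). -/
def NSIZE (s : ℕ → ℕ) (L : Language) : Prop :=
  ∃ D : ℕ → NDCircuit,
    (∃ n₀ : ℕ, ∀ n, n₀ ≤ n → (D n).size ≤ s n) ∧
    ∀ (n : ℕ) (x : Bitstring), x.length = n → (x ∈ L ↔ (D n).Accepts x)

/-- A single-valued nondeterministic circuit: a circuit on `n + w` inputs with two
designated output gates, `valueGate` and `flagGate`. -/
structure SVCircuit where
  w : ℕ
  valueGate : ℕ
  flagGate : ℕ
  C : Circuit

def SVCircuit.size (D : SVCircuit) : ℕ := D.C.size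
def SVCircuit.value (D : SVCircuit) (x y : Bitstring) : Bool := D.C.evalAt (x ++ y) D.valueGate
def SVCircuit.flag (D : SVCircuit) (x y : Bitstring) : Bool := D.C.evalAt (x ++ y) D.flagGate

/-- Partial single-valuedness on inputs of length `n`. -/
def SVCircuit.IsPSVOn (D : SVCircuit) (n : ℕ) : Prop :=
  ∀ x : Bitstring, x.length = n → ∀ y₁ y₂ : Bitstring, y₁.length = D.w → y₂.length = D.w →
    D.flag x y₁ = true → D.flag x y₂ = true → D.value x y₁ = D.value x y₂

/-- Partial single-valuedness (on inputs of every length). -/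
def SVCircuit.IsPSV (D : SVCircuit) : Prop := ∀ n : ℕ, D.IsPSVOn n

/-- `D` is a TSV circuit computing `L` on inputs of length `n`. -/
def SVComputesOn (D : SVCircuit) (L : Language) (n : ℕ) : Prop :=
  D.IsPSVOn n ∧
  (∀ x : Bitstring, x.length = n → ∃ y : Bitstring, y.length = D.w ∧ D.flag x y = true) ∧
  ∀ x : Bitstring, x.length = n →
    (x ∈ L ↔ ∃ y : Bitstring, y.length = D.w ∧ D.flag x y = true ∧ D.value x y = true)

/-- `SVSIZE(s)`. -/
def SVSIZE (s : ℕ → ℕ) (L : Language) : Prop :=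
  ∃ D : ℕ → SVCircuit,
    (∃ n₀ : ℕ, ∀ n, n₀ ≤ n → (D n).size ≤ s n) ∧
    ∀ n : ℕ, SVComputesOn (D n) L n

/-- The size of the smallest SV (TSV) circuit computing `L` on length-`n` inputs. -/
noncomputable def MinSV (L : Language) (n : ℕ) : ℕ :=
  sInf {s : ℕ | ∃ D : SVCircuit, SVComputesOn D L n ∧ D.size = s}

/-! ## Encoding SV circuits as bitstrings -/

def encNat (n : ℕ) : Bitstring := List.replicate n true ++ [false]

def encGate : GateOp → Bitstring
  | .const b => false :: false :: [b]
  | .input i => false :: true :: encNat i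
  | .not a => true :: false :: false :: encNat a
  | .and a b => true :: false :: true :: (encNat a ++ encNat b)
  | .or a b => true :: true :: (encNat a ++ encNat b)

def encodeSV (D : SVCircuit) : Bitstring :=
  encNat D.w ++ encNat D.valueGate ++ encNat D.flagGate ++ (D.C.gates.map encGate).flatten

/-! ## Oracle machines: deterministic and probabilistic -/

/-- Run an oracle machine: each round, the transition TM `N` is run for
`(|x|+|hist|+2)^c` steps on the pair of the input and the history of oracle answers.
Its output is either `1·b` ("halt with answer `b`"), or `0·q` ("query `q`").
A query on which the (partial) oracle is undefined causes immediate rejection. -/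
def omRun (N : TM) (c : ℕ) (O : Bitstring → Option Bool) (x : Bitstring) :
    ℕ → Bitstring → Bool
  | 0, _ => false
  | fuel + 1, hist =>
    match tmOutput N (pair x hist) ((x.length + hist.length + 2) ^ c) with
    | [] => false
    | b :: rest =>
      if b then rest.headD false
      else
        match O rest with
        | none => false
        | some a => omRun N c O x fuel (hist ++ [a])

/-- The list of oracle queries made during a run. -/
def omQueries (N : TM) (c : ℕ) (O : Bitstring → Option Bool) (x : Bitstring) :
    ℕ → Bitstring → List Bitstring
  | 0, _ => []
  | fuel + 1, hist =>
    match tmOutput N (pair x hist) ((x.length + hist.length + 2) ^ c) with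
    | [] => []
    | b :: rest =>
      if b then []
      else
        rest ::
          match O rest with
          | none => []
          | some a => omQueries N c O x fuel (hist ++ [a])

/-- The total oracle associated with a language. -/
noncomputable def oracleOfSet (L : Language) : Bitstring → Option Bool :=
  fun q => some (chi L q)

/-- `P^NP` with advice bound `a`: a polynomial-time deterministic oracle machine with
an NP oracle and `a n` bits of advice. -/
def InPNPAdvice (A : Language) (a : ℕ → ℕ) : Prop :=
  ∃ (N : TM) (c : ℕ) (V : Language) (adv : ℕ → Bitstring), InNP V ∧
    (∀ n, (adv n).length ≤ a n) ∧
    ∀ x : Bitstring,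
      x ∈ A ↔ omRun N c (oracleOfSet V) (pair x (adv x.length)) ((x.length + 2) ^ c) [] = true

/-- A probabilistic polynomial-time oracle machine: transition machine `N`, per-round
time/round-count exponent `c`, and random-string length exponent `k`. -/
structure POM where
  N : TM
  c : ℕ
  k : ℕ

def POM.randLen (P : POM) (n : ℕ) : ℕ := (n + 1) ^ P.k

def POM.accepts (P : POM) (O : Bitstring → Option Bool) (x r : Bitstring) : Bool :=
  omRun P.N P.c O (pair x r) ((x.length + 2) ^ P.c) []

def POM.queries (P : POM) (O : Bitstring → Option Bool) (x r : Bitstring) : List Bitstring :=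
  omQueries P.N P.c O (pair x r) ((x.length + 2) ^ P.c) []

open Classical in
/-- The partial oracle `L(C)` determined by a (PSV) circuit. -/
noncomputable def SVCircuit.partialOracle (D : SVCircuit) (q : Bitstring) : Option Bool :=
  if h : ∃ y : Bitstring, y.length = D.w ∧ D.flag q y = true then some (D.value q h.choose)
  else none

/-! ## SAT and oracle circuits -/

inductive Formula where
  | var (n : ℕ)
  | not (f : Formula)
  | and (f g : Formula)
  | or (f g : Formula)

def Formula.eval (a : ℕ → Bool) : Formula → Bool
  | .var n => a n
  | .not f => !(f.eval a)
  | .and f g => (f.eval a) && (g.eval a)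
  | .or f g => (f.eval a) || (g.eval a)

/-- Unary parsing of a natural number. -/
def parseNat : Bitstring → ℕ × Bitstring
  | true :: l => let p := parseNat l; (p.1 + 1, p.2)
  | false :: l => (0, l)
  | [] => (0, [])

/-- Fuelled parser for Boolean formulas from bitstrings. -/
def parseFormula : ℕ → Bitstring → Option (Formula × Bitstring)
  | 0, _ => none
  | fuel + 1, l =>
    match l with
    | false :: false :: r => let p := parseNat r; some (.var p.1, p.2)
    | false :: true :: r => do
        let p ← parseFormula fuel r
        pure (.not p.1, p.2)
    | true :: false :: r => do
        let p ← parseFormula fuel r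
        let q ← parseFormula fuel p.2
        pure (.and p.1 q.1, q.2)
    | true :: true :: r => do
        let p ← parseFormula fuel r
        let q ← parseFormula fuel p.2
        pure (.or p.1 q.1, q.2)
    | _ => none

/-- The satisfiability problem for (encoded) Boolean formulas. -/
def SAT : Language :=
  {x | ∃ (f : Formula) (r : Bitstring), parseFormula x.length x = some (f, r) ∧
        ∃ a : ℕ → Bool, f.eval a = true}

noncomputable def SATb : Bitstring → Bool := chi SAT

/-- Gates of an oracle circuit. -/
inductive OGateOp where
  | const (b : Bool)
  | input (i : ℕ)
  | not (a : ℕ)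
  | and (a b : ℕ)
  | or (a b : ℕ)
  | oracle (args : List ℕ)

def OGateOp.eval (O : Bitstring → Bool) (x vals : List Bool) : OGateOp → Bool
  | .const b => b
  | .input i => x.getD i false
  | .not a => !(vals.getD a false)
  | .and a b => (vals.getD a false) && (vals.getD b false)
  | .or a b => (vals.getD a false) || (vals.getD b false)
  | .oracle args => O (args.map fun a => vals.getD a false)

def OGateOp.weight : OGateOp → ℕ
  | .oracle args => args.length + 1
  | _ => 1

def evalOGates (O : Bitstring → Bool) (x : List Bool) :
    List OGateOp → List Bool → List Bool
  | [], vals => vals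
  | g :: gs, vals => evalOGates O x gs (vals ++ [g.eval O x vals])

/-- An oracle circuit (it is used here with no inputs, as a generator). -/
structure OCircuit where
  gates : List OGateOp

def OCircuit.size (C : OCircuit) : ℕ := (C.gates.map OGateOp.weight).sum
/-- The outputs of the oracle circuit: the values of all its gates on the empty input. -/
def OCircuit.outputs (C : OCircuit) (O : Bitstring → Bool) : List Bool :=
  evalOGates O [] C.gates []

/-- Split a list of bits into blocks of length `m`. -/
def chunks (m : ℕ) (l : List Bool) : List Bitstring :=
  (List.range (l.length / m)).map fun i => (l.drop (i * m)).take m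

/-- The set of `m`-bit strings generated by an oracle circuit with a SAT oracle. -/
noncomputable def OCircuit.genSet (C : OCircuit) (m : ℕ) : List Bitstring :=
  chunks m (C.outputs SATb)

/-! ## Σ₂-promise problems and hitting sets -/

/-- A promise problem whose promise is decided by a `Σ₂P` language. -/
def Sigma2Promise (P : PromiseProblem) : Prop :=
  ∃ D ∈ Sigma2P, ∀ x : Bitstring, x ∈ P.Y ∪ P.N ↔ x ∈ D

/-- `S` is a hitting set at length `n` for the promise problem `P` with AM relation
`(R, k)` (the strings in `S` play the role of Arthur's random strings). -/
def IsHittingSet (P : PromiseProblem) (R : Language) (k : ℕ) (n : ℕ)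
    (S : List Bitstring) : Prop :=
  (∀ s ∈ S, s.length = (n + 1) ^ k) ∧
  ∀ x : Bitstring, x.length = n →
    (x ∈ P.Y → ∀ y ∈ S, ∃ z : Bitstring, pair x (pair y z) ∈ R) ∧
    (x ∈ P.N → ∀ z : Bitstring, ∃ y ∈ S, pair x (pair y z) ∉ R)

/-! ## The promise problems Γ^M of Santhanam's technique -/

/-- `Γ^M` : yes-instances are pairs `⟨x, C⟩` with `C` a PSV circuit such that the
probabilistic oracle machine accepts `x` with probability at least `2/3` when given
the partial language of `C` as oracle; no-instances are those where it rejects with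
probability at least `2/3`. -/
noncomputable def GammaProblem (P : POM) : PromiseProblem where
  Y := {s | ∃ (x : Bitstring) (D : SVCircuit), s = pair x (encodeSV D) ∧ D.IsPSV ∧
        2 * 2 ^ P.randLen x.length ≤
          3 * countTrue (P.randLen x.length) fun r => P.accepts D.partialOracle x r = true}
  N := {s | ∃ (x : Bitstring) (D : SVCircuit), s = pair x (encodeSV D) ∧ D.IsPSV ∧
        2 * 2 ^ P.randLen x.length ≤
          3 * countTrue (P.randLen x.length) fun r => P.accepts D.partialOracle x r = false}


/-! ## Register programs -/

/-- Instructions of a stack machine with states `S` and stack alphabet `Γ`; the next state `none`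
means that the machine stops. -/
inductive Instr (S Γ : Type) where
  | push (k : ℕ) (a : Γ) (next : Option S)
  | pop (k : ℕ) (next : Option Γ → Option S)
  | read (next : Option Bool → Option S)

/-- The memory of a stack machine: the unread part of the input, and the stacks. -/
@[ext] structure Mem (Γ : Type) where
  inp : List Bool
  reg : ℕ → List Γ

section

variable {S S' Γ : Type}

def Mem.set (m : Mem Γ) (k : ℕ) (l : List Γ) : Mem Γ := ⟨m.inp, Function.update m.reg k l⟩

@[simp] theorem Mem.set_inp (m : Mem Γ) (k : ℕ) (l : List Γ) : (m.set k l).inp = m.inp := rfl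

theorem Mem.set_reg (m : Mem Γ) (k j : ℕ) (l : List Γ) :
    (m.set k l).reg j = if j = k then l else m.reg j := by
  simp [Mem.set, Function.update_apply]

@[simp] theorem Mem.set_self (m : Mem Γ) (k : ℕ) : m.set k (m.reg k) = m := by
  simp [Mem.set]

def Instr.exec : Instr S Γ → Mem Γ → Option S × Mem Γ
  | .push k a n, m => (n, m.set k (a :: m.reg k))
  | .pop k n, m => (n (m.reg k).head?, m.set k (m.reg k).tail)
  | .read n, m => (n m.inp.head?, ⟨m.inp.tail, m.reg⟩)

def Instr.map (φ : Option S → Option S') : Instr S Γ → Instr S' Γ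
  | .push k a n => .push k a (φ n)
  | .pop k n => .pop k (fun o => φ (n o))
  | .read n => .read (fun o => φ (n o))

theorem Instr.exec_map (φ : Option S → Option S') (i : Instr S Γ) (m : Mem Γ) :
    (i.map φ).exec m = (φ (i.exec m).1, (i.exec m).2) := by
  cases i <;> rfl

/-- One step of the stack machine with program table `I`. -/
def smStep (I : S → Instr S Γ) (c : Option S × Mem Γ) : Option S × Mem Γ :=
  match c.1 with
  | none => c
  | some s => (I s).exec c.2

theorem smStep_iterate_none (I : S → Instr S Γ) (m : Mem Γ) (t : ℕ) :
    (smStep I)^[t] (none, m) = (none, m) :=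
  Function.iterate_fixed rfl t

theorem smStep_lift (I : S → Instr S Γ) (I' : S' → Instr S' Γ) (φ : S' → S) (e : Option S)
    (h : ∀ s, I (φ s) = (I' s).map (fun o => o.elim e (fun s' => some (φ s')))) (t : ℕ) :
    ∀ (o : Option S') (m m' : Mem Γ), (smStep I')^[t] (o, m) = (none, m') →
      ∃ t' ≤ t, (smStep I)^[t'] (o.elim e (fun s' => some (φ s')), m) = (e, m') := by
  induction t with
  | zero =>
    intro o m m' hs
    simp only [Function.iterate_zero, id_eq, Prod.mk.injEq] at hs
    exact ⟨0, le_rfl, by simp [hs.1, hs.2]⟩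
  | succ t ih =>
    intro o m m' hs
    cases o with
    | none =>
      rw [smStep_iterate_none] at hs
      simp only [Prod.mk.injEq, true_and] at hs
      exact ⟨0, by omega, by simp [hs]⟩
    | some s =>
      rw [Function.iterate_succ_apply] at hs
      obtain ⟨t', ht', hr⟩ := ih _ _ _ hs
      refine ⟨t' + 1, by omega, ?_⟩
      rw [Function.iterate_succ_apply, ← hr]
      refine congrArg _ ?_
      change (I (φ s)).exec m = _
      rw [h, Instr.exec_map]
      rfl

/-- Structured programs over stacks; `loop k f` pops a symbol `a` from stack `k` and runs `f a`,
until the stack is empty. -/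
inductive Prog (Γ : Type) where
  | skip
  | push (k : ℕ) (a : Γ)
  | pop (k : ℕ) (f : Option Γ → Prog Γ)
  | read (f : Option Bool → Prog Γ)
  | seq (p r : Prog Γ)
  | loop (k : ℕ) (f : Γ → Prog Γ)

namespace Prog

/-- The control states of a program. -/
def St : Prog Γ → Type
  | skip => Empty
  | push _ _ => Unit
  | pop _ f => Option (Σ a, (f a).St)
  | read f => Option (Σ a, (f a).St)
  | seq p r => p.St ⊕ r.St
  | loop _ f => Option (Σ a, (f a).St)

theorem finite_St [Finite Γ] : (p : Prog Γ) → Finite p.St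
  | skip => inferInstanceAs (Finite Empty)
  | push _ _ => inferInstanceAs (Finite Unit)
  | pop _ f => by
    have := fun a => (f a).finite_St
    exact inferInstanceAs (Finite (Option (Σ a, (f a).St)))
  | read f => by
    have := fun a => (f a).finite_St
    exact inferInstanceAs (Finite (Option (Σ a, (f a).St)))
  | seq p r => by
    have := p.finite_St
    have := r.finite_St
    exact inferInstanceAs (Finite (p.St ⊕ r.St))
  | loop _ f => by
    have := fun a => (f a).finite_St
    exact inferInstanceAs (Finite (Option (Σ a, (f a).St)))

def entry : (p : Prog Γ) → Option p.St
  | skip => none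
  | push _ _ => some ()
  | pop _ f => some (none : Option (Σ a, (f a).St))
  | read f => some (none : Option (Σ a, (f a).St))
  | seq p r => p.entry.elim (r.entry.map Sum.inr) (fun s => some (Sum.inl s))
  | loop _ f => some (none : Option (Σ a, (f a).St))

set_option linter.unusedVariables false in
/-- The program table. -/
def table : (p : Prog Γ) → p.St → Instr p.St Γ
  | push k a, _ => .push k a none
  | pop k f, (none : Option (Σ a, (f a).St)) =>
    .pop k (fun o => (f o).entry.map fun s => some ⟨o, s⟩)
  | pop _ f, (some ⟨o, s⟩ : Option (Σ a, (f a).St)) =>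
    ((f o).table s).map (fun n => n.elim none (fun s' => some (some ⟨o, s'⟩)))
  | read f, (none : Option (Σ a, (f a).St)) =>
    .read (fun o => (f o).entry.map fun s => some ⟨o, s⟩)
  | read f, (some ⟨o, s⟩ : Option (Σ a, (f a).St)) =>
    ((f o).table s).map (fun n => n.elim none (fun s' => some (some ⟨o, s'⟩)))
  | seq p r, (Sum.inl s : p.St ⊕ r.St) =>
    (p.table s).map (fun n => n.elim (r.entry.map Sum.inr) (fun s' => some (Sum.inl s')))
  | seq p r, (Sum.inr s : p.St ⊕ r.St) =>
    (r.table s).map (fun n => n.elim none (fun s' => some (Sum.inr s')))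
  | loop k f, (none : Option (Σ a, (f a).St)) =>
    .pop k (fun o => o.elim none
      (fun a => (f a).entry.elim (some none) (fun s => some (some ⟨a, s⟩))))
  | loop _ f, (some ⟨a, s⟩ : Option (Σ a, (f a).St)) =>
    ((f a).table s).map (fun n => n.elim (some none) (fun s' => some (some ⟨a, s'⟩)))

/-- `p` transforms the memory `m` into `m'` in at most `t` steps. -/
def Runs (p : Prog Γ) (m m' : Mem Γ) (t : ℕ) : Prop :=
  ∃ t' ≤ t, (smStep p.table)^[t'] (p.entry, m) = (none, m')

theorem Runs.mono {p : Prog Γ} {m m' : Mem Γ} {t u : ℕ} (h : p.Runs m m' t) (htu : t ≤ u) :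
    p.Runs m m' u := by
  obtain ⟨t', ht', h⟩ := h
  exact ⟨t', ht'.trans htu, h⟩

theorem runs_skip (m : Mem Γ) : (skip : Prog Γ).Runs m m 0 := ⟨0, le_rfl, rfl⟩

theorem runs_push (k : ℕ) (a : Γ) (m : Mem Γ) :
    (push k a).Runs m (m.set k (a :: m.reg k)) 1 := ⟨1, le_rfl, rfl⟩

theorem runs_pop {k : ℕ} {f : Option Γ → Prog Γ} {m m' : Mem Γ} {t : ℕ}
    (h : (f (m.reg k).head?).Runs (m.set k (m.reg k).tail) m' t) :
    (pop k f).Runs m m' (t + 1) := by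
  obtain ⟨t₁, ht₁, h⟩ := h
  obtain ⟨t₂, ht₂, h⟩ := smStep_lift (pop k f).table (f (m.reg k).head?).table
    (fun s => (some ⟨_, s⟩ : Option (Σ a, (f a).St))) none (fun s => rfl) t₁ _ _ _ h
  refine ⟨t₂ + 1, by omega, ?_⟩
  rw [Function.iterate_succ_apply, ← h]
  congr 1
  simp only [smStep, entry, table, Instr.exec]
  cases (f (m.reg k).head?).entry <;> rfl

theorem runs_read {f : Option Bool → Prog Γ} {m m' : Mem Γ} {t : ℕ}
    (h : (f m.inp.head?).Runs ⟨m.inp.tail, m.reg⟩ m' t) :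
    (read f).Runs m m' (t + 1) := by
  obtain ⟨t₁, ht₁, h⟩ := h
  obtain ⟨t₂, ht₂, h⟩ := smStep_lift (read f).table (f m.inp.head?).table
    (fun s => (some ⟨_, s⟩ : Option (Σ a, (f a).St))) none (fun s => rfl) t₁ _ _ _ h
  refine ⟨t₂ + 1, by omega, ?_⟩
  rw [Function.iterate_succ_apply, ← h]
  congr 1
  simp only [smStep, entry, table, Instr.exec]
  cases (f m.inp.head?).entry <;> rfl

theorem Runs.seq {p r : Prog Γ} {m m₁ m' : Mem Γ} {t u : ℕ} (h : p.Runs m m₁ t)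
    (h' : r.Runs m₁ m' u) : (p.seq r).Runs m m' (t + u) := by
  obtain ⟨t₁, ht₁, h⟩ := h
  obtain ⟨u₁, hu₁, h'⟩ := h'
  obtain ⟨t₂, ht₂, h⟩ := smStep_lift (p.seq r).table p.table
    (Sum.inl : p.St → p.St ⊕ r.St) (r.entry.map Sum.inr) (fun s => rfl) t₁ _ _ _ h
  obtain ⟨u₂, hu₂, h'⟩ := smStep_lift (p.seq r).table r.table
    (Sum.inr : r.St → p.St ⊕ r.St) none (fun s => rfl) u₁ _ _ _ h'
  refine ⟨u₂ + t₂, by omega, ?_⟩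
  have he : r.entry.elim none (fun s => some (Sum.inr s : p.St ⊕ r.St)) =
      r.entry.map Sum.inr := by
    cases r.entry <;> rfl
  rw [Function.iterate_add_apply]
  refine (congrArg _ h).trans ?_
  refine (congrArg _ (congrArg (fun o => (o, m₁)) he.symm)).trans h'

theorem runs_loop_nil {k : ℕ} {f : Γ → Prog Γ} {m : Mem Γ} (h : m.reg k = []) :
    (loop k f).Runs m m 1 := by
  refine ⟨1, le_rfl, ?_⟩
  have : m.set k [] = m := by rw [← h, Mem.set_self]
  simp [smStep, entry, table, Instr.exec, h, this]

theorem runs_loop_cons {k : ℕ} {f : Γ → Prog Γ} {m m₁ m' : Mem Γ} {a : Γ} {l : List Γ} {t u : ℕ}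
    (h : m.reg k = a :: l) (h₁ : (f a).Runs (m.set k l) m₁ t) (h₂ : (loop k f).Runs m₁ m' u) :
    (loop k f).Runs m m' (t + u + 1) := by
  obtain ⟨t₁, ht₁, h₁⟩ := h₁
  obtain ⟨u₁, hu₁, h₂⟩ := h₂
  obtain ⟨t₂, ht₂, h₁⟩ := smStep_lift (loop k f).table (f a).table
    (fun s => (some ⟨_, s⟩ : Option (Σ a, (f a).St))) (some (none : Option (Σ a, (f a).St)))
      (fun s => rfl) t₁ _ _ _ h₁
  refine ⟨u₁ + t₂ + 1, by omega, ?_⟩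
  rw [Function.iterate_succ_apply, Function.iterate_add_apply]
  refine (congrArg _ ?_).trans h₂
  refine (congrArg _ ?_).trans h₁
  simp only [smStep, entry, table, Instr.exec, h, List.head?_cons, Option.elim_some, List.tail_cons]

end Prog

end

/-! ## Compiling register programs to Turing machines -/

section abstractMachine

variable {S C : Type}

open Classical in
/-- One step of a Turing machine with state space `S` and tape alphabet `C`. -/
noncomputable def tapeStep (δ : S → C → S × C × Bool) (acc rej : S) (c : S × (ℤ → C) × ℤ) :
    S × (ℤ → C) × ℤ :=
  if c.1 = acc ∨ c.1 = rej then c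
  else ((δ c.1 (c.2.1 c.2.2)).1, Function.update c.2.1 c.2.2 (δ c.1 (c.2.1 c.2.2)).2.1,
    if (δ c.1 (c.2.1 c.2.2)).2.2 then c.2.2 + 1 else c.2.2 - 1)

def inputTape (cell : Option Bool → C) (w : List Bool) (i : ℤ) : C :=
  if 0 ≤ i then cell w[i.toNat]? else cell none

theorem exists_TM_of_tapeStep [Finite S] [Finite C] (δ : S → C → S × C × Bool)
    (start acc rej : S) (cell : Option Bool → C) :
    ∃ M : TM, ∀ (w : List Bool) (t : ℕ), tmAccepts M w t ↔
      ((tapeStep δ acc rej)^[t] (start, inputTape cell w, 0)).1 = acc := by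
  classical
  obtain ⟨n, ⟨e⟩⟩ := Finite.exists_equiv_fin S
  obtain ⟨N, ⟨e'⟩⟩ := Finite.exists_equiv_fin C
  obtain ⟨n, rfl⟩ : ∃ n', n = n' + 1 := by
    rcases n with _ | n
    · exact (e start).elim0
    · exact ⟨n, rfl⟩
  let dec : Fin (N + 3) → C := fun j =>
    if j.val = 0 then cell none else if j.val = 1 then cell (some false)
      else if j.val = 2 then cell (some true)
      else if h : j.val - 3 < N then e'.symm ⟨j.val - 3, h⟩ else cell none
  let enc : C → Fin (N + 3) := fun c => ⟨(e' c).val + 3, by omega⟩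
  have hdec : ∀ c, dec (enc c) = c := by
    intro c
    simp [dec, enc]
  let M : TM :=
    { states := n, symbols := N, start := e start, accept := e acc, reject := e rej
      trans := fun q a => (e (δ (e.symm q) (dec a)).1, enc (δ (e.symm q) (dec a)).2.1,
        (δ (e.symm q) (dec a)).2.2) }
  refine ⟨M, fun w t => ?_⟩
  have key : ∀ t, (runTM M w t).state =
        e ((tapeStep δ acc rej)^[t] (start, inputTape cell w, 0)).1 ∧
      (∀ i, dec ((runTM M w t).tape i) =
        ((tapeStep δ acc rej)^[t] (start, inputTape cell w, 0)).2.1 i) ∧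
      (runTM M w t).head = ((tapeStep δ acc rej)^[t] (start, inputTape cell w, 0)).2.2 := by
    intro t
    induction t with
    | zero =>
      refine ⟨rfl, fun i => ?_, rfl⟩
      simp only [runTM, Function.iterate_zero, id_eq, initCfg, inputTape]
      by_cases h0 : 0 ≤ i
      · by_cases h1 : i < (w.length : ℤ)
        · have h2 : i.toNat < w.length := by omega
          simp only [h0, h1, and_self, if_true, List.getElem?_eq_getElem h2, List.getD,
            Option.getD_some]
          cases w[i.toNat] <;> simp [dec, TM.sym, TM.b0, TM.b1]
        · simp [h0, h1, dec, TM.blank]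
      · simp [h0, dec, TM.blank]
    | succ t ih =>
      obtain ⟨h1, h2, h3⟩ := ih
      simp only [runTM] at h1 h2 h3
      simp only [runTM, Function.iterate_succ_apply']
      generalize (stepCfg M)^[t] (initCfg M w) = c at h1 h2 h3
      generalize (tapeStep δ acc rej)^[t] (start, inputTape cell w, 0) = a at h1 h2 h3
      unfold stepCfg tapeStep
      have hh : (c.state = M.accept ∨ c.state = M.reject) ↔ (a.1 = acc ∨ a.1 = rej) := by
        rw [h1]
        simp [M]
      by_cases hc : a.1 = acc ∨ a.1 = rej
      · rw [if_pos hc, if_pos (hh.2 hc)]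
        exact ⟨h1, h2, h3⟩
      · rw [if_neg hc, if_neg (fun h => hc (hh.1 h))]
        have ht : M.trans c.state (c.tape a.2.2) = (e (δ a.1 (a.2.1 a.2.2)).1,
            enc (δ a.1 (a.2.1 a.2.2)).2.1, (δ a.1 (a.2.1 a.2.2)).2.2) := by
          simp only [M, h1, h2, Equiv.symm_apply_apply]
        simp only [h3, ht]
        refine ⟨trivial, fun i => ?_, trivial⟩
        rw [Function.update_apply]
        split_ifs
        · exact hdec _
        · exact h2 i
  unfold tmAccepts
  rw [(key t).1]
  simp [M]

variable {δ : S → C → S × C × Bool} {acc rej : S}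

theorem tapeStep_eq {q : S} (hq : q ≠ acc ∧ q ≠ rej) {T : ℤ → C} {h : ℤ} {q' : S} {c : C} {b : Bool}
    (hδ : δ q (T h) = (q', c, b)) : tapeStep δ acc rej (q, T, h) =
      (q', Function.update T h c, if b then h + 1 else h - 1) := by
  simp [tapeStep, hq.1, hq.2, hδ]

theorem tapeStep_walk {q : S} (hq : q ≠ acc ∧ q ≠ rej) {T : ℤ → C} (n : ℕ)
    (h : ∀ j < n, δ q (T (j : ℕ)) = (q, T (j : ℕ), true)) :
    (tapeStep δ acc rej)^[n] (q, T, 0) = (q, T, (n : ℤ)) := by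
  induction n with
  | zero => rfl
  | succ n ih =>
    rw [Function.iterate_succ_apply', ih (fun j hj => h j (by omega)),
      tapeStep_eq hq (h n (by omega))]
    simp

theorem tapeStep_home {q q' : S} (hq : q ≠ acc ∧ q ≠ rej) {T : ℤ → C} (n : ℕ)
    (h : ∀ j < n, δ q (T (j : ℕ)) = (q, T (j : ℕ), false))
    (h' : δ q (T (-1)) = (q', T (-1), true)) :
    (tapeStep δ acc rej)^[n + 1] (q, T, (n : ℤ) - 1) = (q', T, 0) := by
  induction n with
  | zero => simp [tapeStep_eq hq h']
  | succ n ih =>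
    have e : ((n + 1 : ℕ) : ℤ) - 1 = (n : ℕ) := by omega
    rw [Function.iterate_succ_apply, e, tapeStep_eq hq (h n (by omega)),
      Function.update_eq_self]
    exact ih (fun j hj => h j (by omega))

end abstractMachine

/-- A tape cell: `none` is the end marker; otherwise one input track (blank, consumed or a bit)
and `K + 1` tracks holding the stacks. -/
abbrev Cell (K : ℕ) (Γ : Type) := Option (Option (Option Bool) × (Fin (K + 1) → Option Γ))

inductive Ctrl (S : Type) where
  | start0 | start1 | final | acc | rej
  | walk (s : S)
  | take (s : S)
  | home (o : Option S)

def Ctrl.next {S : Type} (o : Option S) : Ctrl S := o.elim .final .walk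

instance {S : Type} [Finite S] : Finite (Ctrl S) := by
  let f : Ctrl S → Fin 5 ⊕ S ⊕ S ⊕ Option S := fun c => match c with
    | .start0 => .inl 0
    | .start1 => .inl 1
    | .final => .inl 2
    | .acc => .inl 3
    | .rej => .inl 4
    | .walk s => .inr (.inl s)
    | .take s => .inr (.inr (.inl s))
    | .home o => .inr (.inr (.inr o))
  refine Finite.of_injective f fun a b h => ?_
  cases a <;> cases b <;> simp_all [f]

section compile

variable {S Γ : Type} (K : ℕ)

/-- The transition function of the Turing machine simulating the stack machine `I`. -/
def smTrans (I : S → Instr S Γ) (en : Option S) :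
    Ctrl S → Cell K Γ → Ctrl S × Cell K Γ × Bool
  | .start0, c => (.start1, c, false)
  | .start1, _ => (.next en, none, true)
  | .final, some (i, f) => (if (f 0).isSome then .acc else .rej, some (i, f), true)
  | .walk s, some (i, f) =>
    match I s with
    | .push k a n =>
      if (f (Fin.ofNat (K + 1) k)).isSome then (.walk s, some (i, f), true)
      else (.home n, some (i, Function.update f (Fin.ofNat (K + 1) k) (some a)), false)
    | .pop k _ =>
      if (f (Fin.ofNat (K + 1) k)).isSome then (.walk s, some (i, f), true)
      else (.take s, some (i, f), false)
    | .read n =>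
      match i with
      | none => (.home (n none), some (i, f), false)
      | some none => (.walk s, some (i, f), true)
      | some (some b) => (.home (n (some b)), some (some none, f), false)
  | .take s, none =>
    match I s with
    | .pop _ n => (.next (n none), none, true)
    | _ => (.rej, none, true)
  | .take s, some (i, f) =>
    match I s with
    | .pop k n => (.home (n (f (Fin.ofNat (K + 1) k))),
        some (i, Function.update f (Fin.ofNat (K + 1) k) none), false)
    | _ => (.rej, none, true)
  | .home o, none => (.next o, none, true)
  | .home o, some x => (.home o, some x, false)
  | q, c => (q, c, true)

/-- The tape representing a memory, `r` input bits having been read. -/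
def memTape (m : Mem Γ) (r : ℕ) (i : ℤ) : Cell K Γ :=
  if i = -1 then none
  else if 0 ≤ i then
    some (if i.toNat < r then some none else (m.inp[i.toNat - r]?).map some,
      fun k => (m.reg k).reverse[i.toNat]?)
  else some (none, fun _ => none)

theorem memTape_nat (m : Mem Γ) (r j : ℕ) :
    memTape K m r (j : ℕ) = some (if j < r then some none else (m.inp[j - r]?).map some,
      fun k : Fin (K + 1) => (m.reg k).reverse[j]?) := by
  have : ¬ ((j : ℤ) = -1) := by omega
  simp [memTape, this]

theorem memTape_neg (m : Mem Γ) (r : ℕ) : memTape K m r (-1) = none := by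
  simp [memTape]

variable {K}

theorem memTape_update {m m' : Mem Γ} {r r' j : ℕ} {c : Cell K Γ}
    (h : memTape K m' r' (j : ℕ) = c)
    (h' : ∀ i : ℕ, i ≠ j → memTape K m' r' (i : ℕ) = memTape K m r (i : ℕ)) :
    Function.update (memTape K m r) (j : ℕ) c = memTape K m' r' := by
  funext i
  rw [Function.update_apply]
  split_ifs with hi
  · rw [hi, h]
  · by_cases h0 : 0 ≤ i
    · lift i to ℕ using h0
      exact (h' i (by exact_mod_cast hi)).symm
    · have h0' : ¬ (0 ≤ i) := h0
      simp [memTape, h0']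

theorem memTape_push (m : Mem Γ) (r k : ℕ) (a : Γ) (hk : k ≤ K) :
    Function.update (memTape K m r) ((m.reg k).length : ℕ)
      (some (if (m.reg k).length < r then some none else (m.inp[(m.reg k).length - r]?).map some,
        Function.update (fun i : Fin (K + 1) => (m.reg i).reverse[(m.reg k).length]?)
          (Fin.ofNat (K + 1) k) (some a))) = memTape K (m.set k (a :: m.reg k)) r := by
  have hv : ((Fin.ofNat (K + 1) k : Fin (K + 1)) : ℕ) = k := by simp; omega
  apply memTape_update
  · rw [memTape_nat]
    refine congrArg some (Prod.ext rfl ?_)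
    funext i
    simp only [Mem.set_reg, Function.update_apply, Fin.ext_iff, hv]
    split_ifs
    · rw [List.reverse_cons, List.getElem?_append_right (by simp)]
      simp
    · rfl
  · intro j hj
    rw [memTape_nat, memTape_nat]
    refine congrArg some (Prod.ext rfl ?_)
    funext i
    simp only [Mem.set_reg]
    split_ifs with hi
    · rw [hi, List.reverse_cons, List.getElem?_append]
      split_ifs with hl
      · rfl
      · simp only [List.length_reverse] at hl
        rw [List.getElem?_eq_none, List.getElem?_eq_none]
        · simp; omega
        · simp; omega
    · rfl

theorem memTape_pop (m : Mem Γ) (r k : ℕ) (a : Γ) (l : List Γ) (hm : m.reg k = a :: l)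
    (hk : k ≤ K) :
    Function.update (memTape K m r) (l.length : ℕ)
      (some (if l.length < r then some none else (m.inp[l.length - r]?).map some,
        Function.update (fun i : Fin (K + 1) => (m.reg i).reverse[l.length]?)
          (Fin.ofNat (K + 1) k) none)) = memTape K (m.set k l) r := by
  have hv : ((Fin.ofNat (K + 1) k : Fin (K + 1)) : ℕ) = k := by simp; omega
  apply memTape_update
  · rw [memTape_nat]
    refine congrArg some (Prod.ext rfl ?_)
    funext i
    simp only [Mem.set_reg, Function.update_apply, Fin.ext_iff, hv]
    split_ifs
    · simp
    · rfl
  · intro j hj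
    rw [memTape_nat, memTape_nat]
    refine congrArg some (Prod.ext rfl ?_)
    funext i
    simp only [Mem.set_reg]
    split_ifs with hi
    · rw [hi, hm, List.reverse_cons, List.getElem?_append]
      split_ifs with hl
      · rfl
      · simp only [List.length_reverse] at hl
        rw [List.getElem?_eq_none, List.getElem?_eq_none]
        · simp; omega
        · simp; omega
    · rfl

theorem memTape_read (m : Mem Γ) (r : ℕ) (b : Bool) (l : List Bool) (hm : m.inp = b :: l) :
    Function.update (memTape K m r) (r : ℕ)
      (some (some none, fun i : Fin (K + 1) => (m.reg i).reverse[r]?)) =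
        memTape K ⟨l, m.reg⟩ (r + 1) := by
  apply memTape_update
  · rw [memTape_nat]
    simp
  · intro j hj
    rw [memTape_nat, memTape_nat]
    refine congrArg some (Prod.ext ?_ rfl)
    by_cases hjr : j < r
    · simp [hjr, Nat.lt_succ_of_lt hjr]
    · have h1 : ¬ j < r + 1 := by omega
      have h2 : j - r = (j - (r + 1)) + 1 := by omega
      simp only [hjr, h1, if_false, hm, h2, List.getElem?_cons_succ]

end compile

section compile

variable {S Γ : Type} {K : ℕ}

theorem smTrans_instr (I : S → Instr S Γ) (en : Option S) (s : S) (m : Mem Γ) (r : ℕ)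
    (hK : ∀ k a n, I s = .push k a n → k ≤ K) (hK' : ∀ k n, I s = .pop k n → k ≤ K) (B : ℕ)
    (hB : ∀ k ≤ K, (m.reg k).length ≤ B) (hr : r ≤ B) :
    ∃ u ≤ 2 * B + 2, 1 ≤ u ∧ ∃ r' ≤ r + 1,
      (tapeStep (smTrans K I en) .acc .rej)^[u] (.walk s, memTape K m r, 0) =
        (.next ((I s).exec m).1, memTape K ((I s).exec m).2 r', 0) := by
  have hw : (Ctrl.walk s : Ctrl S) ≠ .acc ∧ (Ctrl.walk s : Ctrl S) ≠ .rej := by simp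
  have ht : (Ctrl.take s : Ctrl S) ≠ .acc ∧ (Ctrl.take s : Ctrl S) ≠ .rej := by simp
  have hh : ∀ o, (Ctrl.home o : Ctrl S) ≠ .acc ∧ (Ctrl.home o : Ctrl S) ≠ .rej := by simp
  have back : ∀ (o : Option S) (m' : Mem Γ) (r' : ℕ) (n : ℕ),
      (tapeStep (smTrans K I en) .acc .rej)^[n + 1] (.home o, memTape K m' r', (n : ℤ) - 1) =
        (.next o, memTape K m' r', 0) := by
    intro o m' r' n
    apply tapeStep_home (hh o)
    · intro j hj
      rw [memTape_nat]
      rfl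
    · rw [memTape_neg]
      rfl
  cases hI : I s with
  | push k a n =>
    have hk := hK k a n hI
    have hv : k % (K + 1) = k := Nat.mod_eq_of_lt (by omega)
    have hl := hB k hk
    refine ⟨(m.reg k).length + 1 + 1 + (m.reg k).length, by omega, by omega, r, by omega, ?_⟩
    rw [Function.iterate_add_apply, tapeStep_walk hw, Function.iterate_succ_apply,
      tapeStep_eq hw (q' := .home n) (b := false), memTape_push m r k a hk]
    · exact back _ _ _ _
    · rw [memTape_nat]
      simp [smTrans, hI, hv]
    · intro j hj
      rw [memTape_nat]
      simp [smTrans, hI, hv, hj]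
  | pop k n =>
    have hk := hK' k n hI
    have hv : k % (K + 1) = k := Nat.mod_eq_of_lt (by omega)
    have hl := hB k hk
    have walk : (tapeStep (smTrans K I en) .acc .rej)^[(m.reg k).length + 1]
        (.walk s, memTape K m r, 0) = (.take s, memTape K m r, ((m.reg k).length : ℤ) - 1) := by
      rw [add_comm, Function.iterate_add_apply, tapeStep_walk hw, Function.iterate_one,
        tapeStep_eq hw (q' := .take s) (b := false) (c := memTape K m r ((m.reg k).length : ℕ)),
        Function.update_eq_self]
      · simp
      · rw [memTape_nat]
        simp [smTrans, hI, hv]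
      · intro j hj
        rw [memTape_nat]
        simp [smTrans, hI, hv, hj]
    cases hm : m.reg k with
    | nil =>
      refine ⟨1 + ((m.reg k).length + 1), by omega, by omega, r, by omega, ?_⟩
      rw [Function.iterate_add_apply, walk, Function.iterate_one]
      have : m.set k [] = m := by rw [← hm, Mem.set_self]
      simp only [hm, List.length_nil, Instr.exec, List.head?_nil, List.tail_nil, this]
      rw [tapeStep_eq ht (q' := .next (n none)) (c := memTape K m r (-1)) (b := true)]
      · simp
      · simp [memTape_neg, smTrans, hI]
    | cons a l =>
      have e : ((m.reg k).length : ℤ) - 1 = (l.length : ℕ) := by simp [hm]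
      refine ⟨l.length + 1 + 1 + ((m.reg k).length + 1), by simp [hm] at hl ⊢; omega,
        by omega, r, by omega, ?_⟩
      rw [Function.iterate_add_apply, walk, e, Function.iterate_succ_apply,
        tapeStep_eq ht (q' := .home (n (some a))) (b := false), memTape_pop m r k a l hm hk]
      · simp only [Instr.exec, hm, List.head?_cons, List.tail_cons]
        exact back _ _ _ _
      · rw [memTape_nat]
        simp [smTrans, hI, hv, hm]
  | read n =>
    refine ⟨r + 1 + 1 + r, by omega, by omega, if m.inp = [] then r else r + 1, by split_ifs <;> omega, ?_⟩
    rw [Function.iterate_add_apply, tapeStep_walk hw, Function.iterate_succ_apply]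
    · cases hm : m.inp with
      | nil =>
        rw [tapeStep_eq hw (q' := .home (n none)) (c := memTape K m r (r : ℕ)) (b := false),
          Function.update_eq_self]
        · have : (⟨[], m.reg⟩ : Mem Γ) = m := by rw [← hm]
          simp only [Instr.exec, hm, List.head?_nil, List.tail_nil, if_true, this]
          exact back _ _ _ _
        · rw [memTape_nat]
          simp [smTrans, hI, hm]
      | cons b l =>
        rw [tapeStep_eq hw (q' := .home (n (some b))) (b := false), memTape_read m r b l hm]
        · simp only [Instr.exec, hm, List.head?_cons, List.tail_cons]
          exact back _ _ _ _
        · rw [memTape_nat]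
          simp [smTrans, hI, hm]
    · intro j hj
      rw [memTape_nat]
      simp [smTrans, hI, hj]

theorem Instr.length_exec_le (i : Instr S Γ) (m : Mem Γ) (B : ℕ) (h : ∀ k, (m.reg k).length ≤ B)
    (k : ℕ) : ((i.exec m).2.reg k).length ≤ B + 1 := by
  have h1 := h k
  cases i with
  | push j a n =>
    simp only [exec, Mem.set_reg]
    split_ifs with e
    · subst e; simp; omega
    · omega
  | pop j n =>
    simp only [exec, Mem.set_reg]
    split_ifs with e
    · subst e; simp; omega
    · omega
  | read n => simp only [exec]; omega

theorem smTrans_run (I : S → Instr S Γ) (en : Option S)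
    (hK : ∀ s k a n, I s = .push k a n → k ≤ K) (hK' : ∀ s k n, I s = .pop k n → k ≤ K)
    (m : Mem Γ) (hm : ∀ k, m.reg k = []) (t : ℕ) :
    ∃ u ≤ 2 * t * (t + 1), ∃ r ≤ t,
      (∀ k, (((smStep I)^[t] (en, m)).2.reg k).length ≤ t) ∧
      (∀ k, (((smStep I)^[t] (en, m)).2.reg k).length ≤ u) ∧
      (tapeStep (smTrans K I en) .acc .rej)^[u] (.next en, memTape K m 0, 0) =
        (.next ((smStep I)^[t] (en, m)).1, memTape K ((smStep I)^[t] (en, m)).2 r, 0) := by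
  induction t with
  | zero => exact ⟨0, by simp, 0, le_rfl, by simp [hm], by simp [hm], rfl⟩
  | succ t ih =>
    obtain ⟨u, hu, r, hr, hl, hlu, hs⟩ := ih
    rw [Function.iterate_succ_apply']
    generalize (smStep I)^[t] (en, m) = c at hl hlu hs
    obtain ⟨o, m'⟩ := c
    cases o with
    | none => exact ⟨u, hu.trans (by nlinarith), r, by omega, fun k => (hl k).trans (by omega), hlu, hs⟩
    | some s =>
      obtain ⟨u', hu', hu1, r', hr', h⟩ := smTrans_instr I en s m' r (hK s) (hK' s) t
        (fun k _ => hl k) hr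
      refine ⟨u' + u, by nlinarith, r', by omega, (I s).length_exec_le m' t hl,
        fun k => ((I s).length_exec_le m' u hlu k).trans (by omega), ?_⟩
      rw [Function.iterate_add_apply, hs]
      exact h

theorem exists_TM_of_prog [Finite Γ] (p : Prog Γ) : ∃ M : TM, ∀ (w : Bitstring) (m' : Mem Γ) (t : ℕ),
    p.Runs ⟨w, fun _ => []⟩ m' t →
      (m'.reg 0 ≠ [] → ∀ τ, 2 * (t + 1) ^ 2 + 3 ≤ τ → tmAccepts M w τ) ∧
      (m'.reg 0 = [] → ∀ τ, ¬ tmAccepts M w τ) ∧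
      ∀ k τ, τ ≤ (m'.reg k).length → ¬ tmAccepts M w τ := by
  classical
  have := p.finite_St
  have := Fintype.ofFinite p.St
  let reg : Instr p.St Γ → ℕ := fun i => match i with
    | .push k _ _ => k
    | .pop k _ => k
    | .read _ => 0
  let K := Finset.univ.sup fun s => reg (p.table s)
  have hK0 : ∀ s, reg (p.table s) ≤ K := fun s =>
    Finset.le_sup (f := fun s => reg (p.table s)) (Finset.mem_univ s)
  have hK : ∀ s k a n, p.table s = .push k a n → k ≤ K := fun s k a n h => by
    simpa [h, reg] using hK0 s
  have hK' : ∀ s k n, p.table s = .pop k n → k ≤ K := fun s k n h => by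
    simpa [h, reg] using hK0 s
  let cell : Option Bool → Cell K Γ := fun o => some (o.map some, fun _ => none)
  obtain ⟨M, hM⟩ := exists_TM_of_tapeStep (smTrans K p.table p.entry) .start0 .acc .rej cell
  refine ⟨M, fun w m' t ⟨t', ht', hp⟩ => ?_⟩
  have h0 : (tapeStep (smTrans K p.table p.entry) .acc .rej)^[2] (.start0, inputTape cell w, 0) =
      (.next p.entry, memTape K ⟨w, fun _ => []⟩ 0, 0) := by
    rw [Function.iterate_succ_apply, Function.iterate_one,
      tapeStep_eq (q := Ctrl.start0) (by simp) (q' := Ctrl.start1)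
        (c := inputTape cell w 0) (b := false) rfl, Function.update_eq_self,
      tapeStep_eq (q := Ctrl.start1) (by simp) (q' := Ctrl.next p.entry) (c := none) (b := true) rfl]
    refine Prod.ext rfl (Prod.ext ?_ rfl)
    funext i
    simp only [Function.update_apply, memTape, inputTape, cell]
    split_ifs with h1 h2 h3 h4 h5 <;> simp_all
  obtain ⟨u, hu, r, hr, -, hlu, hs⟩ := smTrans_run p.table p.entry hK hK' ⟨w, fun _ => []⟩
    (fun _ => rfl) t'
  rw [hp] at hs
  have hfin : (tapeStep (smTrans K p.table p.entry) .acc .rej)^[1 + (u + 2)]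
      (.start0, inputTape cell w, 0) =
        (if m'.reg 0 = [] then .rej else .acc, memTape K m' r, 1) := by
    rw [Function.iterate_add_apply, Function.iterate_add_apply, h0, hs, Function.iterate_one,
      tapeStep_eq (q' := if m'.reg 0 = [] then .rej else .acc) (by simp [Ctrl.next])
        (c := memTape K m' r 0) (b := true), Function.update_eq_self]
    · simp
    · have := memTape_nat K m' r 0
      simp only [Nat.cast_zero] at this
      rw [this]
      simp only [Ctrl.next, Option.elim_none, smTrans]
      cases h : m'.reg 0 <;> simp [h]
  have hfix : ∀ v, (tapeStep (smTrans K p.table p.entry) .acc .rej)^[v]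
      (if m'.reg 0 = [] then .rej else .acc, memTape K m' r, 1) =
        (if m'.reg 0 = [] then .rej else .acc, memTape K m' r, 1) := by
    intro v
    apply Function.iterate_fixed
    split_ifs <;> simp [tapeStep]
  have hlate : ∀ τ, 1 + (u + 2) ≤ τ → ((tapeStep (smTrans K p.table p.entry) .acc .rej)^[τ]
      (.start0, inputTape cell w, 0)).1 = if m'.reg 0 = [] then .rej else .acc := by
    intro τ hτ
    obtain ⟨v, rfl⟩ := Nat.exists_eq_add_of_le' hτ
    rw [Function.iterate_add_apply, hfin, hfix]
  have hstay : ∀ τ v, tmAccepts M w τ → ((tapeStep (smTrans K p.table p.entry) .acc .rej)^[v + τ]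
      (.start0, inputTape cell w, 0)).1 = .acc := by
    intro τ v hacc
    rw [hM] at hacc
    rw [Function.iterate_add_apply]
    generalize (tapeStep (smTrans K p.table p.entry) .acc .rej)^[τ]
      (.start0, inputTape cell w, 0) = c at hacc
    have : tapeStep (smTrans K p.table p.entry) .acc .rej c = c := by simp [tapeStep, hacc]
    rw [Function.iterate_fixed this, hacc]
  refine ⟨fun hne τ hτ => ?_, fun he τ hacc => ?_, fun k τ hτ hacc => ?_⟩
  · have hb : 2 * t' * (t' + 1) ≤ 2 * (t + 1) ^ 2 := by nlinarith
    rw [hM, hlate τ (by omega), if_neg hne]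
  · have h1 := hstay τ (1 + (u + 2)) hacc
    rw [hlate _ (by omega), if_pos he] at h1
    cases h1
  · have h2 := hlu k
    rw [hp] at h2
    obtain ⟨v, hv⟩ := Nat.exists_eq_add_of_le' (show τ ≤ u + 2 by simp only at h2; omega)
    have h1 := hstay τ v hacc
    rw [← hv, Function.iterate_add_apply, h0, hs] at h1
    cases h1

end compile

/-! ## Turing machine configurations as pairs of lists -/

/-- State, tape to the left of the head (reversed) and tape from the head to the right. -/
abbrev LCfg (M : TM) := Fin (M.states + 1) × List (Fin (M.symbols + 3)) × List (Fin (M.symbols + 3))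

def listStep (M : TM) (c : LCfg M) : LCfg M :=
  if c.1 = M.accept ∨ c.1 = M.reject then c
  else
    if (M.trans c.1 (c.2.2.headD M.blank)).2.2 then
      ((M.trans c.1 (c.2.2.headD M.blank)).1,
        (M.trans c.1 (c.2.2.headD M.blank)).2.1 :: c.2.1, c.2.2.tail)
    else ((M.trans c.1 (c.2.2.headD M.blank)).1, c.2.1.tail,
      c.2.1.headD M.blank :: (M.trans c.1 (c.2.2.headD M.blank)).2.1 :: c.2.2.tail)

def listRun (M : TM) (w : Bitstring) (t : ℕ) : LCfg M :=
  (listStep M)^[t] (M.start, [], w.map M.sym)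

structure ListRepr (M : TM) (c : Cfg M) (l : LCfg M) : Prop where
  state : c.state = l.1
  left : ∀ j : ℕ, c.tape (c.head - 1 - j) = l.2.1.getD j M.blank
  right : ∀ j : ℕ, c.tape (c.head + j) = l.2.2.getD j M.blank

theorem getD_tail {α : Type*} (l : List α) (j : ℕ) (a : α) :
    l.tail.getD j a = l.getD (j + 1) a := by
  cases l <;> rfl

theorem headD_eq_getD {α : Type*} (l : List α) (a : α) : l.headD a = l.getD 0 a := by
  cases l <;> rfl

theorem ListRepr.step {M : TM} {c : Cfg M} {l : LCfg M} (h : ListRepr M c l) :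
    ListRepr M (stepCfg M c) (listStep M l) := by
  obtain ⟨h1, h2, h3⟩ := h
  have h0 : c.tape c.head = l.2.2.headD M.blank := by
    rw [headD_eq_getD, ← h3]
    simp
  unfold stepCfg listStep
  rw [h1, h0]
  split_ifs with hc hd
  · exact ⟨h1, h2, h3⟩
  · simp only [hd, if_true]
    refine ⟨rfl, fun j => ?_, fun j => ?_⟩
    · cases j with
      | zero => simp
      | succ j =>
        have e : c.head + 1 - 1 - ((j + 1 : ℕ) : ℤ) = c.head - 1 - j := by push_cast; ring
        have e' : c.head - 1 - j ≠ c.head := by omega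
        simp only [e, e', if_false]
        rw [h2]
        rfl
    · have e : c.head + 1 + (j : ℤ) = c.head + ((j + 1 : ℕ) : ℤ) := by push_cast; ring
      have e' : c.head + ((j + 1 : ℕ) : ℤ) ≠ c.head := by omega
      simp only [e, e', if_false]
      rw [getD_tail, h3]
  · simp only [hd]
    refine ⟨rfl, fun j => ?_, fun j => ?_⟩
    · have e : c.head - 1 - 1 - (j : ℤ) = c.head - 1 - ((j + 1 : ℕ) : ℤ) := by push_cast; ring
      have e' : c.head - 1 - ((j + 1 : ℕ) : ℤ) ≠ c.head := by omega
      simp only [e, e', if_false, Bool.false_eq_true]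
      rw [getD_tail, h2]
    · rcases j with _ | _ | j
      · have e' : c.head - 1 ≠ c.head := by omega
        have := h2 0
        simp only [Nat.cast_zero, sub_zero] at this
        simp only [Nat.cast_zero, add_zero, e', if_false, Bool.false_eq_true, this,
          List.getD_cons_zero, headD_eq_getD]
      · simp
      · have e : c.head - 1 + ((j + 1 + 1 : ℕ) : ℤ) = c.head + ((j + 1 : ℕ) : ℤ) := by
          push_cast; ring
        have e' : c.head + ((j + 1 : ℕ) : ℤ) ≠ c.head := by omega
        simp only [e, e', if_false, Bool.false_eq_true, List.getD_cons_succ]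
        rw [getD_tail, h3]

theorem listRepr_run (M : TM) (w : Bitstring) (t : ℕ) :
    ListRepr M (runTM M w t) (listRun M w t) := by
  induction t with
  | zero =>
    refine ⟨rfl, fun j => ?_, fun j => ?_⟩
    · have : ¬ ((0 : ℤ) ≤ 0 - 1 - (j : ℤ)) := by omega
      simp only [runTM, initCfg, listRun, Function.iterate_zero, id_eq, this, false_and, if_false]
      rfl
    · simp only [runTM, initCfg, listRun, Function.iterate_zero, id_eq, zero_add,
        Nat.cast_nonneg, Nat.cast_lt, true_and, Int.toNat_natCast, List.getD_eq_getElem?_getD,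
        List.getElem?_map]
      split_ifs with hj
      · simp [hj]
      · simp [hj]
  | succ t ih =>
    rw [runTM, listRun, Function.iterate_succ_apply', Function.iterate_succ_apply']
    exact ih.step

theorem tmAccepts_iff (M : TM) (w : Bitstring) (t : ℕ) :
    tmAccepts M w t ↔ (listRun M w t).1 = M.accept := by
  rw [tmAccepts, (listRepr_run M w t).state]

/-! ## A library of program fragments -/

section

variable {Γ : Type}

/-- The memory with unread input `inp`, and with nonempty stacks only among the first ones,
listed in `rs`. -/
def mem (inp : List Bool) (rs : List (List Γ)) : Mem Γ := ⟨inp, fun k => rs.getD k []⟩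

@[simp] theorem mem_inp (inp : List Bool) (rs : List (List Γ)) : (mem inp rs).inp = inp := rfl

@[simp] theorem mem_reg (inp : List Bool) (rs : List (List Γ)) (k : ℕ) :
    (mem inp rs).reg k = rs.getD k [] := rfl

theorem mem_set (inp : List Bool) (rs : List (List Γ)) (k : ℕ) (l : List Γ) (h : k < rs.length) :
    (mem inp rs).set k l = mem inp (rs.set k l) := by
  refine Mem.ext rfl ?_
  funext j
  simp only [Mem.set, mem, Function.update_apply, List.getD_eq_getElem?_getD, List.getElem?_set]
  by_cases hj : j = k
  · subst hj
    simp [h]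
  · simp [hj, Ne.symm hj]

theorem mem_replicate (inp : List Bool) (n : ℕ) :
    (mem inp (List.replicate n []) : Mem Γ) = ⟨inp, fun _ => []⟩ := by
  refine Mem.ext rfl ?_
  funext j
  simp only [mem, List.getD_eq_getElem?_getD, List.getElem?_replicate]
  split_ifs <;> rfl

theorem Mem.set_set (m : Mem Γ) (k : ℕ) (l l' : List Γ) : (m.set k l).set k l' = m.set k l' := by
  simp [Mem.set]

theorem Mem.set_comm (m : Mem Γ) {j k : ℕ} (h : j ≠ k) (l l' : List Γ) :
    (m.set j l).set k l' = (m.set k l').set j l := by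
  simp [Mem.set, Function.update_comm h]

namespace Prog

theorem Runs.of_eq {p : Prog Γ} {m m' m₁ m₁' : Mem Γ} {t : ℕ} (h : p.Runs m m' t) (e : m₁ = m)
    (e' : m' = m₁') : p.Runs m₁ m₁' t := by
  rw [e, ← e']
  exact h

theorem runs_push' {k : ℕ} {a : Γ} {inp : List Bool} {rs : List (List Γ)} (h : k < rs.length) :
    (push k a).Runs (mem inp rs) (mem inp (rs.set k (a :: rs.getD k []))) 1 := by
  rw [← mem_set _ _ _ _ h]
  exact runs_push k a _

theorem runs_pop' {k : ℕ} {f : Option Γ → Prog Γ} {inp : List Bool} {rs : List (List Γ)}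
    {m' : Mem Γ} {t : ℕ} (hk : k < rs.length)
    (h : (f (rs.getD k []).head?).Runs (mem inp (rs.set k (rs.getD k []).tail)) m' t) :
    (pop k f).Runs (mem inp rs) m' (t + 1) := by
  apply runs_pop
  rw [mem_set _ _ _ _ hk]
  exact h

theorem runs_loop_fold {σ : Type*} {k : ℕ} {f : Γ → Prog Γ} (F : σ → List Γ → Mem Γ)
    (g : σ → Γ → σ) (t : ℕ) (I : σ → List Γ → Prop) (hF : ∀ s l, (F s l).reg k = l)
    (hb : ∀ s a l, I s (a :: l) → (f a).Runs ((F s (a :: l)).set k l) (F (g s a) l) t ∧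
      I (g s a) l) (l : List Γ) :
    ∀ s, I s l → (loop k f).Runs (F s l) (F (l.foldl g s) []) (l.length * (t + 1) + 1) := by
  induction l with
  | nil =>
    intro s _
    exact (runs_loop_nil (hF s [])).mono (by simp)
  | cons a l ih =>
    intro s hs
    obtain ⟨h1, h2⟩ := hb s a l hs
    refine (runs_loop_cons (hF s (a :: l)) h1 (ih _ h2)).mono ?_
    rw [List.length_cons]
    linarith

/-- A loop over a stack containing `n` copies of a symbol. -/
theorem runs_loop_nat {k : ℕ} {p : Prog Γ} {u : Γ} (F : ℕ → ℕ → Mem Γ) (t n : ℕ)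
    (hF : ∀ i j, i + j = n → (F i j).reg k = List.replicate j u)
    (hb : ∀ i j, i + j + 1 = n →
      p.Runs ((F i (j + 1)).set k (List.replicate j u)) (F (i + 1) j) t) :
    (loop k fun _ => p).Runs (F 0 n) (F n 0) (n * (t + 1) + 1) := by
  have key : ∀ j i, i + j = n →
      (loop k fun _ => p).Runs (F i j) (F n 0) (j * (t + 1) + 1) := by
    intro j
    induction j with
    | zero =>
      intro i hi
      obtain rfl : i = n := by omega
      exact (runs_loop_nil (hF i 0 hi)).mono (by simp)
    | succ j ih =>
      intro i hi
      refine (runs_loop_cons (f := fun _ => p) (hF i (j + 1) hi) (hb i j (by omega))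
        (ih (i + 1) (by omega))).mono ?_
      linarith
  exact key n 0 (by omega)

/-- Move stack `a` onto stack `b`, which reverses it. -/
def move (a b : ℕ) : Prog Γ := loop a fun x => push b x

theorem runs_move {a b : ℕ} (hab : a ≠ b) (m : Mem Γ) :
    (move a b).Runs m ((m.set a []).set b ((m.reg a).reverse ++ m.reg b))
      (2 * (m.reg a).length + 1) := by
  have := runs_loop_fold (k := a) (f := fun x => push b x)
    (fun s l => (m.set a l).set b s) (fun s x => x :: s) 1 (fun _ _ => True)
    (fun s l => by simp [Mem.set_reg, hab])
    (fun s x l _ => ⟨(runs_push b x _).of_eq rfl (by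
      rw [Mem.set_reg, if_neg hab.symm, Mem.set_reg, if_pos rfl, Mem.set_comm _ hab.symm,
        Mem.set_set, Mem.set_set]), trivial⟩) (m.reg a) (m.reg b) trivial
  refine (this.of_eq ?_ ?_).mono (by omega)
  · rw [Mem.set_self, Mem.set_self]
  · congr 1
    exact List.foldl_flip_cons_eq_append'

theorem runs_move' {a b : ℕ} (hab : a ≠ b) {inp : List Bool} {rs : List (List Γ)}
    (ha : a < rs.length) (hb : b < rs.length) :
    (move a b).Runs (mem inp rs)
      (mem inp ((rs.set a []).set b ((rs.getD a []).reverse ++ rs.getD b [])))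
      (2 * (rs.getD a []).length + 1) := by
  have := runs_move hab (mem inp rs)
  rwa [mem_set _ _ _ _ ha, mem_set _ _ _ _ (by simpa using hb)] at this

/-- Skip `j` input bits. -/
def skipBits : ℕ → Prog Γ
  | 0 => skip
  | j + 1 => read fun _ => skipBits j

theorem runs_skipBits (j : ℕ) (inp : List Bool) (R : ℕ → List Γ) :
    (skipBits j).Runs ⟨inp, R⟩ ⟨inp.drop j, R⟩ j := by
  induction j generalizing inp with
  | zero => exact runs_skip _
  | succ j ih =>
    apply runs_read
    have := ih inp.tail
    rwa [List.drop_tail] at this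

/-- Read a block of `2 * (r + 1)` bits: a block of equal bits is a data bit, and anything else
(including the end of the input) is a stop mark. -/
def block (r : ℕ) (f : Option Bool → Prog Γ) : Prog Γ :=
  read fun a => (skipBits r).seq (read fun b => (skipBits r).seq (f (if a = b then a else none)))

def rep (r : ℕ) (b : Bool) : List Bool := List.replicate (r + 1) b

def encWord (r : ℕ) : List Bool → List Bool
  | [] => []
  | b :: l => rep r b ++ rep r b ++ encWord r l

def stopMark (r : ℕ) : List Bool := rep r true ++ rep r false

theorem runs_block_aux (r : ℕ) (f : Option Bool → Prog Γ) (a b : Bool) (inp : List Bool)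
    (R : ℕ → List Γ) {m' : Mem Γ} {t : ℕ}
    (h : (f (if a = b then some a else none)).Runs ⟨inp, R⟩ m' t) :
    (block r f).Runs ⟨rep r a ++ rep r b ++ inp, R⟩ m' (t + 2 * r + 2) := by
  have h1 : ∀ (c : Bool) (l : List Bool), (rep r c ++ l).head? = some c := fun c l => rfl
  have h2 : ∀ (c : Bool) (l : List Bool), ((rep r c ++ l).tail).drop r = l := by
    intro c l
    simp [rep, List.replicate_succ]
  refine (runs_read (t := r + (r + t + 1)) ?_).mono (by omega)
  simp only [List.append_assoc, h1]
  refine (runs_skipBits r _ R).seq ?_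
  rw [h2]
  apply runs_read
  simp only [h1]
  refine (runs_skipBits r _ R).seq ?_
  rw [h2]
  simpa using h

theorem runs_block_data {r : ℕ} {f : Option Bool → Prog Γ} {b : Bool} {inp : List Bool}
    {R : ℕ → List Γ} {m' : Mem Γ} {t : ℕ} (h : (f (some b)).Runs ⟨inp, R⟩ m' t) :
    (block r f).Runs ⟨rep r b ++ rep r b ++ inp, R⟩ m' (t + 2 * r + 2) :=
  runs_block_aux r f b b inp R (by simpa using h)

/-- `IsStop r s inp`: reading a block of `s` gives a stop mark, and leaves the input `inp`. -/
def IsStop (r : ℕ) (s inp : List Bool) : Prop := s = stopMark r ++ inp ∨ (s = [] ∧ inp = [])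

theorem runs_block_mark {r : ℕ} {f : Option Bool → Prog Γ} {s inp : List Bool}
    (hs : IsStop r s inp)
    {R : ℕ → List Γ} {m' : Mem Γ} {t : ℕ} (h : (f none).Runs ⟨inp, R⟩ m' t) :
    (block r f).Runs ⟨s, R⟩ m' (t + 2 * r + 2) := by
  rcases hs with rfl | ⟨rfl, rfl⟩
  · exact runs_block_aux r f true false inp R (by simpa using h)
  · refine (runs_read (t := r + (r + t + 1)) ?_).mono (by omega)
    refine (runs_skipBits r _ R).seq ?_
    apply runs_read
    refine (runs_skipBits r _ R).seq ?_
    simpa using h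

/-- Read blocks until a stop mark, running `g b` for every data bit `b`. -/
def readAll (r fl : ℕ) (u : Γ) (g : Bool → Prog Γ) : Prog Γ :=
  (push fl u).seq (loop fl fun _ => block r fun o =>
    o.elim skip fun b => (g b).seq (push fl u))

theorem runs_readAll {σ : Type*} {r fl : ℕ} {u : Γ} {g : Bool → Prog Γ} {s inp : List Bool}
    (hs : IsStop r s inp) (R : σ → ℕ → List Γ) (st : σ → Bool → σ) (t : ℕ)
    (hfl : ∀ x, R x fl = [])
    (hg : ∀ x b inp, (g b).Runs ⟨inp, R x⟩ ⟨inp, R (st x b)⟩ t) (l : List Bool) (x : σ) :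
    (readAll r fl u g).Runs ⟨encWord r l ++ s, R x⟩ ⟨inp, R (l.foldl st x)⟩
      ((l.length + 1) * (t + 2 * r + 5)) := by
  have hpush : ∀ x inp, (push fl u).Runs ⟨inp, R x⟩ ⟨inp, Function.update (R x) fl [u]⟩ 1 := by
    intro x inp
    have := runs_push fl u ⟨inp, R x⟩
    simpa [Mem.set, hfl] using this
  have hset : ∀ x inp, (⟨inp, Function.update (R x) fl [u]⟩ : Mem Γ).set fl [] = ⟨inp, R x⟩ := by
    intro x inp
    simp only [Mem.set, Function.update_idem, Mem.mk.injEq, true_and]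
    rw [← hfl x, Function.update_eq_self]
  have key : ∀ (l : List Bool) (x : σ), (loop fl fun _ => block r fun o =>
      o.elim skip fun b => (g b).seq (push fl u)).Runs
      ⟨encWord r l ++ s, Function.update (R x) fl [u]⟩ ⟨inp, R (l.foldl st x)⟩
      (l.length * (t + 2 * r + 4) + 2 * r + 4) := by
    intro l
    induction l with
    | nil =>
      intro x
      refine (runs_loop_cons (a := u) (l := []) (by simp) (t := 0 + 2 * r + 2) (u := 1) ?_
        (runs_loop_nil (hfl x))).mono (by omega)
      rw [hset]
      exact runs_block_mark hs (runs_skip _)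
    | cons b l ih =>
      intro x
      refine (runs_loop_cons (a := u) (l := []) (by simp) (t := t + 1 + 2 * r + 2) ?_
        (ih (st x b))).mono (by simp only [List.length_cons]; linarith)
      rw [hset, encWord, List.append_assoc]
      exact runs_block_data ((hg x b _).seq (hpush _ _))
  refine ((hpush x _).seq (key l x)).mono ?_
  nlinarith

theorem encodeBits_append (x y : Bitstring) :
    encodeBits (x ++ y) = encodeBits x ++ encodeBits y := by
  induction x with
  | nil => rfl
  | cons b x ih => simp [encodeBits, ih]

theorem encodeBits_eq (x : Bitstring) : encodeBits x = encWord 0 x := by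
  induction x with
  | nil => rfl
  | cons b x ih => simp [encodeBits, encWord, rep, ih]

theorem encodeBits_rep (r : ℕ) (b : Bool) : encodeBits (rep r b) = rep (2 * r + 1) b := by
  simp only [rep]
  induction r with
  | zero => rfl
  | succ r ih =>
    rw [List.replicate_succ, encodeBits, ih]
    rfl

theorem encodeBits_encWord (r : ℕ) (x : Bitstring) :
    encodeBits (encWord r x) = encWord (2 * r + 1) x := by
  induction x with
  | nil => rfl
  | cons b x ih => simp [encWord, encodeBits_append, encodeBits_rep, ih]

theorem encodeBits_stopMark (r : ℕ) : encodeBits (stopMark r) = stopMark (2 * r + 1) := by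
  simp [stopMark, encodeBits_append, encodeBits_rep]

theorem pair_eq (x y : Bitstring) : pair x y = encWord 0 x ++ (stopMark 0 ++ encodeBits y) := by
  rw [pair, encodeBits_eq, List.append_assoc]
  rfl

end Prog

end

/-! ## Evaluating a CNF formula given as a string -/

/-- The state of the evaluation: the unread and the read (reversed) part of the assignment, whether
the current clause is already satisfied, whether an error or an unsatisfied clause has been found,
and whether a clause has been completed. -/
structure CnfSt where
  front : List Bool
  back : List Bool
  flag : Bool
  dead : Bool
  done : Bool

def CnfSt.lit (s : CnfSt) (p q : Bool) : CnfSt :=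
  match s.front with
  | [] => { s with dead := true }
  | v :: l => { s with front := l, back := v :: s.back, flag := s.flag || ((p && v) || (q && !v)) }

def CnfSt.close (s : CnfSt) : CnfSt :=
  { front := s.back.reverse ++ s.front.tail, back := [], flag := false
    dead := s.dead || !(s.front.isEmpty && s.flag), done := true }

def CnfSt.tok (s : CnfSt) (p q : Bool) : CnfSt := if p && q then s.close else s.lit p q

def CnfSt.run : List Bool → CnfSt → CnfSt
  | [], s => s
  | [_], s => { s with dead := true }
  | p :: q :: l, s => run l (s.tok p q)

/-- Every two bits of the advice say whether the next variable occurs positively and negatively in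
the current clause; `11` ends the clause. -/
def check (v a : List Bool) : Bool :=
  (CnfSt.run a ⟨v, [], false, false, false⟩).done && !(CnfSt.run a ⟨v, [], false, false, false⟩).dead

theorem CnfSt.dead_run (a : List Bool) (s : CnfSt) (h : s.dead = true) : (run a s).dead = true := by
  induction a, s using CnfSt.run.induct with
  | case1 s => exact h
  | case2 => rfl
  | case3 p q l s ih =>
    apply ih
    unfold tok lit close
    split_ifs
    · simp [h]
    · split <;> simp [h]

theorem CnfSt.length_front_le (a : List Bool) (s : CnfSt) (h : s.done = false)
    (h1 : (run a s).done = true) (h2 : (run a s).dead = false) : s.front.length ≤ a.length := by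
  induction a, s using CnfSt.run.induct with
  | case1 s => simp [run, h] at h1
  | case2 => simp [run] at h2
  | case3 p q l s ih =>
    cases hf : s.front with
    | nil => simp
    | cons v f =>
      rw [run] at h1 h2
      by_cases hpq : (p && q) = true
      · have := dead_run l (s.tok p q) (by simp [tok, hpq, close, hf])
        rw [h2] at this
        cases this
      · have := ih (by simp [tok, hpq, lit, hf, h]) h1 h2
        simp [tok, hpq, lit, hf] at this
        simp
        omega

theorem length_le_of_check {v a : List Bool} (h : check v a = true) : v.length ≤ a.length := by
  simp only [check, Bool.and_eq_true, Bool.not_eq_true'] at h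
  exact CnfSt.length_front_le a ⟨v, [], false, false, false⟩ rfl h.1 h.2

def encClause (c : List (Bool × Bool)) : List Bool := (c.flatMap fun l => [l.1, l.2]) ++ [true, true]

def SatClause (c : List (Bool × Bool)) (v : List Bool) : Prop :=
  ∃ l ∈ c.zip v, (l.1.1 && l.2 || l.1.2 && !l.2) = true

theorem CnfSt.run_lits (c : List (Bool × Bool)) (hc : ∀ l ∈ c, (l.1 && l.2) = false)
    (v w a : List Bool) (hv : v.length = c.length) (b : List Bool) (f de dn : Bool) :
    run ((c.flatMap fun l => [l.1, l.2]) ++ a) ⟨v ++ w, b, f, de, dn⟩ =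
      run a ⟨w, v.reverse ++ b,
        f || (c.zip v).any fun l => (l.1.1 && l.2 || l.1.2 && !l.2), de, dn⟩ := by
  induction c generalizing v b f with
  | nil =>
    obtain rfl : v = [] := by simpa using hv
    simp
  | cons l c ih =>
    cases v with
    | nil => simp at hv
    | cons x v =>
      have hl := hc l (by simp)
      simp only [List.flatMap_cons, List.cons_append, List.nil_append, run, tok, hl, lit,
        Bool.false_eq_true, if_false]
      rw [ih (fun l hl => hc l (by simp [hl])) v (by simpa using hv)]
      simp [Bool.or_assoc]

theorem CnfSt.run_clause (c : List (Bool × Bool)) (hc : ∀ l ∈ c, (l.1 && l.2) = false)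
    (v a : List Bool) (hv : v.length = c.length) (de dn : Bool) :
    run (encClause c ++ a) ⟨v, [], false, de, dn⟩ = run a ⟨v, [], false,
        de || !(c.zip v).any fun l => (l.1.1 && l.2 || l.1.2 && !l.2), true⟩ := by
  have := run_lits c hc v [] ([true, true] ++ a) hv [] false de dn
  rw [List.append_nil] at this
  rw [encClause, List.append_assoc, this]
  simp [run, tok, close]

theorem CnfSt.dead_clause (c : List (Bool × Bool)) (hc : ∀ l ∈ c, (l.1 && l.2) = false)
    (v a : List Bool) (hv : v.length ≠ c.length) (de dn : Bool) :
    (run (encClause c ++ a) ⟨v, [], false, de, dn⟩).dead = true := by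
  rw [encClause, List.append_assoc]
  rcases lt_or_gt_of_ne hv with h | h
  · have hc' := List.take_append_drop v.length c
    have h2 := run_lits (c.take v.length) (fun l hl => hc l (List.mem_of_mem_take hl)) v []
      (((c.drop v.length).flatMap fun l => [l.1, l.2]) ++ ([true, true] ++ a)) (by simp; omega)
      [] false de dn
    rw [← List.append_assoc, ← List.flatMap_append, hc', List.append_nil] at h2
    rw [h2]
    cases hd : c.drop v.length with
    | nil => simp at hd; omega
    | cons l d =>
      have hl := hc l (List.mem_of_mem_drop (i := v.length) (by simp [hd]))
      simp only [List.flatMap_cons, List.cons_append, List.nil_append, run, tok, hl, lit,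
        Bool.false_eq_true, if_false]
      exact dead_run _ _ rfl
  · have hv' := List.take_append_drop c.length v
    rw [← hv', run_lits c hc _ _ _ (by simp; omega)]
    simp only [List.cons_append, List.nil_append, run, tok, Bool.and_self, if_true]
    apply dead_run
    cases hd : v.drop c.length with
    | nil => simp at hd; omega
    | cons x d => simp [close]

theorem CnfSt.run_clauses (cs : List (List (Bool × Bool))) (L : ℕ)
    (hc : ∀ c ∈ cs, c.length = L ∧ ∀ l ∈ c, (l.1 && l.2) = false) (v : List Bool)
    (hv : v.length = L) (de dn : Bool) :
    ((run (cs.flatMap encClause) ⟨v, [], false, de, dn⟩).dead = false ↔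
      de = false ∧ ∀ c ∈ cs, SatClause c v) ∧
    (run (cs.flatMap encClause) ⟨v, [], false, de, dn⟩).done = (dn || !cs.isEmpty) := by
  induction cs generalizing de dn with
  | nil => simp [run]
  | cons c cs ih =>
    obtain ⟨h1, h2⟩ := hc c (by simp)
    have h3 := ih (fun c hc' => hc c (by simp [hc']))
    rw [List.flatMap_cons, run_clause c h2 v _ (by rw [hv, h1])]
    refine ⟨(h3 _ _).1.trans ?_, (h3 _ _).2.trans (by simp)⟩
    simp only [Bool.or_eq_false_iff, Bool.not_eq_false', List.any_eq_true, List.forall_mem_cons,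
      and_assoc]
    rfl

theorem check_clauses (cs : List (List (Bool × Bool))) (L : ℕ) (h0 : cs ≠ [])
    (hc : ∀ c ∈ cs, c.length = L ∧ ∀ l ∈ c, (l.1 && l.2) = false) (v : List Bool) :
    check v (cs.flatMap encClause) = true ↔ v.length = L ∧ ∀ c ∈ cs, SatClause c v := by
  by_cases hv : v.length = L
  · obtain ⟨h1, h2⟩ := CnfSt.run_clauses cs L hc v hv false false
    rw [check, h2, Bool.and_eq_true, Bool.not_eq_true', h1]
    simp [hv, h0]
  · obtain ⟨c, cs, rfl⟩ := List.exists_cons_of_ne_nil h0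
    obtain ⟨h1, h2⟩ := hc c (by simp)
    have := CnfSt.dead_clause c h2 v (cs.flatMap encClause) (by rwa [h1]) false false
    simp [check, this, hv]

namespace Prog

def flagList (b : Bool) : List Bool := if b then [true] else []

def setFlag (k : ℕ) : Prog Bool := pop k fun _ => push k true

def cnfMem (inp a : List Bool) (s : CnfSt) : Mem Bool :=
  mem inp [[], s.front, a, s.back, flagList s.flag, flagList s.dead, flagList s.done, []]

theorem runs_setFlag {k : ℕ} {inp : List Bool} {rs : List (List Bool)} (hk : k < rs.length)
    {b : Bool} (h : rs.getD k [] = flagList b) :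
    (setFlag k).Runs (mem inp rs) (mem inp (rs.set k [true])) 2 := by
  refine runs_pop' hk ((runs_push' (by simpa using hk)).of_eq rfl ?_)
  rw [h]
  simp only [List.set_set]
  congr 2
  cases b <;> simp [flagList, hk]

/-- The program for `CnfSt.tok`. -/
def tokProg (p q : Bool) : Prog Bool :=
  if p && q then
    (pop 1 fun o => o.elim skip fun _ => setFlag 5).seq
      ((pop 4 fun o => o.elim (setFlag 5) fun _ => skip).seq ((setFlag 6).seq (move 3 1)))
  else
    pop 1 fun o => o.elim (setFlag 5) fun v =>
      (push 3 v).seq (if p && v || q && !v then setFlag 4 else skip)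

theorem runs_tokProg (p q : Bool) (inp a : List Bool) (s : CnfSt) :
    (tokProg p q).Runs (cnfMem inp a s) (cnfMem inp a (s.tok p q)) (2 * s.back.length + 10) := by
  obtain ⟨f, b, fl, de, dn⟩ := s
  unfold tokProg CnfSt.tok
  by_cases hpq : (p && q) = true
  · rw [if_pos hpq, if_pos hpq]
    have h1 : (pop 1 fun o => o.elim skip fun _ => setFlag 5).Runs (cnfMem inp a ⟨f, b, fl, de, dn⟩)
        (cnfMem inp a ⟨f.tail, b, fl, de || !f.isEmpty, dn⟩) 3 := by
      refine runs_pop' (by simp) (t := 2) ?_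
      cases f with
      | nil => exact (runs_skip _).of_eq rfl (by simp [cnfMem]) |>.mono (by omega)
      | cons v f =>
        exact (runs_setFlag (b := de) (by simp) rfl).of_eq rfl (by simp [cnfMem, flagList])
    have h2 : (pop 4 fun o => o.elim (setFlag 5) fun _ => skip).Runs
        (cnfMem inp a ⟨f.tail, b, fl, de || !f.isEmpty, dn⟩)
        (cnfMem inp a ⟨f.tail, b, false, (de || !f.isEmpty) || !fl, dn⟩) 3 := by
      refine runs_pop' (by simp) (t := 2) ?_
      cases fl with
      | true => exact (runs_skip _).of_eq rfl (by simp [cnfMem, flagList]) |>.mono (by omega)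
      | false =>
        exact (runs_setFlag (b := de || !f.isEmpty) (by simp) rfl).of_eq rfl
          (by simp [cnfMem, flagList])
    have h3 : (setFlag 6).Runs (cnfMem inp a ⟨f.tail, b, false, (de || !f.isEmpty) || !fl, dn⟩)
        (cnfMem inp a ⟨f.tail, b, false, (de || !f.isEmpty) || !fl, true⟩) 2 :=
      (runs_setFlag (b := dn) (by simp) rfl).of_eq rfl (by simp [cnfMem, flagList])
    refine ((h1.seq (h2.seq (h3.seq (runs_move' (by simp) (by simp) (by simp))))).of_eq rfl
      ?_).mono ?_
    · simp [cnfMem, CnfSt.close, flagList, Bool.or_assoc, Bool.not_and]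
    · simp; omega
  · rw [if_neg hpq, if_neg hpq]
    refine (runs_pop' (by simp) (t := 3) ?_).mono (by omega)
    cases f with
    | nil =>
      exact (runs_setFlag (b := de) (by simp) rfl).of_eq rfl
        (by simp only [cnfMem, CnfSt.lit]; rfl) |>.mono (by omega)
    | cons v f =>
      refine (runs_push' (by simp)).seq (u := 2) ?_
      by_cases h : (p && v || q && !v) = true
      · rw [if_pos h]
        exact (runs_setFlag (b := fl) (by simp) rfl).of_eq rfl
          (by simp [cnfMem, flagList, CnfSt.lit, h])
      · rw [if_neg h]
        exact (runs_skip _).of_eq rfl (by simp [cnfMem, flagList, CnfSt.lit, h]) |>.mono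
          (by omega)

theorem length_tok_le (s : CnfSt) (p q : Bool) (L : ℕ) (h : s.back.length + s.front.length ≤ L) :
    (s.tok p q).back.length + (s.tok p q).front.length ≤ L := by
  obtain ⟨f, b, fl, de, dn⟩ := s
  unfold CnfSt.tok CnfSt.lit CnfSt.close
  simp only at h
  split_ifs
  · simp; omega
  · cases f
    · simpa using h
    · simp at h ⊢; omega

def tokLoop : Prog Bool := loop 2 fun p => pop 2 fun o => o.elim (setFlag 5) fun q => tokProg p q

theorem runs_tokLoop (inp a : List Bool) (s : CnfSt) (L : ℕ)
    (hL : s.back.length + s.front.length ≤ L) :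
    tokLoop.Runs (cnfMem inp a s) (cnfMem inp [] (CnfSt.run a s)) (a.length * (2 * L + 12) + 1) := by
  induction a, s using CnfSt.run.induct with
  | case1 s => exact (runs_loop_nil rfl).mono (by simp)
  | case2 p s =>
    refine (runs_loop_cons (a := p) (l := []) rfl (t := 2 + 1) (u := 1)
      (m₁ := cnfMem inp [] { s with dead := true }) ?_ (runs_loop_nil rfl)).mono
        (by simp only [List.length_singleton]; omega)
    rw [cnfMem, mem_set _ _ _ _ (by simp)]
    refine runs_pop' (by simp) ?_
    exact (runs_setFlag (b := s.dead) (by simp) rfl).of_eq rfl (by simp [cnfMem, flagList])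
  | case3 p q l s ih =>
    refine (runs_loop_cons (a := p) (l := q :: l) rfl (t := 2 * s.back.length + 10 + 1)
      (m₁ := cnfMem inp l (s.tok p q)) ?_ (ih (length_tok_le s p q L hL))).mono ?_
    · rw [cnfMem, mem_set _ _ _ _ (by simp)]
      refine runs_pop' (by simp) ?_
      exact (runs_tokProg p q inp l s).of_eq (by simp [cnfMem]) rfl
    · simp only [List.length_cons]
      nlinarith

/-- Evaluate the formula given by the second component of the input. -/
def cnfProg : Prog Bool :=
  (readAll 0 7 true (push 3)).seq ((readAll 1 7 true (push 4)).seq ((readAll 1 7 true (push 3)).seq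
    ((move 3 1).seq ((move 4 2).seq (tokLoop.seq
      (pop 6 fun o => o.elim skip fun _ => pop 5 fun o => o.elim (push 0 true) fun _ => skip))))))

theorem pair_pair (x a y : Bitstring) :
    pair x (pair a y) =
      encWord 0 x ++ (stopMark 0 ++ (encWord 1 a ++ (stopMark 1 ++ encWord 1 y))) := by
  rw [pair_eq, pair_eq, encodeBits_append, encodeBits_append, encodeBits_encWord,
    encodeBits_stopMark, encodeBits_eq y, encodeBits_encWord]

theorem foldl_flip_cons (l : List Bool) (s : List Bool) :
    l.foldl (fun s b => b :: s) s = l.reverse ++ s := List.foldl_flip_cons_eq_append'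

theorem runs_cnfProg (x a y : Bitstring) :
    ∃ m', cnfProg.Runs ⟨pair x (pair a y), fun _ => []⟩ m'
      (40 * (x.length + a.length + y.length + 1) ^ 2) ∧
      (m'.reg 0 ≠ [] ↔ check (x ++ y) a = true) := by
  have r1 := fun s inp (hs : IsStop 0 s inp) B => runs_readAll (fl := 7) (u := true)
    (g := push 3) hs
    (fun s => (mem [] [[], [], [], s, B, [], [], []] : Mem Bool).reg) (fun s b => b :: s) 1
    (fun s => rfl) (fun s b inp => runs_push' (k := 3) (rs := [[], [], [], s, B, [], [], []])
      (by simp))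
  have r2 := fun s inp (hs : IsStop 1 s inp) B => runs_readAll (fl := 7) (u := true)
    (g := push 4) hs
    (fun s => (mem [] [[], [], [], B, s, [], [], []] : Mem Bool).reg) (fun s b => b :: s) 1
    (fun s => rfl) (fun s b inp => runs_push' (k := 4) (rs := [[], [], [], B, s, [], [], []])
      (by simp))
  have r3 := fun s inp (hs : IsStop 1 s inp) B => runs_readAll (fl := 7) (u := true)
    (g := push 3) hs
    (fun s => (mem [] [[], [], [], s, B, [], [], []] : Mem Bool).reg) (fun s b => b :: s) 1
    (fun s => rfl) (fun s b inp => runs_push' (k := 3) (rs := [[], [], [], s, B, [], [], []])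
      (by simp))
  have h1 := r1 _ (encWord 1 a ++ (stopMark 1 ++ encWord 1 y)) (.inl rfl) [] x []
  have h2 := r2 _ (encWord 1 y) (.inl rfl) (x.reverse) a []
  have h3 := r3 [] [] (.inr ⟨rfl, rfl⟩) (a.reverse) y x.reverse
  rw [foldl_flip_cons, List.append_nil] at h1 h2
  rw [foldl_flip_cons, List.append_nil, ← List.reverse_append] at h3
  have h4 : (move 3 1).Runs (mem [] [[], [], [], (x ++ y).reverse, a.reverse, [], [], []])
      (mem [] [[], x ++ y, [], [], a.reverse, [], [], []])
      (2 * (x ++ y).reverse.length + 1) :=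
    (runs_move' (by simp) (by simp) (by simp)).of_eq rfl (by simp)
  have h5 : (move 4 2).Runs (mem [] [[], x ++ y, [], [], a.reverse, [], [], []])
      (cnfMem [] a ⟨x ++ y, [], false, false, false⟩) (2 * a.reverse.length + 1) :=
    (runs_move' (by simp) (by simp) (by simp)).of_eq rfl (by simp [cnfMem, flagList])
  have h6 := runs_tokLoop [] a ⟨x ++ y, [], false, false, false⟩ (x.length + y.length) (by simp)
  have key : ∀ s : CnfSt, ∃ m', (pop 6 fun o => o.elim skip fun _ =>
      pop 5 fun o => o.elim (push 0 true) fun _ => skip).Runs (cnfMem [] [] s) m' 3 ∧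
        (m'.reg 0 ≠ [] ↔ (s.done && !s.dead) = true) := by
    rintro ⟨f, b, fl, de, dn⟩
    cases dn with
    | false => exact ⟨_, runs_pop' (by simp) (t := 2) ((runs_skip _).mono (by omega)),
        by simp [flagList]⟩
    | true =>
      cases de with
      | true => exact ⟨_, runs_pop' (by simp) (t := 2) (runs_pop' (by simp [flagList]) (t := 1)
          ((runs_skip _).mono (by omega))), by simp [flagList]⟩
      | false => exact ⟨_, runs_pop' (by simp) (t := 2) (runs_pop' (by simp [flagList]) (t := 1)
          (runs_push' (by simp))), by simp [flagList]⟩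
  obtain ⟨m', h7, h8⟩ := key (CnfSt.run a ⟨x ++ y, [], false, false, false⟩)
  refine ⟨m', (((h1.of_eq (m₁ := ⟨pair x (pair a y), fun _ => []⟩) ?_ rfl).seq (h2.seq (h3.seq
    (h4.seq (h5.seq (h6.seq h7)))))).mono ?_), h8⟩
  · rw [← mem_replicate _ 8, pair_pair]
    rfl
  · simp only [List.length_reverse, List.length_append]
    nlinarith

end Prog

theorem exists_TM_check : ∃ M : TM, ∀ x a y : Bitstring,
    (check (x ++ y) a = true → ∀ τ,
      2 * (40 * (x.length + a.length + y.length + 1) ^ 2 + 1) ^ 2 + 3 ≤ τ →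
        tmAccepts M (pair x (pair a y)) τ) ∧
    (check (x ++ y) a = false → ∀ τ, ¬ tmAccepts M (pair x (pair a y)) τ) := by
  obtain ⟨M, hM⟩ := exists_TM_of_prog Prog.cnfProg
  refine ⟨M, fun x a y => ?_⟩
  obtain ⟨m', h1, h2⟩ := Prog.runs_cnfProg x a y
  obtain ⟨h3, h4, -⟩ := hM _ _ _ h1
  refine ⟨fun h => h3 (h2.2 h), fun h => h4 ?_⟩
  by_contra h'
  rw [h2.1 h'] at h
  cases h

/-! ## From nondeterministic circuits to CNF formulas -/

def mkClause (L : ℕ) (lits : List (ℕ × Bool)) : List (Bool × Bool) :=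
  (List.range L).map fun i => (decide ((i, true) ∈ lits), decide ((i, false) ∈ lits))

def SatLits (v : ℕ → Bool) (lits : List (ℕ × Bool)) : Prop := ∃ l ∈ lits, v l.1 = l.2

theorem satClause_mkClause {L : ℕ} {lits : List (ℕ × Bool)} (h : ∀ l ∈ lits, l.1 < L) {v : List Bool}
    (hv : v.length = L) : SatClause (mkClause L lits) v ↔ SatLits (fun i => v.getD i false) lits := by
  constructor
  · rintro ⟨l, hl, h2⟩
    obtain ⟨i, hi, rfl⟩ := List.mem_iff_getElem.1 hl
    simp only [mkClause, List.getElem_zip, List.getElem_map, List.getElem_range,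
      Bool.or_eq_true, Bool.and_eq_true, decide_eq_true_eq, Bool.not_eq_true'] at h2
    simp only [List.length_zip, mkClause, List.length_map, List.length_range] at hi
    have hi' : i < v.length := by omega
    rcases h2 with ⟨h2, h3⟩ | ⟨h2, h3⟩
    · exact ⟨_, h2, by simpa [List.getD_eq_getElem?_getD, hi'] using h3⟩
    · exact ⟨_, h2, by simpa [List.getD_eq_getElem?_getD, hi'] using h3⟩
  · rintro ⟨⟨i, b⟩, hl, h2⟩
    have hi := h _ hl
    simp only at hi h2
    have hi' : i < v.length := by omega
    have h3 : ((mkClause L lits).zip v)[i]'(by simp [mkClause]; omega) ∈ (mkClause L lits).zip v :=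
      List.getElem_mem _
    refine ⟨_, h3, ?_⟩
    simp only [List.getD_eq_getElem?_getD, hi', List.getElem?_eq_getElem, Option.getD_some] at h2
    cases b <;> simp [mkClause, h2, hl]

/-- The CNF formula with the given clauses. -/
def encCnf (L : ℕ) (cls : List (List (ℕ × Bool))) : List Bool :=
  (cls.map (mkClause L)).flatMap encClause

theorem check_encCnf {L : ℕ} {cls : List (List (ℕ × Bool))} (h0 : cls ≠ [])
    (h1 : ∀ c ∈ cls, ∀ l ∈ c, l.1 < L) (h2 : ∀ c ∈ cls, ∀ i, (i, true) ∈ c → (i, false) ∉ c)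
    (v : List Bool) : check v (encCnf L cls) = true ↔
      v.length = L ∧ ∀ c ∈ cls, SatLits (fun i => v.getD i false) c := by
  rw [encCnf, check_clauses _ L (by simpa using h0)]
  · refine and_congr_right fun hv => ?_
    simp only [List.forall_mem_map]
    exact forall₂_congr fun c hc => satClause_mkClause (h1 c hc) hv
  · simp only [List.forall_mem_map]
    refine fun c hc => ⟨by simp [mkClause], ?_⟩
    simp only [mkClause, List.forall_mem_map]
    intro i _
    have := h2 c hc i
    by_cases h : (i, true) ∈ c <;> simp_all

theorem length_encCnf (L : ℕ) (cls : List (List (ℕ × Bool))) :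
    (encCnf L cls).length = cls.length * (2 * L + 2) := by
  induction cls with
  | nil => simp [encCnf]
  | cons c cls ih =>
    simp only [encCnf, List.map_cons, List.flatMap_cons, List.length_append] at ih ⊢
    rw [ih]
    simp [encClause, mkClause, List.length_flatMap, Function.comp_def]
    ring

theorem eq_evalGates_iff (x : List Bool) (gs : List GateOp) (vals U : List Bool) :
    U = evalGates x gs vals ↔ U.length = vals.length + gs.length ∧ U.take vals.length = vals ∧
      ∀ g (h : g < gs.length), U.getD (vals.length + g) false =
        (gs[g]).eval x (U.take (vals.length + g)) := by
  induction gs generalizing vals with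
  | nil =>
    simp only [evalGates, List.length_nil, Nat.add_zero]
    constructor
    · rintro rfl
      simp
    · rintro ⟨h1, h2, -⟩
      rwa [← h1, List.take_length] at h2
  | cons g gs ih =>
    rw [evalGates, ih]
    simp only [List.length_append, List.length_cons, List.length_nil, Nat.zero_add]
    constructor
    · rintro ⟨h1, h2, h3⟩
      have h4 : U.take vals.length = vals := by
        have := congrArg (List.take vals.length) h2
        rw [List.take_take, min_eq_left (by omega)] at this
        simpa using this
      refine ⟨by omega, h4, ?_⟩
      rintro (_ | j) hj
      · have := congrArg (fun l => List.getD l vals.length false) h2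
        simp only [List.getD_eq_getElem?_getD, List.getElem?_take] at this
        simp only [Nat.add_zero, List.getElem_cons_zero, h4]
        rw [List.getD_eq_getElem?_getD]
        simpa using this
      · have := h3 j (by simpa using hj)
        rw [show vals.length + (j + 1) = vals.length + 1 + j by omega]
        simpa using this
    · rintro ⟨h1, h2, h3⟩
      refine ⟨by omega, ?_, fun j hj => ?_⟩
      · have := h3 0 (by omega)
        simp only [Nat.add_zero, List.getElem_cons_zero, h2] at this
        rw [List.take_add_one, h2]
        rw [List.getD_eq_getElem?_getD] at this
        have hl : vals.length < U.length := by omega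
        simp only [List.getElem?_eq_getElem hl, Option.getD_some] at this
        simp [List.getElem?_eq_getElem hl, this]
      · have := h3 (j + 1) (by omega)
        rw [show vals.length + (j + 1) = vals.length + 1 + j by omega] at this
        simpa using this

def GateOp.isInput (i : ℕ) : GateOp → Bool
  | .input j => decide (j = i)
  | _ => false

theorem GateOp.isInput_iff {i : ℕ} {g : GateOp} : g.isInput i = true ↔ g = .input i := by
  cases g <;> simp [isInput]

def eqClauses (a b : ℕ) : List (List (ℕ × Bool)) := [[(a, true), (b, false)], [(a, false), (b, true)]]

/-- Clauses for gate `g`, for a circuit applied to a fixed prefix `P` and `n` variable bits, and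
with `w` witness bits. Variable `n` is `false`, and the values of the gates follow. -/
def gateClauses (P : List Bool) (n w : ℕ) (gs : List GateOp) (g : ℕ) : List (List (ℕ × Bool)) :=
  let o := n + 1 + g
  let r := fun a => if a < g then n + 1 + a else n
  match gs.getD g (.const false) with
  | .const b => [[(o, b)]]
  | .input i =>
    if i < P.length then [[(o, P.getD i false)]]
    else if i < P.length + n then eqClauses o (i - P.length)
    else if i < P.length + n + w then
      (List.range g).flatMap fun g' =>
        if (gs.getD g' (.const false)).isInput i then eqClauses o (n + 1 + g') else []
    else [[(o, false)]]
  | .not a => [[(o, true), (r a, true)], [(o, false), (r a, false)]]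
  | .and a b => [[(o, false), (r a, true)], [(o, false), (r b, true)],
      [(o, true), (r a, false), (r b, false)]]
  | .or a b => [[(o, true), (r a, false)], [(o, true), (r b, false)],
      [(o, false), (r a, true), (r b, true)]]

def circuitClauses (P : List Bool) (n w : ℕ) (gs : List GateOp) : List (List (ℕ × Bool)) :=
  [(n, false)] :: [(n + gs.length, true)] :: (List.range gs.length).flatMap (gateClauses P n w gs)

theorem gateClauses_wf (P : List Bool) (n w : ℕ) (gs : List GateOp) (g : ℕ) :
    ∀ c ∈ gateClauses P n w gs g, (∀ l ∈ c, l.1 ≤ n + 1 + g) ∧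
      ∀ i, (i, true) ∈ c → (i, false) ∉ c := by
  have hr : ∀ a, (if a < g then n + 1 + a else n) < n + 1 + g := by
    intro a
    split_ifs <;> omega
  have heq : ∀ b < n + 1 + g, ∀ c ∈ eqClauses (n + 1 + g) b, (∀ l ∈ c, l.1 ≤ n + 1 + g) ∧
      ∀ i, (i, true) ∈ c → (i, false) ∉ c := by
    intro b hb c hc
    simp only [eqClauses, List.mem_cons, List.not_mem_nil, or_false] at hc
    rcases hc with rfl | rfl <;> constructor <;> intro _ <;> simp <;> grind
  unfold gateClauses
  cases gs.getD g (.const false) with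
  | const b =>
    intro c hc
    simp only [List.mem_singleton] at hc
    subst hc
    simp
  | input i =>
    simp only
    split_ifs
    · intro c hc
      simp only [List.mem_singleton] at hc
      subst hc
      simp
    · exact heq _ (by omega)
    · intro c hc
      simp only [List.mem_flatMap, List.mem_range] at hc
      obtain ⟨g', hg, hc⟩ := hc
      split_ifs at hc
      · exact heq _ (by omega) c hc
      · simp at hc
    · intro c hc
      simp only [List.mem_singleton] at hc
      subst hc
      simp
  | not a =>
    intro c hc
    have := hr a
    simp only [List.mem_cons, List.not_mem_nil, or_false] at hc
    rcases hc with rfl | rfl <;> constructor <;> intro _ <;> simp <;> grind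
  | and a b =>
    intro c hc
    have := hr a
    have := hr b
    simp only [List.mem_cons, List.not_mem_nil, or_false] at hc
    rcases hc with rfl | rfl | rfl <;> constructor <;> intro _ <;> simp <;> grind
  | or a b =>
    intro c hc
    have := hr a
    have := hr b
    simp only [List.mem_cons, List.not_mem_nil, or_false] at hc
    rcases hc with rfl | rfl | rfl <;> constructor <;> intro _ <;> simp <;> grind

theorem length_gateClauses_le (P : List Bool) (n w : ℕ) (gs : List GateOp) (g : ℕ) :
    (gateClauses P n w gs g).length ≤ 2 * g + 3 := by
  unfold gateClauses
  cases gs.getD g (.const false) with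
  | input i =>
    simp only
    split_ifs
    · simp
    · simp [eqClauses]
    · rw [List.length_flatMap]
      refine (List.sum_le_card_nsmul _ 2 ?_).trans (by simp; omega)
      simp only [List.forall_mem_map]
      intro g' _
      split_ifs <;> simp [eqClauses]
    · simp
  | _ => simp

theorem length_circuitClauses_le (P : List Bool) (n w : ℕ) (gs : List GateOp) :
    (circuitClauses P n w gs).length ≤ gs.length * (2 * gs.length + 3) + 2 := by
  simp only [circuitClauses, List.length_cons, List.length_flatMap]
  have := List.sum_le_card_nsmul ((List.range gs.length).map fun g => (gateClauses P n w gs g).length)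
    (2 * gs.length + 3) (by
      simp only [List.forall_mem_map]
      intro g hg
      rw [List.mem_range] at hg
      exact (length_gateClauses_le P n w gs g).trans (by omega))
  simp only [List.length_map, List.length_range, smul_eq_mul] at this
  omega

theorem satLits_eqClauses (v : ℕ → Bool) (a b : ℕ) :
    (∀ c ∈ eqClauses a b, SatLits v c) ↔ v a = v b := by
  simp only [eqClauses, SatLits, List.mem_cons, List.not_mem_nil, or_false, forall_eq_or_imp,
    exists_eq_or_imp, exists_eq_left, forall_eq]
  cases v a <;> cases v b <;> simp

/-- The meaning of the clauses of an input gate. -/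
def InputOk (P : List Bool) (n w : ℕ) (gs : List GateOp) (v : ℕ → Bool) (g i : ℕ) : Prop :=
  if i < P.length then v (n + 1 + g) = P.getD i false
  else if i < P.length + n then v (n + 1 + g) = v (i - P.length)
  else if i < P.length + n + w then
    ∀ g' < g, gs.getD g' (.const false) = .input i → v (n + 1 + g) = v (n + 1 + g')
  else v (n + 1 + g) = false

def GateOk (P : List Bool) (n w : ℕ) (gs : List GateOp) (v : ℕ → Bool) (g : ℕ) : Prop :=
  match gs.getD g (.const false) with
  | .input i => InputOk P n w gs v g i
  | op => v (n + 1 + g) = op.eval [] ((List.range g).map fun a => v (n + 1 + a))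

theorem satLits_gateClauses (P : List Bool) (n w : ℕ) (gs : List GateOp) (v : ℕ → Bool)
    (hv : v n = false) (g : ℕ) :
    (∀ c ∈ gateClauses P n w gs g, SatLits v c) ↔ GateOk P n w gs v g := by
  have hr : ∀ a, v (if a < g then n + 1 + a else n) =
      ((List.range g).map fun a => v (n + 1 + a)).getD a false := by
    intro a
    rw [List.getD_eq_getElem?_getD, List.getElem?_map]
    by_cases h : a < g
    · simp [h]
    · simp [h, hv]
  unfold gateClauses GateOk
  cases gs.getD g (.const false) with
  | const b => simp [SatLits, GateOp.eval]
  | input i =>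
    simp only [InputOk]
    split_ifs
    · simp [SatLits]
    · exact satLits_eqClauses _ _ _
    · simp only [List.mem_flatMap, List.mem_range, forall_exists_index, and_imp]
      constructor
      · intro h g' hg' h2
        rw [← satLits_eqClauses]
        intro c hc
        exact h c g' hg' (by rwa [if_pos (GateOp.isInput_iff.2 h2)])
      · intro h c g' hg' hc
        split_ifs at hc with h2
        · exact (satLits_eqClauses _ _ _).2 (h g' hg' (GateOp.isInput_iff.1 h2)) c hc
        · simp at hc
    · simp [SatLits]
  | not a =>
    simp only [SatLits, List.mem_cons, List.not_mem_nil, or_false, forall_eq_or_imp,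
      exists_eq_or_imp, exists_eq_left, forall_eq, hr, GateOp.eval]
    generalize List.getD _ a false = x
    generalize v _ = y
    revert x y
    decide
  | and a b =>
    simp only [SatLits, List.mem_cons, List.not_mem_nil, or_false, forall_eq_or_imp,
      exists_eq_or_imp, exists_eq_left, forall_eq, hr, GateOp.eval]
    generalize List.getD _ a false = x
    generalize List.getD _ b false = z
    generalize v _ = y
    revert x y z
    decide
  | or a b =>
    simp only [SatLits, List.mem_cons, List.not_mem_nil, or_false, forall_eq_or_imp,
      exists_eq_or_imp, exists_eq_left, forall_eq, hr, GateOp.eval]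
    generalize List.getD _ a false = x
    generalize List.getD _ b false = z
    generalize v _ = y
    revert x y z
    decide

theorem satLits_circuitClauses (P : List Bool) (n w : ℕ) (gs : List GateOp) (v : ℕ → Bool) :
    (∀ c ∈ circuitClauses P n w gs, SatLits v c) ↔
      v n = false ∧ v (n + gs.length) = true ∧ ∀ g < gs.length, GateOk P n w gs v g := by
  simp only [circuitClauses, List.forall_mem_cons, List.mem_flatMap, List.mem_range]
  rw [show SatLits v [(n, false)] ↔ v n = false by simp [SatLits],
    show SatLits v [(n + gs.length, true)] ↔ v (n + gs.length) = true by simp [SatLits]]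
  refine and_congr_right fun hv => and_congr_right fun _ => ?_
  constructor
  · intro h g hg
    exact (satLits_gateClauses P n w gs v hv g).1 fun c hc => h c ⟨g, hg, hc⟩
  · rintro h c ⟨g, hg, hc⟩
    exact (satLits_gateClauses P n w gs v hv g).2 (h g hg) c hc

theorem getD_append_lt {α : Type*} (x y : List α) (d : α) {i : ℕ} (h : i < x.length) :
    (x ++ y).getD i d = x.getD i d := by
  simp [List.getD_eq_getElem?_getD, List.getElem?_append, h]

theorem getD_append_add {α : Type*} (x y : List α) (d : α) (i : ℕ) :
    (x ++ y).getD (x.length + i) d = y.getD i d := by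
  simp [List.getD_eq_getElem?_getD, List.getElem?_append]

theorem take_eq_map_getD (U : List Bool) (g : ℕ) (hg : g ≤ U.length) (v : ℕ → Bool)
    (h : ∀ a < g, v a = U.getD a false) : (List.range g).map v = U.take g := by
  apply List.ext_getElem?
  intro i
  by_cases hi : i < g
  · rw [List.getElem?_map, List.getElem?_take, if_pos hi, List.getElem?_range hi, Option.map_some,
      h i hi, List.getD_eq_getElem?_getD, List.getElem?_eq_getElem (by omega), Option.getD_some]
  · rw [List.getElem?_eq_none (by simpa using hi), List.getElem?_eq_none (by simp; omega)]

theorem exists_gate_values_iff (P x : List Bool) (D : NDCircuit) (hs : D.C.gates ≠ []) :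
    D.Accepts (P ++ x) ↔ ∃ U : List Bool, U.length = D.C.gates.length ∧
      ∀ c ∈ circuitClauses P x.length D.w D.C.gates,
        SatLits (fun i => (x ++ false :: U).getD i false) c := by
  have hpos := List.length_pos_iff.2 hs
  have e0 : ∀ U : List Bool, (x ++ false :: U).getD x.length false = false := fun U =>
    getD_append_add x (false :: U) false 0
  have e1 : ∀ (U : List Bool) g, (x ++ false :: U).getD (x.length + 1 + g) false = U.getD g false :=
    fun U g => by
      have := getD_append_add x (false :: U) false (g + 1)
      rwa [← add_assoc, add_right_comm] at this
  have e2 : ∀ U : List Bool, U.length = D.C.gates.length →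
      (x ++ false :: U).getD (x.length + D.C.gates.length) false = U.getLastD false := by
    intro U hU
    have := e1 U (D.C.gates.length - 1)
    rw [show x.length + 1 + (D.C.gates.length - 1) = x.length + D.C.gates.length by omega] at this
    rw [this, List.getD_eq_getElem?_getD, ← hU, ← List.getLast?_eq_getElem?,
      List.getLastD_eq_getLast?]
  have e3 : ∀ U : List Bool, U.length = D.C.gates.length → ∀ g < D.C.gates.length,
      ((List.range g).map fun a => (x ++ false :: U).getD (x.length + 1 + a) false) = U.take g := by
    intro U hU g hg
    exact take_eq_map_getD U g (by omega) _ fun a _ => e1 U a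
  constructor
  · rintro ⟨y, hy, h⟩
    set U := evalGates (P ++ x ++ y) D.C.gates [] with hUdef
    obtain ⟨hU, -, hg⟩ := (eq_evalGates_iff (P ++ x ++ y) D.C.gates [] U).1 rfl
    simp only [List.length_nil, Nat.zero_add] at hU hg
    refine ⟨U, hU, (satLits_circuitClauses _ _ _ _ _).2 ⟨e0 U, (e2 U hU).trans h, fun g hlt => ?_⟩⟩
    have h1 := hg g hlt
    have e4 : D.C.gates.getD g (.const false) = D.C.gates[g] := by
      simp [List.getD_eq_getElem?_getD, hlt]
    unfold GateOk
    rw [e4]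
    cases hop : D.C.gates[g] with
    | input i =>
      rw [hop] at h1
      simp only [GateOp.eval] at h1
      simp only [InputOk, e1]
      split_ifs with c1 c2 c3
      · rw [h1, List.append_assoc, getD_append_lt _ _ _ c1]
      · obtain ⟨j, rfl⟩ := Nat.exists_eq_add_of_le (not_lt.1 c1)
        rw [h1, List.append_assoc, getD_append_add, getD_append_lt _ _ _ (by omega),
          Nat.add_sub_cancel_left, getD_append_lt _ _ _ (by omega)]
      · intro g' hg' h2
        have h3 := hg g' (by omega)
        have e5 : D.C.gates.getD g' (.const false) = D.C.gates[g'] := by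
          simp [List.getD_eq_getElem?_getD, hg'.trans hlt]
        rw [h1, h3, ← e5, h2]
        rfl
      · rw [h1, List.getD_eq_getElem?_getD, List.getElem?_eq_none]
        · rfl
        · simp only [List.length_append]
          omega
    | _ =>
      rw [hop] at h1
      simp only
      rw [e1, e3 U hU g hlt, h1]
      rfl
  · rintro ⟨U, hU, h⟩
    obtain ⟨-, h2, h3⟩ := (satLits_circuitClauses _ _ _ _ _).1 h
    rw [e2 U hU] at h2
    let Y : ℕ → Bool := fun j => (List.range D.C.gates.length).any fun g =>
      U.getD g false && (D.C.gates.getD g (.const false)).isInput (P.length + x.length + j)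
    refine ⟨(List.range D.w).map Y, by simp, ?_⟩
    have : U = evalGates (P ++ x ++ (List.range D.w).map Y) D.C.gates [] := by
      rw [eq_evalGates_iff]
      refine ⟨by simpa using hU, rfl, fun g hlt => ?_⟩
      simp only [List.length_nil, Nat.zero_add]
      have h1 := h3 g hlt
      have e4 : D.C.gates.getD g (.const false) = D.C.gates[g] := by
        simp [List.getD_eq_getElem?_getD, hlt]
      unfold GateOk at h1
      rw [e4] at h1
      cases hop : D.C.gates[g] with
      | input i =>
        rw [hop] at h1
        simp only [InputOk, e1] at h1
        simp only [GateOp.eval]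
        split_ifs at h1 with c1 c2 c3
        · rw [h1, List.append_assoc, getD_append_lt _ _ _ c1]
        · obtain ⟨j, rfl⟩ := Nat.exists_eq_add_of_le (not_lt.1 c1)
          rw [h1, List.append_assoc, getD_append_add, getD_append_lt _ _ _ (by omega),
            Nat.add_sub_cancel_left, getD_append_lt _ _ _ (by omega)]
        · obtain ⟨j, rfl⟩ := Nat.exists_eq_add_of_le (not_lt.1 c2)
          have h5 := getD_append_add (P ++ x) ((List.range D.w).map Y) false j
          rw [List.length_append] at h5
          rw [h5, List.getD_eq_getElem?_getD (l := List.map _ _), List.getElem?_map,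
            List.getElem?_range (by omega),
            Option.map_some, Option.getD_some, Bool.eq_iff_iff, List.any_eq_true]
          simp only [List.mem_range, Bool.and_eq_true, GateOp.isInput_iff]
          constructor
          · intro h6
            exact ⟨g, hlt, h6, by rw [e4, hop]⟩
          · rintro ⟨g', hg', h6, h7⟩
            rcases lt_trichotomy g' g with h8 | rfl | h8
            · rw [h1 g' h8 h7, h6]
            · exact h6
            · have h9 := h3 g' hg'
              unfold GateOk at h9
              rw [h7] at h9
              simp only [InputOk, e1] at h9
              rw [if_neg c1, if_neg c2, if_pos c3] at h9
              rw [← h9 g h8 (by rw [e4, hop]), h6]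
        · rw [h1, List.getD_eq_getElem?_getD, List.getElem?_eq_none]
          · rfl
          · simp only [List.length_append, List.length_map, List.length_range]
            omega
      | _ =>
        rw [hop] at h1
        simp only at h1
        rw [e1, e3 U hU g hlt] at h1
        rw [h1]
        rfl
    rw [Circuit.eval, Circuit.values, ← this, h2]

/-- `L` is computed on length `n` by a CNF formula of size at most `N` with existential
variables. -/
def Compact (L : Language) (n N : ℕ) : Prop :=
  ∃ a : List Bool, a.length ≤ N ∧ ∀ x : List Bool, x.length = n →
    (x ∈ L ↔ ∃ y : List Bool, y.length ≤ N ∧ check (x ++ y) a = true)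

theorem Compact.mono {L : Language} {n N N' : ℕ} (h : Compact L n N) (hN : N ≤ N') :
    Compact L n N' := by
  obtain ⟨a, ha, h⟩ := h
  refine ⟨a, ha.trans hN, fun x hx => (h x hx).trans ?_⟩
  constructor
  · rintro ⟨y, hy, h⟩
    exact ⟨y, hy.trans hN, h⟩
  · rintro ⟨y, -, h⟩
    have := length_le_of_check h
    rw [List.length_append] at this
    exact ⟨y, by omega, h⟩

theorem compact_of_circuit (L : Language) (n s : ℕ) (P : List Bool) (D : NDCircuit)
    (hD : D.size ≤ s) (h : ∀ x : List Bool, x.length = n → (x ∈ L ↔ D.Accepts (P ++ x))) :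
    Compact L n ((n + s + 2) ^ 7) := by
  by_cases hs : D.C.gates = []
  · have hno : ∀ x, ¬ D.Accepts x := by
      rintro x ⟨y, -, hy⟩
      simp [Circuit.eval, Circuit.values, hs, evalGates] at hy
    refine ⟨[], by simp, fun x hx => ?_⟩
    rw [h x hx]
    simp only [hno, false_iff]
    rintro ⟨y, -, hy⟩
    simp [check, CnfSt.run] at hy
  · refine Compact.mono (N := (s * (2 * s + 3) + 2) * (2 * (n + 1 + s) + 2)) ?_ ?_
    · have hwf : ∀ c ∈ circuitClauses P n D.w D.C.gates,
          (∀ l ∈ c, l.1 < n + 1 + D.C.gates.length) ∧ ∀ i, (i, true) ∈ c → (i, false) ∉ c := by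
        intro c hc
        have hpos := List.length_pos_iff.2 hs
        simp only [circuitClauses, List.mem_cons, List.mem_flatMap, List.mem_range] at hc
        rcases hc with rfl | rfl | ⟨g, hg, hc⟩
        · simp
          omega
        · simp
        · obtain ⟨h1, h2⟩ := gateClauses_wf P n D.w D.C.gates g c hc
          exact ⟨fun l hl => by have := h1 l hl; omega, h2⟩
      have hlen := length_circuitClauses_le P n D.w D.C.gates
      have hD' : D.C.gates.length ≤ s := hD
      refine ⟨encCnf (n + 1 + D.C.gates.length) (circuitClauses P n D.w D.C.gates), ?_,
        fun x hx => ?_⟩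
      · rw [length_encCnf]
        gcongr
        refine hlen.trans ?_
        gcongr
      · rw [h x hx, exists_gate_values_iff P x D hs, hx]
        have hck := fun v => check_encCnf (cls := circuitClauses P n D.w D.C.gates)
          (by simp [circuitClauses]) (fun c hc => (hwf c hc).1) (fun c hc => (hwf c hc).2) v
        simp only [hck]
        constructor
        · rintro ⟨U, hU, h1⟩
          refine ⟨false :: U, ?_, ?_, h1⟩
          · simp only [List.length_cons, hU]
            have : s + 1 ≤ s * (2 * s + 3) + 2 := by nlinarith
            exact (by omega : _ ≤ s + 1).trans (this.trans (Nat.le_mul_of_pos_right _ (by omega)))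
          · simp only [List.length_append, List.length_cons, hU, hx]
            omega
        · rintro ⟨y, -, h1, h2⟩
          rw [List.length_append] at h1
          cases y with
          | nil => simp at h1; omega
          | cons b U =>
            have h3 := ((satLits_circuitClauses _ _ _ _ _).1 h2).1
            have h4 := getD_append_add x (b :: U) false 0
            rw [Nat.add_zero, hx, h3] at h4
            obtain rfl : b = false := by simpa using h4.symm
            exact ⟨U, by simp at h1; omega, h2⟩
    · have h1 : s * (2 * s + 3) + 2 ≤ 2 * (n + s + 2) ^ 2 := by
        have : (s + 2) ^ 2 ≤ (n + s + 2) ^ 2 := Nat.pow_le_pow_left (by omega) 2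
        nlinarith
      have h2 : 2 * (n + 1 + s) + 2 ≤ 2 * (n + s + 2) := by omega
      calc _ ≤ 2 * (n + s + 2) ^ 2 * (2 * (n + s + 2)) := Nat.mul_le_mul h1 h2
        _ = 2 ^ 2 * (n + s + 2) ^ 3 := by ring
        _ ≤ (n + s + 2) ^ 2 * (n + s + 2) ^ 3 := by gcongr; omega
        _ = (n + s + 2) ^ 5 := by ring
        _ ≤ _ := Nat.pow_le_pow_right (by omega) (by omega)

/-! ## Primitive recursiveness -/

section Primrec

variable {α : Type*} [Primcodable α]

/-- All bitstrings of length at most `N`. -/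
def allLists : ℕ → List (List Bool)
  | 0 => [[]]
  | N + 1 => [] :: (allLists N).flatMap fun l => [true :: l, false :: l]

theorem mem_allLists (N : ℕ) (l : List Bool) : l ∈ allLists N ↔ l.length ≤ N := by
  induction N generalizing l with
  | zero => simp [allLists]
  | succ N ih =>
    cases l with
    | nil => simp [allLists]
    | cons b l => cases b <;> simp [allLists, ih]

theorem primrec_allLists : Primrec allLists := by
  have h : Primrec₂ fun (_ : ℕ) (ll : List (List Bool)) =>
      ([] : List Bool) :: ll.flatMap fun l => [true :: l, false :: l] := by
    refine Primrec.list_cons.comp (Primrec.const _) (Primrec.list_flatMap Primrec.snd ?_)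
    exact Primrec.list_cons.comp (Primrec.list_cons.comp (Primrec.const _) Primrec.snd)
      (Primrec.list_cons.comp (Primrec.list_cons.comp (Primrec.const _) Primrec.snd)
        (Primrec.const _))
  refine (Primrec.nat_rec₁ [[]] h).of_eq fun N => ?_
  induction N with
  | zero => rfl
  | succ N ih => simp [allLists, ← ih]

theorem primrecPred_exists_le {f : α → ℕ} (hf : Primrec f) {R : List Bool → α → Prop}
    (hR : PrimrecRel R) : PrimrecPred fun a => ∃ y : List Bool, y.length ≤ f a ∧ R y a :=
  (hR.exists_mem_list.comp (primrec_allLists.comp hf) Primrec.id).of_eq fun a => by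
    simp [mem_allLists]

theorem primrecPred_forall_le {f : α → ℕ} (hf : Primrec f) {R : List Bool → α → Prop}
    (hR : PrimrecRel R) : PrimrecPred fun a => ∀ y : List Bool, y.length ≤ f a → R y a :=
  (hR.forall_mem_list.comp (primrec_allLists.comp hf) Primrec.id).of_eq fun a => by
    simp [mem_allLists]

theorem primrecPred_forall_eq {f : α → ℕ} (hf : Primrec f) {R : List Bool → α → Prop}
    (hR : PrimrecRel R) : PrimrecPred fun a => ∀ y : List Bool, y.length = f a → R y a := by
  have h : PrimrecRel fun (y : List Bool) (a : α) => ¬ (y.length = f a) ∨ R y a :=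
    PrimrecPred.or (PrimrecPred.not (Primrec.eq.comp (Primrec.list_length.comp Primrec.fst)
      (hf.comp Primrec.snd))) hR
  refine (primrecPred_forall_le hf h).of_eq fun a => ?_
  constructor
  · intro h y hy
    rcases h y hy.le with h | h
    · exact absurd hy h
    · exact h
  · intro h y _
    by_cases hy : y.length = f a
    · exact .inr (h y hy)
    · exact .inl hy

theorem primrecPred_iff {p q : α → Prop} (hp : PrimrecPred p) (hq : PrimrecPred q) :
    PrimrecPred fun a => (p a ↔ q a) :=
  ((hp.and hq).or (hp.not.and hq.not)).of_eq fun a => by tauto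

theorem primrec_pow : Primrec₂ fun a b : ℕ => a ^ b := by
  have h : Primrec₂ fun (a : ℕ) (p : ℕ × ℕ) => p.2 * a :=
    Primrec.nat_mul.comp (Primrec.snd.comp Primrec.snd) Primrec.fst
  refine (Primrec.nat_rec (Primrec.const 1 : Primrec fun _ : ℕ => 1) h).of_eq fun a b => ?_
  induction b with
  | zero => rfl
  | succ b ih => simp only [ih, pow_succ]

theorem primrec_encodeBits : Primrec encodeBits := by
  refine (Primrec.list_flatMap (g := fun _ b => [b, b]) Primrec.id (Primrec.list_cons.comp
    Primrec.snd (Primrec.list_cons.comp Primrec.snd (Primrec.const _)))).of_eq fun l => ?_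
  induction l with
  | nil => rfl
  | cons b l ih => simpa [encodeBits] using ih

theorem primrec_pair : Primrec₂ pair :=
  Primrec.list_append.comp (Primrec.list_append.comp (primrec_encodeBits.comp Primrec.fst)
    (Primrec.const _)) (primrec_encodeBits.comp Primrec.snd)

theorem primrec_headD {β : Type*} [Primcodable β] (b : β) : Primrec fun l : List β => l.headD b :=
  (Primrec.option_getD.comp Primrec.list_head? (Primrec.const b)).of_eq fun l => by cases l <;> rfl

theorem primrec_listStep (M : TM) : Primrec (listStep M) := by
  have h1 : Primrec fun c : LCfg M => c.1 := Primrec.fst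
  have hl : Primrec fun c : LCfg M => c.2.1 := Primrec.fst.comp Primrec.snd
  have hr : Primrec fun c : LCfg M => c.2.2 := Primrec.snd.comp Primrec.snd
  have ht : Primrec fun c : LCfg M => M.trans c.1 (c.2.2.headD M.blank) :=
    (Primrec.dom_finite fun p : Fin (M.states + 1) × Fin (M.symbols + 3) => M.trans p.1 p.2).comp
      (h1.pair ((primrec_headD M.blank).comp hr))
  have ht1 := Primrec.fst.comp ht
  have ht2 := Primrec.fst.comp (Primrec.snd.comp ht)
  have ht3 := Primrec.snd.comp (Primrec.snd.comp ht)
  refine (Primrec.ite (PrimrecPred.or (Primrec.eq.comp h1 (Primrec.const _))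
    (Primrec.eq.comp h1 (Primrec.const _))) Primrec.id
    (Primrec.ite (Primrec.eq.comp ht3 (Primrec.const true))
      (ht1.pair ((Primrec.list_cons.comp ht2 hl).pair (Primrec.list_tail.comp hr)))
      (ht1.pair ((Primrec.list_tail.comp hl).pair (Primrec.list_cons.comp
        ((primrec_headD M.blank).comp hl) (Primrec.list_cons.comp ht2
          (Primrec.list_tail.comp hr))))))).of_eq fun c => rfl

theorem primrecRel_tmAccepts (M : TM) : PrimrecRel fun (w : Bitstring) (t : ℕ) => tmAccepts M w t := by
  have h : Primrec fun p : Bitstring × ℕ => listRun M p.1 p.2 := by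
    refine Primrec.nat_iterate (f := fun p : Bitstring × ℕ => p.2)
      (g := fun p => ((M.start, [], p.1.map M.sym) : LCfg M)) (h := fun _ c => listStep M c)
      Primrec.snd ?_ ((primrec_listStep M).comp Primrec.snd)
    exact (Primrec.const _).pair ((Primrec.const _).pair (Primrec.list_map Primrec.fst
      ((Primrec.dom_finite M.sym).comp Primrec.snd)))
  exact (Primrec.eq.comp (Primrec.fst.comp h) (Primrec.const M.accept)).of_eq fun p =>
    (tmAccepts_iff M p.1 p.2).symm

theorem primrecPred_sig2 (M : TM) (c κ : ℕ) :
    PrimrecPred fun x : Bitstring => Sig2Accepts M c (2 ^ (κ * (x.length + 1))) x [] := by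
  have ht : Primrec fun x : Bitstring => 2 ^ (κ * (x.length + 1)) :=
    primrec_pow.comp (Primrec.const 2) (Primrec.nat_mul.comp (Primrec.const κ)
      (Primrec.succ.comp Primrec.list_length))
  have h3 : PrimrecPred fun p : Bitstring × Bitstring × Bitstring =>
      tmAccepts M (pair p.2.2 (pair [] (pair p.2.1 p.1)))
        (c * 2 ^ (κ * (p.2.2.length + 1)) + c) := by
    have e1 : Primrec fun p : Bitstring × Bitstring × Bitstring => p.1 := Primrec.fst
    have e2 : Primrec fun p : Bitstring × Bitstring × Bitstring => p.2.1 :=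
      Primrec.fst.comp Primrec.snd
    have e3 : Primrec fun p : Bitstring × Bitstring × Bitstring => p.2.2 :=
      Primrec.snd.comp Primrec.snd
    exact (primrecRel_tmAccepts M).comp
      (primrec_pair.comp e3 (primrec_pair.comp (Primrec.const []) (primrec_pair.comp e2 e1)))
      (Primrec.nat_add.comp (Primrec.nat_mul.comp (Primrec.const c) (ht.comp e3))
        (Primrec.const c))
  have h2 : PrimrecPred fun p : Bitstring × Bitstring =>
      ∀ z : Bitstring, z.length ≤ 2 ^ (κ * (p.2.length + 1)) →
        tmAccepts M (pair p.2 (pair [] (pair p.1 z))) (c * 2 ^ (κ * (p.2.length + 1)) + c) :=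
    primrecPred_forall_le (R := fun z p => tmAccepts M (pair p.2 (pair [] (pair p.1 z)))
      (c * 2 ^ (κ * (p.2.length + 1)) + c)) (ht.comp Primrec.snd) h3
  exact primrecPred_exists_le (R := fun y x => ∀ z : Bitstring,
    z.length ≤ 2 ^ (κ * (x.length + 1)) → tmAccepts M (pair x (pair [] (pair y z)))
      (c * 2 ^ (κ * (x.length + 1)) + c)) ht h2

/-- The evaluation of CNF formulas as a left fold; the last component is the first bit of an
incomplete token. -/
abbrev CnfFold := (List Bool × List Bool) × (Bool × Bool × Bool) × Option Bool

def CnfFold.toSt (s : CnfFold) : CnfSt := ⟨s.1.1, s.1.2, s.2.1.1, s.2.1.2.1, s.2.1.2.2⟩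

def CnfFold.ofSt (s : CnfSt) : CnfFold := ((s.front, s.back), (s.flag, s.dead, s.done), none)

def CnfFold.step (s : CnfFold) (b : Bool) : CnfFold :=
  s.2.2.casesOn (s.1, s.2.1, some b) fun p => CnfFold.ofSt ((CnfFold.toSt s).tok p b)

theorem CnfFold.foldl_step (a : List Bool) (s : CnfSt) :
    (CnfSt.run a s).done = (a.foldl CnfFold.step (ofSt s)).2.1.2.2 ∧
    (CnfSt.run a s).dead = ((a.foldl CnfFold.step (ofSt s)).2.1.2.1 ||
      (a.foldl CnfFold.step (ofSt s)).2.2.isSome) := by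
  induction a, s using CnfSt.run.induct with
  | case1 s => simp [CnfSt.run, ofSt]
  | case2 => simp [CnfSt.run, ofSt, step]
  | case3 p q l s ih => simpa [CnfSt.run, step, ofSt, toSt] using ih

def CnfFold.closeFlags (q : (Bool × Bool × Bool) × Option Bool) : Bool × Bool × Bool :=
  (false, q.1.2.1 || !(q.2.isNone && q.1.1), true)

def CnfFold.litFlags (q : ((Bool × Bool) × Bool) × (Bool × Bool × Bool)) : Bool × Bool × Bool :=
  (q.2.1 || ((q.1.1.1 && q.1.2) || (q.1.1.2 && !q.1.2)), q.2.2.1, q.2.2.2)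

def CnfFold.deadFlags (q : Bool × Bool × Bool) : Bool × Bool × Bool := (q.1, true, q.2.2)

theorem primrec_close : Primrec fun s : CnfFold => CnfFold.ofSt (CnfFold.toSt s).close := by
  have e1 : Primrec fun s : CnfFold => s.1.1 := Primrec.fst.comp Primrec.fst
  have e2 : Primrec fun s : CnfFold => s.1.2 := Primrec.snd.comp Primrec.fst
  have e3 : Primrec fun s : CnfFold => s.2.1 := Primrec.fst.comp Primrec.snd
  have e4 : Primrec fun s : CnfFold => (s.2.1, s.1.1.head?) :=
    e3.pair (Primrec.list_head?.comp e1)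
  have h : Primrec fun s : CnfFold => ((s.1.2.reverse ++ s.1.1.tail, ([] : List Bool)),
      CnfFold.closeFlags (s.2.1, s.1.1.head?),
      (none : Option Bool)) :=
    ((Primrec.list_append.comp (Primrec.list_reverse.comp e2) (Primrec.list_tail.comp e1)).pair
      (Primrec.const [])).pair (((Primrec.dom_finite CnfFold.closeFlags).comp e4).pair (Primrec.const none))
  refine h.of_eq ?_
  rintro ⟨⟨f, b⟩, ⟨fl, de, dn⟩, o⟩
  cases f <;> rfl

theorem primrec_lit : Primrec fun r : (Bool × Bool) × CnfFold =>
    CnfFold.ofSt ((CnfFold.toSt r.2).lit r.1.1 r.1.2) := by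
  have e0 : Primrec fun r : (Bool × Bool) × CnfFold => r.1 := Primrec.fst
  have e1 : Primrec fun r : (Bool × Bool) × CnfFold => r.2.1.1 :=
    Primrec.fst.comp (Primrec.fst.comp Primrec.snd)
  have e2 : Primrec fun r : (Bool × Bool) × CnfFold => r.2.1.2 :=
    Primrec.snd.comp (Primrec.fst.comp Primrec.snd)
  have e3 : Primrec fun r : (Bool × Bool) × CnfFold => r.2.2.1 :=
    Primrec.fst.comp (Primrec.snd.comp Primrec.snd)
  have h := Primrec.list_casesOn (f := fun r : (Bool × Bool) × CnfFold => r.2.1.1)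
    (g := fun r => ((([] : List Bool), r.2.1.2),
      CnfFold.deadFlags r.2.2.1, (none : Option Bool)))
    (h := fun r p => ((p.2, p.1 :: r.2.1.2),
      CnfFold.litFlags ((r.1, p.1), r.2.2.1), (none : Option Bool)))
    e1 (((Primrec.const []).pair e2).pair (((Primrec.dom_finite CnfFold.deadFlags).comp e3).pair
      (Primrec.const none)))
    (((Primrec.snd.comp Primrec.snd).pair (Primrec.list_cons.comp (Primrec.fst.comp Primrec.snd)
      (e2.comp Primrec.fst))).pair (((Primrec.dom_finite CnfFold.litFlags).comp (((e0.comp Primrec.fst).pair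
        (Primrec.fst.comp Primrec.snd)).pair (e3.comp Primrec.fst))).pair (Primrec.const none)))
  refine h.of_eq ?_
  rintro ⟨⟨p, q⟩, ⟨f, b⟩, ⟨fl, de, dn⟩, o⟩
  cases f <;> rfl

theorem primrec_cnfFold_step : Primrec₂ CnfFold.step := by
  have htok : Primrec fun r : (Bool × Bool) × CnfFold =>
      CnfFold.ofSt ((CnfFold.toSt r.2).tok r.1.1 r.1.2) := by
    refine (Primrec.ite (Primrec.eq.comp ((Primrec.dom_finite fun q : Bool × Bool =>
      q.1 && q.2).comp Primrec.fst) (Primrec.const true)) (primrec_close.comp Primrec.snd)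
      primrec_lit).of_eq ?_
    rintro ⟨⟨p, q⟩, s⟩
    cases p <;> cases q <;> rfl
  refine (Primrec.option_casesOn (o := fun r : CnfFold × Bool => r.1.2.2)
    (f := fun r => (r.1.1, r.1.2.1, some r.2))
    (g := fun r p => CnfFold.ofSt ((CnfFold.toSt r.1).tok p r.2)) ?_ ?_ ?_).of_eq ?_
  · exact Primrec.snd.comp (Primrec.snd.comp Primrec.fst)
  · exact (Primrec.fst.comp Primrec.fst).pair ((Primrec.fst.comp (Primrec.snd.comp
      Primrec.fst)).pair (Primrec.option_some.comp Primrec.snd))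
  · exact htok.comp ((Primrec.snd.pair (Primrec.snd.comp Primrec.fst)).pair
      (Primrec.fst.comp Primrec.fst))
  · rintro ⟨⟨s, q, o⟩, b⟩
    cases o <;> rfl

theorem primrecRel_check : PrimrecRel fun v a : List Bool => check v a = true := by
  have h : Primrec fun p : List Bool × List Bool =>
      p.2.foldl CnfFold.step (CnfFold.ofSt ⟨p.1, [], false, false, false⟩) :=
    Primrec.list_foldl (h := fun _ q => CnfFold.step q.1 q.2) Primrec.snd
      ((Primrec.fst.pair (Primrec.const [])).pair (Primrec.const ((false, false, false), none)))
      (primrec_cnfFold_step.comp (Primrec.fst.comp Primrec.snd) (Primrec.snd.comp Primrec.snd))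
  have h2 := (Primrec.dom_finite fun q : (Bool × Bool × Bool) × Option Bool =>
    q.1.2.2 && !(q.1.2.1 || q.2.isSome)).comp (Primrec.snd.comp h)
  refine (Primrec.eq.comp h2 (Primrec.const true)).of_eq ?_
  rintro ⟨v, a⟩
  obtain ⟨h3, h4⟩ := CnfFold.foldl_step a ⟨v, [], false, false, false⟩
  simp only [check, h3, h4]

theorem primrecRel_compact {L : Language} (hL : PrimrecPred fun x => x ∈ L) :
    PrimrecRel fun n N : ℕ => Compact L n N := by
  have h4 : PrimrecPred fun p : Bitstring × Bitstring × Bitstring × ℕ × ℕ =>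
      check (p.2.1 ++ p.1) p.2.2.1 = true :=
    primrecRel_check.comp (Primrec.list_append.comp (Primrec.fst.comp Primrec.snd) Primrec.fst)
      (Primrec.fst.comp (Primrec.snd.comp Primrec.snd))
  have h3 : PrimrecPred fun p : Bitstring × Bitstring × ℕ × ℕ =>
      ∃ y : List Bool, y.length ≤ p.2.2.2 ∧ check (p.1 ++ y) p.2.1 = true :=
    primrecPred_exists_le (R := fun y (p : Bitstring × Bitstring × ℕ × ℕ) =>
      check (p.1 ++ y) p.2.1 = true)
      (Primrec.snd.comp (Primrec.snd.comp Primrec.snd)) h4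
  have h2 : PrimrecPred fun p : Bitstring × ℕ × ℕ => ∀ x : Bitstring, x.length = p.2.1 →
      (x ∈ L ↔ ∃ y : List Bool, y.length ≤ p.2.2 ∧ check (x ++ y) p.1 = true) :=
    primrecPred_forall_eq (R := fun x (p : Bitstring × ℕ × ℕ) =>
      (x ∈ L ↔ ∃ y : List Bool, y.length ≤ p.2.2 ∧ check (x ++ y) p.1 = true))
      (Primrec.fst.comp Primrec.snd) (primrecPred_iff (hL.comp Primrec.fst) h3)
  exact primrecPred_exists_le (R := fun a (p : ℕ × ℕ) => ∀ x : Bitstring, x.length = p.1 →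
      (x ∈ L ↔ ∃ y : List Bool, y.length ≤ p.2 ∧ check (x ++ y) a = true)) Primrec.snd h2

end Primrec

/-! ## Primitive recursive functions by programs with unary registers -/

namespace Prog

def Halts {Γ : Type} (p : Prog Γ) (m m' : Mem Γ) : Prop := ∃ t, p.Runs m m' t

theorem Halts.seq {Γ : Type} {p q : Prog Γ} {m m₁ m' : Mem Γ} (h : p.Halts m m₁)
    (h' : q.Halts m₁ m') : (p.seq q).Halts m m' :=
  ⟨_, h.choose_spec.seq h'.choose_spec⟩

theorem Halts.of_eq {Γ : Type} {p : Prog Γ} {m m' m₁ m₁' : Mem Γ} (h : p.Halts m m') (e : m₁ = m)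
    (e' : m' = m₁') : p.Halts m₁ m₁' := by
  rw [e, ← e']
  exact h

/-- The memory with given unary registers. -/
def nm (inp : List Bool) (R : ℕ → ℕ) : Mem Unit := ⟨inp, fun k => List.replicate (R k) ()⟩

theorem nm_congr {inp : List Bool} {R R' : ℕ → ℕ} (h : ∀ k, R k = R' k) : nm inp R = nm inp R' := by
  rw [funext h]

theorem nm_set (inp : List Bool) (R : ℕ → ℕ) (k n : ℕ) :
    (nm inp R).set k (List.replicate n ()) = nm inp (Function.update R k n) := by
  refine Mem.ext rfl (funext fun j => ?_)
  simp only [Mem.set_reg, nm, Function.update_apply]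
  split_ifs <;> rfl

theorem halts_skip (m : Mem Unit) : (skip : Prog Unit).Halts m m := ⟨0, runs_skip m⟩

theorem halts_push (inp : List Bool) (R : ℕ → ℕ) (k : ℕ) :
    (push k ()).Halts (nm inp R) (nm inp (Function.update R k (R k + 1))) := by
  rw [← nm_set]
  exact ⟨1, runs_push k () _⟩

theorem halts_loop {inp : List Bool} {k : ℕ} {p : Prog Unit} (n : ℕ) (F : ℕ → ℕ → ℕ)
    (hk : ∀ i ≤ n, F i k = n - i)
    (hb : ∀ i < n, p.Halts (nm inp (Function.update (F i) k (n - i - 1))) (nm inp (F (i + 1)))) :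
    (loop k fun _ => p).Halts (nm inp (F 0)) (nm inp (F n)) := by
  have key : ∀ j ≤ n, (loop k fun _ => p).Halts (nm inp (F (n - j))) (nm inp (F n)) := by
    intro j
    induction j with
    | zero =>
      intro _
      exact ⟨1, runs_loop_nil (by simp [nm, hk])⟩
    | succ j ih =>
      intro hj
      obtain ⟨t, ht⟩ := ih (by omega)
      obtain ⟨u, hu⟩ := hb (n - (j + 1)) (by omega)
      rw [← nm_set, show n - (j + 1) + 1 = n - j by omega] at hu
      refine ⟨_, runs_loop_cons (a := ()) (l := List.replicate (n - (n - (j + 1)) - 1) ()) ?_ hu ht⟩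
      simp only [nm, hk _ (show n - (j + 1) ≤ n by omega), ← List.replicate_succ]
      congr 1
      omega
  have := key n le_rfl
  rwa [Nat.sub_self] at this

def clear (k : ℕ) : Prog Unit := loop k fun _ => skip

theorem halts_clear (inp : List Bool) (R : ℕ → ℕ) (k : ℕ) :
    (clear k).Halts (nm inp R) (nm inp (Function.update R k 0)) := by
  refine (halts_loop (R k) (fun i => Function.update R k (R k - i)) (by simp) fun i _ =>
    (halts_skip _).of_eq (nm_congr fun j => ?_) rfl).of_eq (nm_congr fun j => ?_)
      (nm_congr fun j => ?_)
  all_goals simp only [Function.update_apply]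
  all_goals grind

/-- Add register `a` to register `o`, using the empty register `b`. -/
def addTo (a o b : ℕ) : Prog Unit :=
  (loop a fun _ => (push o ()).seq (push b ())).seq (loop b fun _ => push a ())

theorem halts_addTo (inp : List Bool) (R : ℕ → ℕ) {a o b : ℕ} (hab : a ≠ b) (hao : a ≠ o)
    (hob : o ≠ b) (hb : R b = 0) :
    (addTo a o b).Halts (nm inp R) (nm inp (Function.update R o (R o + R a))) := by
  have h1 := halts_loop (inp := inp) (k := a) (p := (push o ()).seq (push b ())) (R a)
    (fun i k => if k = a then R a - i else if k = o then R o + i else if k = b then i else R k)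
    (by simp) fun i hi => ((halts_push inp _ o).seq (halts_push inp _ b)).of_eq rfl
      (nm_congr fun j => by simp only [Function.update_apply]; grind)
  have h2 := halts_loop (inp := inp) (k := b) (p := push a ()) (R a)
    (fun i k => if k = b then R a - i else if k = o then R o + R a else if k = a then i else R k)
    (by simp) fun i hi => (halts_push inp _ a).of_eq rfl
      (nm_congr fun j => by simp only [Function.update_apply]; grind)
  refine (h1.seq (h2.of_eq (nm_congr fun j => ?_) rfl)).of_eq (nm_congr fun j => ?_)
    (nm_congr fun j => ?_)
  · grind
  · grind
  · simp only [Function.update_apply]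
    grind

theorem halts_iterate {Γ : Type} (p : ℕ → Prog Γ) (S : ℕ → Mem Γ) (n : ℕ)
    (h : ∀ j < n, (p j).Halts (S j) (S (j + 1))) :
    (Nat.rec skip (fun j q => q.seq (p j)) n : Prog Γ).Halts (S 0) (S n) := by
  induction n with
  | zero => exact ⟨0, runs_skip _⟩
  | succ n ih => exact (ih fun j hj => h j (by omega)).seq (h n (by omega))

/-- For all choices of input registers and of an empty output register, there is a program for `f`
that only uses the empty registers starting from `base` as additional registers. -/
def Computable {n : ℕ} (f : List.Vector ℕ n → ℕ) : Prop :=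
  ∀ (ins : Fin n → ℕ) (out base : ℕ), (∀ i, ins i < base) → (∀ i, ins i ≠ out) → out < base →
    ∃ p : Prog Unit, ∀ inp R, R out = 0 → (∀ k, base ≤ k → R k = 0) →
      p.Halts (nm inp R) (nm inp (Function.update R out (f (List.Vector.ofFn fun i => R (ins i)))))

theorem Computable.get {n : ℕ} (i : Fin n) : Computable fun v : List.Vector ℕ n => v.get i := by
  intro ins out base h1 h2 h3
  refine ⟨addTo (ins i) out base, fun inp R h4 h5 => ?_⟩
  refine (halts_addTo inp R (h1 i).ne (h2 i) h3.ne (h5 _ le_rfl)).of_eq rfl ?_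
  simp only [List.Vector.get_ofFn, h4, Nat.zero_add]

theorem Computable.zero : Computable fun _ : List.Vector ℕ 0 => 0 := by
  intro ins out base h1 h2 h3
  refine ⟨skip, fun inp R h4 h5 => (halts_skip _).of_eq rfl (nm_congr fun j => ?_)⟩
  simp only [Function.update_apply]
  grind

theorem Computable.succ : Computable fun v : List.Vector ℕ 1 => v.head.succ := by
  intro ins out base h1 h2 h3
  refine ⟨(addTo (ins 0) out base).seq (push out ()), fun inp R h4 h5 => ?_⟩
  refine ((halts_addTo inp R (h1 0).ne (h2 0) h3.ne (h5 _ le_rfl)).seq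
    (halts_push inp _ out)).of_eq rfl (nm_congr fun j => ?_)
  simp only [← List.Vector.get_zero, List.Vector.get_ofFn]
  simp only [Function.update_apply]
  grind

theorem Computable.comp {m n : ℕ} {f : List.Vector ℕ n → ℕ} (g : Fin n → List.Vector ℕ m → ℕ)
    (hf : Computable f) (hg : ∀ i, Computable (g i)) :
    Computable fun a => f (List.Vector.ofFn fun i => g i a) := by
  intro ins out base h1 h2 h3
  have hp : ∀ j : ℕ, ∃ p : Prog Unit, ∀ h : j < n, ∀ inp R, R (base + j) = 0 →
      (∀ k, base + n ≤ k → R k = 0) → p.Halts (nm inp R) (nm inp (Function.update R (base + j)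
        (g ⟨j, h⟩ (List.Vector.ofFn fun i => R (ins i))))) := by
    intro j
    by_cases h : j < n
    · obtain ⟨p, hp⟩ := hg ⟨j, h⟩ ins (base + j) (base + n) (fun i => by have := h1 i; omega)
        (fun i => by have := h1 i; omega) (by omega)
      exact ⟨p, fun _ => hp⟩
    · exact ⟨skip, fun h' => absurd h' h⟩
  choose p hp using hp
  obtain ⟨q, hq⟩ := hf (fun i => base + i) out (base + n) (fun i => by have := i.2; omega)
    (fun i => by omega) (by omega)
  refine ⟨(Nat.rec skip (fun j q => q.seq (p j)) n : Prog Unit).seq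
    (q.seq (Nat.rec skip (fun j q => q.seq (clear (base + j))) n : Prog Unit)),
    fun inp R h4 h5 => ?_⟩
  beta_reduce
  obtain ⟨G, hG⟩ : ∃ G : ℕ → ℕ, ∀ i : Fin n, G i = g i (List.Vector.ofFn fun i => R (ins i)) :=
    ⟨fun j => if h : j < n then g ⟨j, h⟩ (List.Vector.ofFn fun i => R (ins i)) else 0,
      fun i => by simp⟩
  have s1 := halts_iterate p (fun j => nm inp fun k => if base ≤ k ∧ k < base + j then G (k - base)
      else R k) n fun j hj => by
    refine (hp j hj inp _ ?_ ?_).of_eq rfl (nm_congr fun k => ?_)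
    · simp only [lt_irrefl, and_false, if_false]
      exact h5 _ (by omega)
    · intro k hk
      have := h5 k (by omega)
      simp only [this, show ¬ k < base + j by omega, and_false, if_false]
    · have e : ∀ i, ¬ (base ≤ ins i ∧ ins i < base + j) := fun i => by have := h1 i; omega
      simp only [e, if_false, Function.update_apply, ← hG]
      split_ifs with c1 c2 c3 <;> first | rfl | omega | (subst c1; simp)
  have s2 := hq inp (fun k => if base ≤ k ∧ k < base + n then G (k - base) else R k)
    (by simp only [show ¬ base ≤ out by omega, false_and, if_false, h4])
    (fun k hk => by
      simp only [h5 k (by omega), show ¬ k < base + n by omega, and_false, if_false])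
  have e : ∀ i : Fin n, (if base ≤ base + (i : ℕ) ∧ base + (i : ℕ) < base + n then
      G (base + i - base) else R (base + i)) = g i (List.Vector.ofFn fun i => R (ins i)) := by
    intro i
    simp [hG]
  simp only [e] at s2
  generalize f (List.Vector.ofFn fun i => g i (List.Vector.ofFn fun i => R (ins i))) = v at s2 ⊢
  have s3 := halts_iterate (fun j => clear (base + j)) (fun j => nm inp fun k =>
      if k = out then v
      else if base + j ≤ k ∧ k < base + n then G (k - base) else R k) n fun j hj => by
    refine (halts_clear inp _ _).of_eq rfl (nm_congr fun k => ?_)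
    have := h5 (base + j) (by omega)
    simp only [Function.update_apply]
    split_ifs with c1 c2 c3 <;> first | rfl | omega | (subst c1; omega)
  refine (s1.seq (s2.seq (s3.of_eq (nm_congr fun k => ?_) rfl))).of_eq (nm_congr fun k => ?_)
    (nm_congr fun k => ?_)
  · simp only [Function.update_apply, Nat.add_zero]
  · simp only [show ¬ (base ≤ k ∧ k < base + 0) by omega, if_false]
  · simp only [Function.update_apply]
    split_ifs <;> first | rfl | omega

theorem Computable.prec {n : ℕ} {f : List.Vector ℕ n → ℕ} {g : List.Vector ℕ (n + 2) → ℕ}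
    (hf : Computable f) (hg : Computable g) :
    Computable fun v : List.Vector ℕ (n + 1) =>
      v.head.rec (f v.tail) fun y IH => g (y ::ᵥ IH ::ᵥ v.tail) := by
  intro ins out base h1 h2 h3
  obtain ⟨p, hp⟩ := hf (fun i => ins i.succ) (base + 2) (base + 4)
    (fun i => by have := h1 i.succ; omega) (fun i => by have := h1 i.succ; omega) (by omega)
  obtain ⟨q, hq⟩ := hg (Fin.cons (base + 1) (Fin.cons (base + 2) fun i => ins i.succ)) (base + 3)
    (base + 4)
    (by
      refine Fin.cases (by simp) (Fin.cases (by simp) fun i => ?_)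
      have := h1 i.succ
      simp
      omega)
    (by
      refine Fin.cases (by simp) (Fin.cases (by simp) fun i => ?_)
      have := h1 i.succ
      simp
      omega) (by omega)
  refine ⟨(addTo (ins 0) base (base + 4)).seq (p.seq ((loop base fun _ => q.seq
    ((clear (base + 2)).seq ((addTo (base + 3) (base + 2) (base + 4)).seq
      ((clear (base + 3)).seq (push (base + 1) ()))))).seq ((addTo (base + 2) out (base + 4)).seq
        ((clear (base + 2)).seq (clear (base + 1)))))), fun inp R h4 h5 => ?_⟩
  beta_reduce
  have h10 := h1 0
  let v : List.Vector ℕ n := List.Vector.ofFn fun i => R (ins i.succ)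
  obtain ⟨A, hA0, hA, hAr⟩ : ∃ A : ℕ → ℕ, A 0 = f v ∧ (∀ j, A (j + 1) = g (j ::ᵥ A j ::ᵥ v)) ∧
      ∀ j : ℕ, (j.rec (f v) (fun y IH => g (y ::ᵥ IH ::ᵥ v)) : ℕ) = A j :=
    ⟨fun j => j.rec (f v) (fun y IH => g (y ::ᵥ IH ::ᵥ v)), rfl, fun j => rfl, fun j => rfl⟩
  let F : ℕ → ℕ → ℕ := fun j k => if k = base then R (ins 0) - j else if k = base + 1 then j
    else if k = base + 2 then A j else R k
  have hb0 := h5 base (by omega)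
  have hb1 := h5 (base + 1) (by omega)
  have hb2 := h5 (base + 2) (by omega)
  have hb3 := h5 (base + 3) (by omega)
  have hb4 := h5 (base + 4) (by omega)
  have hb' : ∀ k, base + 4 ≤ k → R k = 0 := fun k hk => h5 k (by omega)
  have s1 := halts_addTo inp R (a := ins 0) (o := base) (b := base + 4)
    (by omega) (by omega) (by omega) hb4
  have s2 := hp inp (Function.update R base (R base + R (ins 0)))
    (by rw [Function.update_of_ne (by omega), hb2])
    (fun k hk => by rw [Function.update_of_ne (by omega), hb' k hk])
  have s3 := halts_loop (inp := inp) (k := base) (p := q.seq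
    ((clear (base + 2)).seq ((addTo (base + 3) (base + 2) (base + 4)).seq
      ((clear (base + 3)).seq (push (base + 1) ()))))) (R (ins 0)) F (by simp [F]) fun j hj => by
    have t1 := hq inp (Function.update (F j) base (R (ins 0) - j - 1))
      (by
        rw [Function.update_of_ne (by omega)]
        simp [F, hb3])
      (fun k hk => by
        rw [Function.update_of_ne (by omega)]
        simp only [F, hb' k hk, show k ≠ base by omega, show k ≠ base + 1 by omega,
          show k ≠ base + 2 by omega, if_false])
    have hv : (List.Vector.ofFn fun i => Function.update (F j) base (R (ins 0) - j - 1)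
        ((Fin.cons (base + 1) (Fin.cons (base + 2) fun i => ins i.succ) : Fin (n + 2) → ℕ) i)) =
        j ::ᵥ A j ::ᵥ v := by
      apply List.Vector.ext
      refine Fin.cases ?_ (Fin.cases ?_ fun i => ?_)
      · simp [F]
      · rw [List.Vector.get_ofFn]
        simp [F]
        rfl
      · have := h1 i.succ
        rw [List.Vector.get_ofFn, Fin.cons_succ, Fin.cons_succ,
          Function.update_of_ne (by omega), List.Vector.get_cons_succ, List.Vector.get_cons_succ,
          List.Vector.get_ofFn]
        simp only [F, show ins i.succ ≠ base by omega, show ins i.succ ≠ base + 1 by omega,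
          show ins i.succ ≠ base + 2 by omega, if_false]
    rw [hv, ← hA] at t1
    refine (t1.seq ((halts_clear inp _ _).seq ((halts_addTo inp _ (by omega) (by omega) (by omega)
      ?_).seq ((halts_clear inp _ _).seq (halts_push inp _ _))))).of_eq rfl (nm_congr fun k => ?_)
    · simp [F, hb4]
    · simp only [Function.update_apply, F]
      split_ifs <;> first | omega | (subst_vars; omega)
  have s4 := (halts_addTo inp (F (R (ins 0))) (a := base + 2) (o := out) (b := base + 4)
    (by omega) (by omega) (by omega) (by simp [F, hb4])).seq ((halts_clear inp _ (base + 2)).seq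
      (halts_clear inp _ (base + 1)))
  refine (s1.seq (s2.seq ((s3.of_eq (nm_congr fun k => ?_) rfl).seq s4))).of_eq rfl
    (nm_congr fun k => ?_)
  · have hv : (List.Vector.ofFn fun i => Function.update R base (R base + R (ins 0)) (ins i.succ)) =
        v := by
      apply List.Vector.ext
      intro i
      have := h1 i.succ
      rw [List.Vector.get_ofFn, List.Vector.get_ofFn, Function.update_of_ne (by omega)]
    rw [hv, ← hA0]
    simp only [Function.update_apply, F]
    split_ifs <;> first | omega | (subst_vars; omega)
  · have e : (List.Vector.ofFn fun i => R (ins i)).head.rec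
        (f (List.Vector.ofFn fun i => R (ins i)).tail)
        (fun y IH => g (y ::ᵥ IH ::ᵥ (List.Vector.ofFn fun i => R (ins i)).tail)) =
          A (R (ins 0)) := by
      rw [← List.Vector.get_zero, List.Vector.get_ofFn, List.Vector.tail_ofFn, ← hAr]
    rw [e]
    simp only [Function.update_apply, F]
    split_ifs <;> first | omega | (subst_vars; omega)

theorem computable_of_primrec {n : ℕ} {f : List.Vector ℕ n → ℕ} (hf : Nat.Primrec' f) :
    Computable f := by
  induction hf with
  | zero => exact .zero
  | succ => exact .succ
  | get i => exact .get i
  | comp g _ _ hf hg => exact .comp g hf hg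
  | prec _ _ hf hg => exact .prec hf hg

/-- Three unary registers, with all others empty. -/
def reg3 (d j f : ℕ) : ℕ → ℕ := fun k => if k = 1 then d else if k = 2 then j else if k = 3 then f
  else 0

theorem halts_readUnary (d : ℕ) : ∀ a,
    (loop 3 fun _ => read fun o => bif o.isSome then (push 1 ()).seq (push 3 ()) else skip).Halts
      (nm (List.replicate d true) (reg3 a 0 1)) (nm [] (reg3 (a + d) 0 0)) := by
  induction d with
  | zero =>
    intro a
    refine ⟨_, runs_loop_cons (a := ()) (l := []) rfl (runs_read ((runs_skip _).of_eq ?_ rfl))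
      (runs_loop_nil rfl)⟩
    refine Mem.ext rfl (funext fun k => ?_)
    simp only [Mem.set_reg, nm, reg3]
    split_ifs <;> first | rfl | omega
  | succ d ih =>
    intro a
    refine ⟨_, runs_loop_cons (a := ()) (l := []) rfl (runs_read
      (((halts_push (List.replicate d true) (reg3 a 0 0) 1).seq
        (halts_push _ _ 3)).of_eq ?_ ?_).choose_spec) (ih (a + 1)).choose_spec |>.of_eq rfl ?_⟩
    · refine Mem.ext rfl (funext fun k => ?_)
      simp only [Mem.set_reg, nm, reg3]
      split_ifs <;> first | rfl | omega
    · refine nm_congr fun k => ?_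
      simp only [Function.update_apply, reg3]
      split_ifs <;> first | rfl | omega
    · rw [add_right_comm, add_assoc]

theorem exists_TM_search {Q : ℕ → ℕ → Prop} (hQ : PrimrecRel Q) (h : ∀ d, ∃ i, Q i d) :
    ∃ M : TM, ∀ d, ∃ i, Q i d ∧ (∃ T, ∀ τ, T ≤ τ → tmAccepts M (List.replicate d true) τ) ∧
      ∀ τ ≤ i, ¬ tmAccepts M (List.replicate d true) τ := by
  classical
  have hchi : Primrec fun v : List.Vector ℕ 2 => if Q (v.get 0) (v.get 1) then 1 else 0 :=
    Primrec.ite (hQ.comp (Primrec.vector_get.comp .id (.const 0))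
      (Primrec.vector_get.comp .id (.const 1))) (.const 1) (.const 0)
  obtain ⟨p, hp⟩ := computable_of_primrec (Nat.Primrec'.of_prim hchi) ![2, 1] 4 5
    (by simp [Fin.forall_fin_two]) (by simp [Fin.forall_fin_two]) (by omega)
  have hp' : ∀ d j, p.Halts (nm [] (reg3 d j 0))
      (nm [] (Function.update (reg3 d j 0) 4 (if Q j d then 1 else 0))) := by
    intro d j
    have := hp [] (reg3 d j 0) rfl fun k hk => by
      simp only [reg3, show k ≠ 1 by omega, show k ≠ 2 by omega, show k ≠ 3 by omega, if_false]
    simpa [reg3] using this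
  let body : Prog Unit := p.seq (pop 4 fun o => bif o.isSome then skip
    else (push 2 ()).seq (push 3 ()))
  obtain ⟨M, hM⟩ := exists_TM_of_prog ((push 3 ()).seq ((loop 3 fun _ => read fun o =>
    bif o.isSome then (push 1 ()).seq (push 3 ()) else skip).seq ((push 3 ()).seq
      ((loop 3 fun _ => body).seq (push 0 ())))))
  refine ⟨M, fun d => ⟨Nat.find (h d), Nat.find_spec (h d), ?_⟩⟩
  have search : ∀ r j, j + r = Nat.find (h d) →
      (loop 3 fun _ => body).Halts (nm [] (reg3 d j 1)) (nm [] (reg3 d (Nat.find (h d)) 0)) := by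
    intro r
    induction r with
    | zero =>
      intro j hj
      obtain rfl : j = Nat.find (h d) := hj
      have h1 := hp' d (Nat.find (h d))
      rw [if_pos (Nat.find_spec (h d))] at h1
      refine ⟨_, runs_loop_cons (a := ()) (l := []) rfl
        (((h1.choose_spec).seq (runs_pop (runs_skip _))).of_eq ?_ rfl)
        ((runs_loop_nil rfl).of_eq rfl ?_)⟩
      · refine Mem.ext rfl (funext fun k => ?_)
        simp only [Mem.set_reg, nm, reg3]
        split_ifs <;> first | rfl | omega
      · refine Mem.ext rfl (funext fun k => ?_)
        simp only [Mem.set_reg, nm, reg3, Function.update_apply]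
        split_ifs <;> first | rfl | omega
    | succ r ih =>
      intro j hj
      have h1 := hp' d j
      rw [if_neg (Nat.find_min (h d) (by omega))] at h1
      refine ⟨_, runs_loop_cons (a := ()) (l := []) rfl
        (((h1.choose_spec).seq (runs_pop
          (((halts_push [] (reg3 d j 0) 2).seq (halts_push _ _ 3)).of_eq ?_ ?_).choose_spec)).of_eq
            ?_ rfl) (ih (j + 1) (by omega)).choose_spec⟩
      · refine Mem.ext rfl (funext fun k => ?_)
        simp only [Mem.set_reg, nm, reg3, Function.update_apply]
        split_ifs <;> first | rfl | omega
      · refine nm_congr fun k => ?_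
        simp only [Function.update_apply, reg3]
        split_ifs <;> first | rfl | omega
      · refine Mem.ext rfl (funext fun k => ?_)
        simp only [Mem.set_reg, nm, reg3]
        split_ifs <;> first | rfl | omega
  obtain ⟨t, ht⟩ := ((halts_push (List.replicate d true) (reg3 0 0 0) 3).of_eq (m₁' := nm _
      (reg3 0 0 1)) rfl (nm_congr fun k => by
        simp only [Function.update_apply, reg3]
        split_ifs <;> first | rfl | omega)).seq ((halts_readUnary d 0).seq
    (((halts_push [] (reg3 (0 + d) 0 0) 3).of_eq (m₁' := nm _ (reg3 d 0 1)) rfl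
      (nm_congr fun k => by
        simp only [Function.update_apply, reg3]
        split_ifs <;> first | rfl | omega)).seq ((search (Nat.find (h d)) 0 (by omega)).seq
          (halts_push _ _ 0))))
  obtain ⟨h1, -, h3⟩ := hM (List.replicate d true) _ t (ht.of_eq (m₁ := ⟨_, fun _ => []⟩)
    (Mem.ext rfl (funext fun k => by
      simp only [nm, reg3]
      split_ifs <;> rfl)) rfl)
  refine ⟨⟨_, h1 ?_⟩, fun τ hτ => h3 2 τ ?_⟩
  · simp [nm]
  · simpa [nm, reg3] using hτ

end Prog

/-! ## Programs simulating Turing machines and computing powers -/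

/-- A coding of the elements of `α` by symbols. -/
structure Coding (Γ α : Type) where
  enc : α → Γ
  dec : Γ → α
  dec_enc : ∀ a, dec (enc a) = a

namespace Prog

variable {Γ : Type}

/-- Push the elements of a list, ending with its head. -/
def pushList (k : ℕ) : List Γ → Prog Γ
  | [] => skip
  | a :: l => (pushList k l).seq (push k a)

theorem runs_pushList {k : ℕ} {inp : List Bool} {rs : List (List Γ)} (h : k < rs.length)
    (l : List Γ) :
    (pushList k l).Runs (mem inp rs) (mem inp (rs.set k (l ++ rs.getD k []))) l.length := by
  induction l with
  | nil =>
    refine (runs_skip _).of_eq rfl ?_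
    congr 1
    apply List.ext_getElem?
    intro i
    simp only [List.nil_append, List.getElem?_set, List.getD_eq_getElem?_getD]
    split_ifs with h1
    · subst h1
      simp [h]
    · rfl
  | cons a l ih =>
    refine (ih.seq ((runs_push' (by simpa using h)).of_eq rfl ?_))
    simp [List.getD_eq_getElem?_getD, h]

/-- Replace every symbol of a stack by a list, and push these to another stack. -/
def pushAll (a b : ℕ) (f : Γ → List Γ) : Prog Γ := loop a fun x => pushList b (f x)

theorem runs_pushAll {a b : ℕ} (hab : a ≠ b) (f : Γ → List Γ) {s : ℕ} (hf : ∀ x, (f x).length ≤ s)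
    {inp : List Bool} {rs : List (List Γ)} (ha : a < rs.length) (hb : b < rs.length) :
    (pushAll a b f).Runs (mem inp rs)
      (mem inp ((rs.set a []).set b ((rs.getD a []).reverse.flatMap f ++ rs.getD b [])))
      ((rs.getD a []).length * (s + 1) + 1) := by
  have := runs_loop_fold (k := a) (f := fun x => pushList b (f x))
    (fun r l => mem inp ((rs.set a l).set b r)) (fun r x => f x ++ r) s (fun _ _ => True)
    (fun r l => by
      simp [List.getD_eq_getElem?_getD, ha, Ne.symm hab])
    (fun r x l _ => ⟨((runs_pushList (by simpa using hb) (f x)).of_eq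
        (m₁' := mem inp ((rs.set a l).set b (f x ++ r)))
        (mem_set _ _ _ _ (by simpa using ha)) (by
      congr 1
      apply List.ext_getElem?
      intro i
      simp only [List.getElem?_set, List.getD_eq_getElem?_getD, List.length_set]
      by_cases h1 : b = i
      · subst h1
        simp [hab, hb]
      · by_cases h2 : a = i
        · subst h2
          simp [h1, ha]
        · simp [h1, h2])).mono (hf x), trivial⟩) (rs.getD a []) (rs.getD b []) trivial
  refine this.of_eq ?_ ?_
  · congr 1
    apply List.ext_getElem?
    intro i
    simp only [List.getElem?_set, List.getD_eq_getElem?_getD, List.length_set]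
    by_cases h1 : b = i
    · subst h1
      simp [hb]
    · by_cases h2 : a = i
      · subst h2
        simp [h1, ha]
      · simp [h1, h2]
  · congr 2
    generalize rs.getD a [] = l
    generalize rs.getD b [] = r
    induction l generalizing r with
    | nil => rfl
    | cons x l ih => simp [ih]

/-- One step of the simulation of a Turing machine with state in stack `2` and tape in stacks
`3` (left, reversed) and `4`. -/
def simStep (M : TM) (S : Coding Γ (Fin (M.symbols + 3))) (Q : Coding Γ (Fin (M.states + 1))) :
    Prog Γ :=
  pop 2 fun q =>
    if q.elim M.start Q.dec = M.accept ∨ q.elim M.start Q.dec = M.reject then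
      push 2 (Q.enc (q.elim M.start Q.dec))
    else pop 4 fun s =>
      (push 2 (Q.enc (M.trans (q.elim M.start Q.dec) (s.elim M.blank S.dec)).1)).seq
        (if (M.trans (q.elim M.start Q.dec) (s.elim M.blank S.dec)).2.2 then
          push 3 (S.enc (M.trans (q.elim M.start Q.dec) (s.elim M.blank S.dec)).2.1)
        else (push 4 (S.enc (M.trans (q.elim M.start Q.dec) (s.elim M.blank S.dec)).2.1)).seq
          (pop 3 fun l => push 4 (S.enc (l.elim M.blank S.dec))))

/-- Simulate a Turing machine for as many steps as stack `1` has elements. -/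
def sim (M : TM) (S : Coding Γ (Fin (M.symbols + 3))) (Q : Coding Γ (Fin (M.states + 1))) :
    Prog Γ :=
  (push 2 (Q.enc M.start)).seq (loop 1 fun _ => simStep M S Q)

theorem head?_map_elim {α : Type} (S : Coding Γ α) (l : List α) (a : α) :
    (l.map S.enc).head?.elim a S.dec = l.headD a := by
  cases l with
  | nil => rfl
  | cons b l => exact S.dec_enc b

theorem runs_simStep (M : TM) (S : Coding Γ (Fin (M.symbols + 3)))
    (Q : Coding Γ (Fin (M.states + 1))) (inp : List Bool) (o n : List Γ) (rest : List (List Γ))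
    (c : LCfg M) :
    (simStep M S Q).Runs
      (mem inp (o :: n :: [Q.enc c.1] :: c.2.1.map S.enc :: c.2.2.map S.enc :: rest))
      (mem inp (o :: n :: [Q.enc (listStep M c).1] :: (listStep M c).2.1.map S.enc ::
        (listStep M c).2.2.map S.enc :: rest)) 6 := by
  obtain ⟨q, l, r⟩ := c
  refine (runs_pop' (t := 5) (by simp) ?_)
  simp only [List.getD_cons_succ, List.getD_cons_zero, List.head?_cons, Option.elim_some, Q.dec_enc,
    List.set_cons_succ, List.set_cons_zero, List.tail_cons]
  by_cases hc : q = M.accept ∨ q = M.reject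
  · simp only [hc, if_true, listStep]
    exact (runs_push' (by simp)).mono (by omega)
  · simp only [hc, if_false, listStep]
    refine (runs_pop' (t := 4) (by simp) ?_)
    simp only [List.getD_cons_succ, List.getD_cons_zero, head?_map_elim,
      List.set_cons_succ, List.set_cons_zero]
    by_cases hd : (M.trans q (r.headD M.blank)).2.2 = true
    · simp only [hd, if_true, ← List.map_tail]
      exact ((runs_push' (by simp)).seq ((runs_push' (by simp)).of_eq rfl (by simp))).mono
        (by omega)
    · simp only [hd, ← List.map_tail]
      refine ((runs_push' (by simp)).seq ((runs_push' (by simp)).seq (runs_pop' (t := 1) (by simp)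
        ?_)))
      simp only [List.getD_cons_succ, List.getD_cons_zero, head?_map_elim,
        List.set_cons_succ, List.set_cons_zero]
      exact (runs_push' (by simp)).of_eq rfl (by simp [List.map_tail])

theorem runs_sim (M : TM) (S : Coding Γ (Fin (M.symbols + 3)))
    (Q : Coding Γ (Fin (M.states + 1))) (inp : List Bool) (o : List Γ) (u : Γ)
    (rest : List (List Γ)) (w : Bitstring) (t : ℕ) :
    (sim M S Q).Runs
      (mem inp (o :: List.replicate t u :: [] :: [] :: (w.map M.sym).map S.enc :: rest))
      (mem inp (o :: [] :: [Q.enc (listRun M w t).1] :: (listRun M w t).2.1.map S.enc ::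
        (listRun M w t).2.2.map S.enc :: rest)) (7 * t + 2) := by
  have := runs_loop_nat (k := 1) (u := u) (p := simStep M S Q) (fun i j => mem inp (o ::
    List.replicate j u :: [Q.enc (listRun M w i).1] :: (listRun M w i).2.1.map S.enc ::
        (listRun M w i).2.2.map S.enc :: rest)) 6 t (fun i j _ => rfl) (fun i j _ =>
      (runs_simStep M S Q inp o (List.replicate j u) rest (listRun M w i)).of_eq
        ((mem_set _ _ _ _ (by simp)).trans rfl) (by
          simp only [listRun, Function.iterate_succ_apply']))
  exact (((runs_push' (by simp)).of_eq rfl rfl).seq this).mono (by omega)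

theorem length_listRun (M : TM) (w : Bitstring) (t : ℕ) :
    (listRun M w t).2.1.length + (listRun M w t).2.2.length ≤ w.length + 2 * t := by
  induction t with
  | zero => simp [listRun]
  | succ t ih =>
    rw [listRun, Function.iterate_succ_apply', ← listRun]
    generalize listRun M w t = c at *
    unfold listStep
    split_ifs
    · omega
    · simp only [List.length_cons, List.length_tail]
      omega
    · simp only [List.length_cons, List.length_tail]
      omega

def drain (k : ℕ) : Prog Γ := pushAll k (k + 1) fun _ => []

theorem runs_drain {k : ℕ} {inp : List Bool} {rs : List (List Γ)} (h : k + 1 < rs.length) :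
    (drain k).Runs (mem inp rs) (mem inp (rs.set k [])) ((rs.getD k []).length + 1) := by
  refine (runs_pushAll (s := 0) (by omega) _ (by simp) (by omega) h).of_eq rfl ?_ |>.mono (by omega)
  congr 1
  apply List.ext_getElem?
  intro i
  simp only [List.getElem?_set, List.getD_eq_getElem?_getD, List.length_set]
  by_cases h1 : k + 1 = i
  · subst h1
    simp [h]
  · simp [h1]

/-- Multiply stack `a` by a constant as often as stack `n` has elements, where `p` pushes the
constant to stack `b`. -/
def power (n a b : ℕ) (p : Prog Γ) : Prog Γ :=
  loop n fun _ => (loop a fun _ => p).seq (move b a)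

theorem runs_power {n a b : ℕ} {p : Prog Γ} {u : Γ} {q t : ℕ} (F : ℕ → ℕ → ℕ → Mem Γ)
    (hn : ∀ d i j, (F d i j).reg n = List.replicate d u)
    (ha : ∀ d i j, (F d i j).reg a = List.replicate i u)
    (hn' : ∀ d i j, (F (d + 1) i j).set n (List.replicate d u) = F d i j)
    (hp : ∀ d i j, p.Runs ((F d (i + 1) j).set a (List.replicate i u)) (F d i (j + q)) t)
    (hm : ∀ d j, (move b a).Runs (F d 0 j) (F d j 0) (2 * j + 1)) (hq : 1 ≤ q) (d : ℕ) :
    (power n a b p).Runs (F d 1 0) (F 0 (q ^ d) 0) (d * (q ^ d * (t + 3) + 3) + 1) := by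
  have := runs_loop_nat (k := n) (u := u) (p := (loop a fun _ => p).seq (move b a))
    (fun i j => F j (q ^ i) 0) (q ^ d * (t + 3) + 2) d (fun i j _ => hn _ _ _) (fun i j hij => by
      rw [hn']
      have h1 := runs_loop_nat (k := a) (u := u) (p := p) (fun i' j' => F j j' (i' * q)) t (q ^ i)
        (fun i' j' _ => ha _ _ _) (fun i' j' _ => (hp _ _ _).of_eq rfl (by rw [Nat.succ_mul]))
      rw [Nat.zero_mul] at h1
      refine (h1.seq (hm j _)).mono ?_
      rw [← Nat.pow_succ]
      have h2 : q ^ i ≤ q ^ d := Nat.pow_le_pow_right hq (by omega)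
      have h3 : q ^ i.succ ≤ q ^ d := Nat.pow_le_pow_right hq (by omega)
      nlinarith [Nat.mul_le_mul_right (t + 1) h2])
  rw [pow_zero] at this
  exact this.mono (by linarith)

end Prog

/-! ## The fragments of the verifier -/

/-- The state of the parser of strings `1^d 0 1^r 0 x`: the reversed input, the number `d`,
the reversed string `x`, and the phase. -/
structure PSt where
  w : List Bool
  d : ℕ
  x : List Bool
  ph : Option Bool

def PSt.step (s : PSt) (b : Bool) : PSt :=
  match s.ph, b with
  | none, true => ⟨b :: s.w, s.d + 1, s.x, none⟩
  | none, false => ⟨b :: s.w, s.d, s.x, some false⟩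
  | some false, true => ⟨b :: s.w, s.d, s.x, some false⟩
  | some false, false => ⟨b :: s.w, s.d, s.x, some true⟩
  | some true, b => ⟨b :: s.w, s.d, b :: s.x, some true⟩

def parse (w : Bitstring) : PSt := w.foldl PSt.step ⟨[], 0, [], none⟩

namespace Prog

variable {Γ : Type}

/-- Parse the first word of the input. -/
def parseBit (B : Coding Γ Bool) (a : Γ) (b : Bool) : Prog Γ :=
  (push 6 (B.enc b)).seq ((push 7 (B.enc true)).seq (pop 18 fun o =>
    match o.map B.dec, b with
    | none, true => (push 8 (B.enc true)).seq (push 4 a)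
    | none, false => push 18 (B.enc false)
    | some false, true => push 18 (B.enc false)
    | some false, false => push 18 (B.enc true)
    | some true, b => (push 18 (B.enc true)).seq ((push 9 (B.enc b)).seq ((push 1 (B.enc true)).seq
        ((push 10 (B.enc true)).seq (push 11 (B.enc true)))))))

def parseMem (B : Coding Γ Bool) (a : Γ) (inp : List Bool) (s : PSt) : Mem Γ :=
  mem inp [[], List.replicate s.x.length (B.enc true), [], [], List.replicate s.d a, [],
    s.w.map B.enc, List.replicate s.w.length (B.enc true), List.replicate s.d (B.enc true),
    s.x.map B.enc, List.replicate s.x.length (B.enc true),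
    List.replicate s.x.length (B.enc true), [], [], [], [], [], [], s.ph.toList.map B.enc]

theorem runs_parseBit (B : Coding Γ Bool) (a : Γ) (s : PSt) (b : Bool) (inp : List Bool) :
    (parseBit B a b).Runs (parseMem B a inp s) (parseMem B a inp (s.step b)) 8 := by
  obtain ⟨w, d, x, ph⟩ := s
  refine ((runs_push' (by simp)).seq ((runs_push' (by simp)).seq (runs_pop' (t := 5) (by simp)
    ?_)))
  simp only [List.getD_cons_succ, List.getD_cons_zero, List.set_cons_succ, List.set_cons_zero]
  rcases ph with _ | _ | _
  · cases b
    · exact ((runs_push' (by simp)).of_eq rfl rfl).mono (by omega)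
    · exact ((runs_push' (by simp)).seq ((runs_push' (by simp)).of_eq rfl rfl)).mono (by omega)
  · simp only [Option.toList_some, List.map_cons, List.map_nil, List.head?_cons, Option.map_some,
      B.dec_enc]
    cases b
    · exact ((runs_push' (by simp)).of_eq rfl rfl).mono (by omega)
    · exact ((runs_push' (by simp)).of_eq rfl rfl).mono (by omega)
  · simp only [Option.toList_some, List.map_cons, List.map_nil, List.head?_cons, Option.map_some,
      B.dec_enc]
    refine ((runs_push' (by simp)).seq ((runs_push' (by simp)).seq ((runs_push' (by simp)).seq
      ((runs_push' (by simp)).seq ((runs_push' (by simp)).of_eq rfl ?_)))))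
    cases b <;> rfl

theorem runs_parse (B : Coding Γ Bool) (a : Γ) (w s : List Bool) :
    (readAll 0 5 (B.enc true) (parseBit B a)).Runs
      ⟨encWord 0 w ++ (stopMark 0 ++ s), fun _ => []⟩ (parseMem B a s (parse w))
      ((w.length + 1) * 13) :=
  (runs_readAll (fl := 5) (.inl rfl) (fun x => (parseMem B a [] x).reg) PSt.step 8 (fun x => rfl)
    (fun x b inp => runs_parseBit B a x b inp) w ⟨[], 0, [], none⟩).of_eq
    (by rw [← mem_replicate _ 19]; rfl) rfl

/-- Read off up to `j` bits from stack `6`, and run `f` on the word read if the stack is found to be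
empty, otherwise `g`. -/
def lookup (B : Coding Γ Bool) (f : List Bool → Prog Γ) (g : Prog Γ) : ℕ → List Bool → Prog Γ
  | 0, _ => g
  | j + 1, acc => pop 6 fun o => o.elim (f acc) fun a => lookup B f g j (B.dec a :: acc)

theorem runs_lookup {B : Coding Γ Bool} {f : List Bool → Prog Γ} {g : Prog Γ} {m' : Mem Γ} {t : ℕ}
    {inp : List Bool} {a₀ a₁ a₂ a₃ a₄ a₅ : List Γ} {rest : List (List Γ)} (j : ℕ) :
    ∀ (acc l : List Bool),
    (l.length < j → (f (l.reverse ++ acc)).Runs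
      (mem inp (a₀ :: a₁ :: a₂ :: a₃ :: a₄ :: a₅ :: [] :: rest)) m' t) →
    (j ≤ l.length → g.Runs
      (mem inp (a₀ :: a₁ :: a₂ :: a₃ :: a₄ :: a₅ :: (l.drop j).map B.enc :: rest)) m' t) →
    (lookup B f g j acc).Runs
      (mem inp (a₀ :: a₁ :: a₂ :: a₃ :: a₄ :: a₅ :: l.map B.enc :: rest)) m' (t + j) := by
  induction j with
  | zero => intro acc l _ hg; exact hg (by omega)
  | succ j ih =>
    intro acc l hf hg
    refine runs_pop' (by simp) ?_
    simp only [List.getD_cons_succ, List.getD_cons_zero, List.set_cons_succ, List.set_cons_zero]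
    cases l with
    | nil => exact (hf (by simp)).mono (Nat.le_add_right t j)
    | cons b l =>
      simp only [List.map_cons, List.head?_cons, Option.elim_some, B.dec_enc, List.tail_cons]
      refine ih (b :: acc) l (fun h => ?_) (fun h => ?_)
      · have := hf (by simpa using h)
        simpa using this
      · exact hg (by simpa using h)

/-- Push the number of elements of stack `10` plus two to stack `13`. -/
def addBody (u : Γ) : Prog Γ :=
  (loop 10 fun _ => (push 13 u).seq (push 14 u)).seq ((move 14 10).seq ((push 13 u).seq (push 13 u)))

theorem runs_addBody (u : Γ) (inp : List Bool) (a₀ a₁ a₂ a₃ a₄ a₅ a₆ a₇ a₈ a₉ a₁₁ a₁₂ : List Γ)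
    (rest : List (List Γ)) (n j : ℕ) :
    (addBody u).Runs (mem inp (a₀ :: a₁ :: a₂ :: a₃ :: a₄ :: a₅ :: a₆ :: a₇ :: a₈ :: a₉ ::
        List.replicate n u :: a₁₁ :: a₁₂ :: List.replicate j u :: [] :: rest))
      (mem inp (a₀ :: a₁ :: a₂ :: a₃ :: a₄ :: a₅ :: a₆ :: a₇ :: a₈ :: a₉ ::
        List.replicate n u :: a₁₁ :: a₁₂ :: List.replicate (j + (n + 2)) u :: [] :: rest))
      (5 * n + 4) := by
  have h1 := runs_loop_nat (k := 10) (u := u) (p := (push 13 u).seq (push 14 u)) (fun i k =>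
    mem inp (a₀ :: a₁ :: a₂ :: a₃ :: a₄ :: a₅ :: a₆ :: a₇ :: a₈ :: a₉ ::
        List.replicate k u :: a₁₁ :: a₁₂ :: List.replicate (j + i) u :: List.replicate i u :: rest))
    2 n (fun i k _ => rfl) (fun i k _ => ((runs_push' (by simp)).seq (runs_push' (by simp))).of_eq
      (mem_set _ _ _ _ (by simp)) rfl)
  have h2 : (move 14 10).Runs (mem inp (a₀ :: a₁ :: a₂ :: a₃ :: a₄ :: a₅ :: a₆ :: a₇ :: a₈ :: a₉ ::
        [] :: a₁₁ :: a₁₂ :: List.replicate (j + n) u :: List.replicate n u :: rest))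
      (mem inp (a₀ :: a₁ :: a₂ :: a₃ :: a₄ :: a₅ :: a₆ :: a₇ :: a₈ :: a₉ ::
        List.replicate n u :: a₁₁ :: a₁₂ :: List.replicate (j + n) u :: [] :: rest)) (2 * n + 1) :=
    ((runs_move' (by simp) (by simp) (by simp)).of_eq rfl (by simp)).mono (by simp)
  refine (h1.seq (h2.seq ((runs_push' (by simp)).seq ((runs_push' (by simp)).of_eq rfl rfl)))).mono
    (by omega)

/-- Compute `(n + 2) ^ d`. -/
def powProg (u : Γ) : Prog Γ := (push 12 u).seq (power 8 12 13 (addBody u))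

theorem runs_powProg (u : Γ) (inp : List Bool) (a₀ a₁ a₂ a₃ a₄ a₅ a₆ a₇ a₉ a₁₁ : List Γ)
    (rest : List (List Γ)) (n d : ℕ) :
    (powProg u).Runs (mem inp (a₀ :: a₁ :: a₂ :: a₃ :: a₄ :: a₅ :: a₆ :: a₇ ::
        List.replicate d u :: a₉ :: List.replicate n u :: a₁₁ :: [] :: [] :: [] :: rest))
      (mem inp (a₀ :: a₁ :: a₂ :: a₃ :: a₄ :: a₅ :: a₆ :: a₇ ::
        [] :: a₉ :: List.replicate n u :: a₁₁ :: List.replicate ((n + 2) ^ d) u :: [] :: [] :: rest))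
      (d * ((n + 2) ^ d * (5 * n + 7) + 3) + 2) := by
  have h1 := runs_power (n := 8) (a := 12) (b := 13) (p := addBody u) (u := u) (q := n + 2)
    (t := 5 * n + 4) (fun d i j => mem inp (a₀ :: a₁ :: a₂ :: a₃ :: a₄ :: a₅ :: a₆ :: a₇ ::
        List.replicate d u :: a₉ :: List.replicate n u :: a₁₁ :: List.replicate i u ::
          List.replicate j u :: [] :: rest))
    (fun d i j => rfl) (fun d i j => rfl) (fun d i j => mem_set _ _ _ _ (by simp))
    (fun d i j => (runs_addBody u inp a₀ a₁ a₂ a₃ a₄ a₅ a₆ a₇ _ a₉ a₁₁ _ rest n j).of_eq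
      (mem_set _ _ _ _ (by simp)) rfl)
    (fun d j => ((runs_move' (by simp) (by simp) (by simp)).of_eq rfl (by simp)).mono (by simp))
    (by omega) d
  exact (((runs_push' (by simp)).of_eq rfl rfl).seq h1).mono (by
    rw [show 5 * n + 4 + 3 = 5 * n + 7 from rfl]
    omega)

/-- Compute `2 ^ (κ * (n + 1))`. -/
def expProg (u : Γ) (κ : ℕ) : Prog Γ :=
  (push 12 u).seq ((push 11 u).seq (power 11 12 13 (pushList 13 (List.replicate (2 ^ κ) u))))

theorem runs_expProg (u : Γ) (κ : ℕ) (inp : List Bool)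
    (a₀ a₁ a₂ a₃ a₄ a₅ a₆ a₇ a₈ a₉ a₁₀ : List Γ) (rest : List (List Γ)) (n : ℕ) :
    (expProg u κ).Runs (mem inp (a₀ :: a₁ :: a₂ :: a₃ :: a₄ :: a₅ :: a₆ :: a₇ :: a₈ :: a₉ :: a₁₀ ::
        List.replicate n u :: [] :: [] :: rest))
      (mem inp (a₀ :: a₁ :: a₂ :: a₃ :: a₄ :: a₅ :: a₆ :: a₇ :: a₈ :: a₉ :: a₁₀ ::
        [] :: List.replicate (2 ^ (κ * (n + 1))) u :: [] :: rest))
      ((n + 1) * (2 ^ (κ * (n + 1)) * (2 ^ κ + 3) + 3) + 3) := by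
  have h1 := runs_power (n := 11) (a := 12) (b := 13)
    (p := pushList 13 (List.replicate (2 ^ κ) u)) (u := u) (q := 2 ^ κ)
    (t := 2 ^ κ) (fun d i j => mem inp (a₀ :: a₁ :: a₂ :: a₃ :: a₄ :: a₅ :: a₆ :: a₇ :: a₈ :: a₉ ::
      a₁₀ :: List.replicate d u :: List.replicate i u :: List.replicate j u :: rest))
    (fun d i j => rfl) (fun d i j => rfl) (fun d i j => mem_set _ _ _ _ (by simp))
    (fun d i j => ((runs_pushList (by simp) _).of_eq (mem_set _ _ _ _ (by simp))
      (by simp [Nat.add_comm])).mono (by simp))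
    (fun d j => ((runs_move' (by simp) (by simp) (by simp)).of_eq rfl (by simp)).mono (by simp))
    Nat.one_le_two_pow (n + 1)
  rw [← pow_mul] at h1
  exact ((runs_push' (by simp)).seq (((runs_push' (by simp)).of_eq rfl rfl).seq h1)).mono (by omega)

/-- Push a symbol to stack `15` if stack `12` is longer than stack `7`. -/
def cmpProg (u : Γ) : Prog Γ :=
  loop 12 fun _ => pop 7 fun o => o.elim (push 15 u) fun _ => skip

theorem runs_cmpProg (u : Γ) (inp : List Bool)
    (a₀ a₁ a₂ a₃ a₄ a₅ a₆ a₈ a₉ a₁₀ a₁₁ a₁₃ a₁₄ : List Γ) (rest : List (List Γ)) (m P : ℕ) :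
    (cmpProg u).Runs (mem inp (a₀ :: a₁ :: a₂ :: a₃ :: a₄ :: a₅ :: a₆ :: List.replicate m u :: a₈ ::
        a₉ :: a₁₀ :: a₁₁ :: List.replicate P u :: a₁₃ :: a₁₄ :: [] :: rest))
      (mem inp (a₀ :: a₁ :: a₂ :: a₃ :: a₄ :: a₅ :: a₆ :: List.replicate (m - P) u :: a₈ ::
        a₉ :: a₁₀ :: a₁₁ :: [] :: a₁₃ :: a₁₄ :: List.replicate (P - m) u :: rest))
      (P * 3 + 1) := by
  have h1 := runs_loop_nat (k := 12) (u := u) (p := pop 7 fun o => o.elim (push 15 u) fun _ => skip)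
    (fun i j => mem inp (a₀ :: a₁ :: a₂ :: a₃ :: a₄ :: a₅ :: a₆ :: List.replicate (m - i) u :: a₈ ::
        a₉ :: a₁₀ :: a₁₁ :: List.replicate j u :: a₁₃ :: a₁₄ :: List.replicate (i - m) u :: rest))
    2 P (fun i j _ => rfl) (fun i j _ => by
      rw [mem_set _ _ _ _ (by simp)]
      refine runs_pop' (t := 1) (by simp) ?_
      simp only [List.getD_cons_succ, List.getD_cons_zero, List.set_cons_succ, List.set_cons_zero]
      rcases Nat.lt_or_ge i m with h | h
      · obtain ⟨r, rfl⟩ : ∃ r, m = i + r + 1 := ⟨m - i - 1, by omega⟩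
        simp only [show i + r + 1 - i = r + 1 by omega, show i + r + 1 - (i + 1) = r by omega,
          show i - (i + r + 1) = 0 by omega, show i + 1 - (i + r + 1) = 0 by omega]
        exact (runs_skip _).mono (by omega)
      · simp only [show m - i = 0 by omega, show m - (i + 1) = 0 by omega,
          show i + 1 - m = (i - m) + 1 by omega]
        exact (runs_push' (by simp)).of_eq rfl rfl)
  exact h1.of_eq (by simp) (by simp)

/-- Distribute the length of stack `12`. -/
def distProg (u : Γ) (c : ℕ) : Prog Γ :=
  (loop 12 fun _ => (push 13 u).seq ((push 14 u).seq (pushList 1 (List.replicate c u)))).seq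
    (pushList 1 (List.replicate c u))

theorem runs_distProg (u : Γ) (c : ℕ) (inp : List Bool)
    (a₀ a₂ a₃ a₄ a₅ a₆ a₇ a₈ a₉ a₁₀ a₁₁ : List Γ) (rest : List (List Γ)) (T : ℕ) :
    (distProg u c).Runs (mem inp (a₀ :: [] :: a₂ :: a₃ :: a₄ :: a₅ :: a₆ :: a₇ :: a₈ ::
        a₉ :: a₁₀ :: a₁₁ :: List.replicate T u :: [] :: [] :: rest))
      (mem inp (a₀ :: List.replicate (c * T + c) u :: a₂ :: a₃ :: a₄ :: a₅ :: a₆ :: a₇ :: a₈ ::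
        a₉ :: a₁₀ :: a₁₁ :: [] :: List.replicate T u :: List.replicate T u :: rest))
      (T * (c + 3) + c + 1) := by
  have h1 := runs_loop_nat (k := 12) (u := u)
    (p := (push 13 u).seq ((push 14 u).seq (pushList 1 (List.replicate c u))))
    (fun i j => mem inp (a₀ :: List.replicate (c * i) u :: a₂ :: a₃ :: a₄ :: a₅ :: a₆ :: a₇ :: a₈ ::
        a₉ :: a₁₀ :: a₁₁ :: List.replicate j u :: List.replicate i u :: List.replicate i u :: rest))
    (c + 2) T (fun i j _ => rfl) (fun i j _ => by
      rw [mem_set _ _ _ _ (by simp)]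
      refine ((runs_push' (by simp)).seq ((runs_push' (by simp)).seq ((runs_pushList (by simp)
        _).of_eq rfl ?_))).mono ?_
      · simp [Nat.mul_succ, Nat.add_comm (c * i) c, ← List.replicate_succ]
      · simp only [List.length_replicate]
        omega)
  refine ((h1.seq ((runs_pushList (by simp) _).of_eq rfl ?_)).of_eq rfl rfl).mono ?_
  · simp [Nat.add_comm c]
  · simp only [List.length_replicate]
    linarith

/-- Read a word from the input as long as there is time on stack `14`. -/
theorem runs_readY (B : Coding Γ Bool) {s inp : List Bool} (hs : IsStop 3 s inp)
    (a₀ a₁ a₂ a₃ a₄ a₆ a₇ a₈ a₉ a₁₀ a₁₁ a₁₂ a₁₃ a₁₅ : List Γ) (rest : List (List Γ)) (T : ℕ)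
    (y : List Bool) :
    (readAll 3 5 (B.enc true) fun b => pop 14 fun o => o.elim skip fun _ => push 16 (B.enc b)).Runs
      (mem (encWord 3 y ++ s) (a₀ :: a₁ :: a₂ :: a₃ :: a₄ :: [] :: a₆ :: a₇ :: a₈ :: a₉ :: a₁₀ ::
        a₁₁ :: a₁₂ :: a₁₃ :: List.replicate T (B.enc true) :: a₁₅ :: [] :: rest))
      (mem inp (a₀ :: a₁ :: a₂ :: a₃ :: a₄ :: [] :: a₆ :: a₇ :: a₈ :: a₉ :: a₁₀ ::
        a₁₁ :: a₁₂ :: a₁₃ :: List.replicate (T - y.length) (B.enc true) :: a₁₅ ::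
          (y.take T).reverse.map B.enc :: rest))
      ((y.length + 1) * 13) := by
  have h1 := runs_readAll (fl := 5) (u := B.enc true)
    (g := fun b => pop 14 fun o => o.elim skip fun _ => push 16 (B.enc b)) hs
    (fun v : ℕ × List Bool => (mem [] (a₀ :: a₁ :: a₂ :: a₃ :: a₄ :: [] :: a₆ :: a₇ :: a₈ :: a₉ ::
        a₁₀ :: a₁₁ :: a₁₂ :: a₁₃ :: List.replicate v.1 (B.enc true) :: a₁₅ ::
          v.2.map B.enc :: rest) : Mem Γ).reg)
    (fun v b => if v.1 = 0 then v else (v.1 - 1, b :: v.2)) 2 (fun v => rfl) (fun v b inp => by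
      obtain ⟨v, l⟩ := v
      refine runs_pop' (t := 1) (rs := (a₀ :: a₁ :: a₂ :: a₃ :: a₄ :: [] :: a₆ :: a₇ :: a₈ :: a₉ ::
        a₁₀ :: a₁₁ :: a₁₂ :: a₁₃ :: List.replicate v (B.enc true) :: a₁₅ ::
          l.map B.enc :: rest)) (by simp) ?_
      simp only [List.getD_cons_succ, List.getD_cons_zero, List.set_cons_succ, List.set_cons_zero]
      cases v with
      | zero => exact ((runs_skip _).of_eq rfl rfl).mono (by omega)
      | succ v => exact (runs_push' (by simp)).of_eq rfl rfl) y (T, [])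
  refine h1.of_eq rfl ?_
  have h2 : ∀ (y : List Bool) (T : ℕ) (l : List Bool),
      y.foldl (fun v b => if v.1 = 0 then v else (v.1 - 1, b :: v.2)) (T, l) =
        (T - y.length, (y.take T).reverse ++ l) := by
    intro y
    induction y with
    | nil => simp
    | cons b y ih =>
      intro T l
      cases T with
      | zero =>
        simp only [List.foldl_cons, if_true, ih]
        simp
      | succ T => simp [ih]
  rw [h2, List.append_nil]
  rfl

/-- Read a word at the end of the input, for as many symbols as there are on stack `13`. -/
theorem runs_readZ (B : Coding Γ Bool)
    (a₀ a₁ a₂ a₃ a₄ a₅ a₆ a₇ a₈ a₉ a₁₀ a₁₁ a₁₂ a₁₄ a₁₅ a₁₆ : List Γ) (rest : List (List Γ)) (T : ℕ)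
    (z : List Bool) :
    (loop 13 fun _ => block 3 fun o => o.elim skip fun b => push 17 (B.enc b)).Runs
      (mem (encWord 3 z) (a₀ :: a₁ :: a₂ :: a₃ :: a₄ :: a₅ :: a₆ :: a₇ :: a₈ :: a₉ :: a₁₀ ::
        a₁₁ :: a₁₂ :: List.replicate T (B.enc true) :: a₁₄ :: a₁₅ :: a₁₆ :: [] :: rest))
      (mem (encWord 3 (z.drop T)) (a₀ :: a₁ :: a₂ :: a₃ :: a₄ :: a₅ :: a₆ :: a₇ :: a₈ :: a₉ ::
        a₁₀ :: a₁₁ :: a₁₂ :: [] :: a₁₄ :: a₁₅ :: a₁₆ :: (z.take T).reverse.map B.enc :: rest))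
      (T * 10 + 1) := by
  refine (runs_loop_nat (k := 13) (u := B.enc true)
    (p := block 3 fun o => o.elim skip fun b => push 17 (B.enc b))
    (fun i j => mem (encWord 3 (z.drop i)) (a₀ :: a₁ :: a₂ :: a₃ :: a₄ :: a₅ :: a₆ :: a₇ :: a₈ ::
        a₉ :: a₁₀ :: a₁₁ :: a₁₂ :: List.replicate j (B.enc true) :: a₁₄ :: a₁₅ :: a₁₆ ::
        (z.take i).reverse.map B.enc :: rest)) 9 T (fun i j _ => rfl) fun i j _ => ?_).of_eq
    (by simp) rfl
  rw [mem_set _ _ _ _ (by simp)]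
  rcases Nat.lt_or_ge i z.length with h | h
  · rw [List.drop_eq_getElem_cons h, List.take_succ_eq_append_getElem h, encWord]
    refine (runs_block_data (t := 1) (b := z[i]) (inp := encWord 3 (z.drop (i + 1)))
      ((runs_push' (k := 17) (rs := (a₀ :: a₁ :: a₂ :: a₃ :: a₄ :: a₅ :: a₆ :: a₇ :: a₈ :: a₉ ::
        a₁₀ :: a₁₁ :: a₁₂ :: List.replicate j (B.enc true) :: a₁₄ :: a₁₅ :: a₁₆ ::
        (z.take i).reverse.map B.enc :: rest)) (by simp)).of_eq rfl ?_)).of_eq rfl rfl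
    rw [List.reverse_append]
    rfl
  · rw [List.drop_eq_nil_of_le h, List.drop_eq_nil_of_le (by omega), List.take_of_length_le h,
      List.take_of_length_le (by omega)]
    exact (runs_block_mark (.inr ⟨rfl, rfl⟩) (runs_skip _)).mono (by omega)

end Prog

/-! ## The verifier -/

namespace Prog

variable {Γ : Type}

def encSym (M : TM) (S : Coding Γ (Fin (M.symbols + 3))) (l : Bitstring) : List Γ :=
  (l.map M.sym).map S.enc

theorem encSym_append (M : TM) (S : Coding Γ (Fin (M.symbols + 3))) (l l' : Bitstring) :
    encSym M S (l ++ l') = encSym M S l ++ encSym M S l' := by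
  simp [encSym]

theorem length_encSym (M : TM) (S : Coding Γ (Fin (M.symbols + 3))) (l : Bitstring) :
    (encSym M S l).length = l.length := by
  simp [encSym]

theorem flatMap_encSym (B : Coding Γ Bool) (M : TM) (S : Coding Γ (Fin (M.symbols + 3))) (r : ℕ)
    (l : Bitstring) :
    (l.map B.enc).flatMap (fun g => encSym M S (rep r (B.dec g) ++ rep r (B.dec g))) =
      encSym M S (encWord r l) := by
  induction l with
  | nil => rfl
  | cons b l ih =>
    rw [List.map_cons, List.flatMap_cons, ih, encWord, B.dec_enc, ← encSym_append]

theorem pair_nil_pair (x y z : Bitstring) :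
    pair x (pair [] (pair y z)) = encWord 0 x ++ (stopMark 0 ++ (stopMark 1 ++
      (encWord 3 y ++ (stopMark 3 ++ encWord 3 z)))) := by
  rw [pair_eq x, pair_eq [], pair_eq y]
  simp only [encWord, List.nil_append, encodeBits_append, encodeBits_encWord, encodeBits_stopMark,
    encodeBits_eq z]

/-- Write the input word of a machine to stack `4`, from its parts on stacks `9`, `16`, `17`. -/
def tapeProg (B : Coding Γ Bool) (M : TM) (S : Coding Γ (Fin (M.symbols + 3))) : Prog Γ :=
  (pushAll 17 4 fun g => encSym M S (rep 3 (B.dec g) ++ rep 3 (B.dec g))).seq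
    ((pushList 4 (encSym M S (stopMark 3))).seq
      ((pushAll 16 4 fun g => encSym M S (rep 3 (B.dec g) ++ rep 3 (B.dec g))).seq
        ((pushList 4 (encSym M S (stopMark 0 ++ stopMark 1))).seq
          (pushAll 9 4 fun g => encSym M S (rep 0 (B.dec g) ++ rep 0 (B.dec g))))))

theorem runs_tapeProg (B : Coding Γ Bool) (M : TM) (S : Coding Γ (Fin (M.symbols + 3)))
    (inp : List Bool) (a₀ a₁ a₂ a₃ a₅ a₆ a₇ a₈ a₁₀ a₁₁ a₁₂ a₁₃ a₁₄ a₁₅ : List Γ)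
    (rest : List (List Γ)) (x y z : Bitstring) :
    (tapeProg B M S).Runs
      (mem inp (a₀ :: a₁ :: a₂ :: a₃ :: [] :: a₅ :: a₆ :: a₇ :: a₈ :: x.reverse.map B.enc :: a₁₀ ::
        a₁₁ :: a₁₂ :: a₁₃ :: a₁₄ :: a₁₅ :: y.reverse.map B.enc :: z.reverse.map B.enc :: rest))
      (mem inp (a₀ :: a₁ :: a₂ :: a₃ :: encSym M S (pair x (pair [] (pair y z))) :: a₅ :: a₆ ::
        a₇ :: a₈ :: [] :: a₁₀ :: a₁₁ :: a₁₂ :: a₁₃ :: a₁₄ :: a₁₅ :: [] :: [] :: rest))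
      (z.length * 9 + y.length * 9 + x.length * 3 + 17) := by
  have hl : ∀ r g, (encSym M S (rep r (B.dec g) ++ rep r (B.dec g))).length ≤ 2 * r + 2 := by
    intro r g
    rw [length_encSym]
    simp [rep]
    omega
  have hs : ∀ r, (encSym M S (stopMark r)).length = 2 * r + 2 := by
    intro r
    rw [length_encSym]
    simp [stopMark, rep]
    omega
  refine ((runs_pushAll (by omega) _ (hl 3) (by simp) (by simp)).seq
    ((runs_pushList (by simp) _).seq ((runs_pushAll (by omega) _ (hl 3) (by simp) (by simp)).seq
      ((runs_pushList (by simp) _).seq ((runs_pushAll (by omega) _ (hl 0) (by simp)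
        (by simp)).of_eq rfl ?_))))).mono ?_
  · simp only [List.getD_cons_succ, List.getD_cons_zero, List.set_cons_succ, List.set_cons_zero,
      ← List.map_reverse, List.reverse_reverse, flatMap_encSym]
    simp only [pair_nil_pair, encSym_append, List.append_assoc, List.append_nil]
  · simp only [List.getD_cons_succ, List.getD_cons_zero, List.set_cons_succ, List.set_cons_zero,
      List.length_map, List.length_reverse, encSym_append, List.length_append, hs]
    omega

section Main

variable (B : Coding Γ Bool)
  (MR : TM) (SR : Coding Γ (Fin (MR.symbols + 3))) (QR : Coding Γ (Fin (MR.states + 1)))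
  (ML : TM) (SL : Coding Γ (Fin (ML.symbols + 3))) (QL : Coding Γ (Fin (ML.states + 1)))
  (κ c : ℕ)

def guardProg : Prog Γ :=
  (powProg (B.enc true)).seq ((cmpProg (B.enc true)).seq ((sim MR SR QR).seq
    ((pop 2 fun q => if q.elim MR.start QR.dec = MR.accept then push 15 (B.enc true) else skip).seq
      ((drain 3).seq (drain 4)))))

open Classical in
theorem runs_guardProg (inp : List Bool) (a₆ a₉ a₁₁ : List Γ) (rest : List (List Γ)) (n d m : ℕ) :
    (guardProg B MR SR QR).Runs
      (mem inp ([] :: List.replicate n (B.enc true) :: [] :: [] ::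
        encSym MR SR (List.replicate d true) :: [] :: a₆ :: List.replicate m (B.enc true) ::
        List.replicate d (B.enc true) :: a₉ :: List.replicate n (B.enc true) :: a₁₁ :: [] :: [] ::
        [] :: [] :: rest))
      (mem inp ([] :: [] :: [] :: [] :: [] :: [] :: a₆ :: List.replicate (m - (n + 2) ^ d)
        (B.enc true) :: [] :: a₉ :: List.replicate n (B.enc true) :: a₁₁ :: [] :: [] ::
        [] :: List.replicate (((n + 2) ^ d - m) +
          if tmAccepts MR (List.replicate d true) n then 1 else 0) (B.enc true) :: rest))
      (d * ((n + 2) ^ d * (5 * n + 7) + 3) + (n + 2) ^ d * 3 + 11 * n + d + 9) := by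
  have hlen := length_listRun MR (List.replicate d true) n
  rw [List.length_replicate] at hlen
  refine ((runs_powProg _ _ _ _ _ _ _ _ _ _ _ _ _ _ _).seq
    ((runs_cmpProg _ _ _ _ _ _ _ _ _ _ _ _ _ _ _ _ _ _).seq
      ((runs_sim MR SR QR _ _ _ _ _ _).seq ((runs_pop' (t := 1) (m' := mem inp ([] :: [] :: [] ::
        (listRun MR (List.replicate d true) n).2.1.map SR.enc ::
        (listRun MR (List.replicate d true) n).2.2.map SR.enc :: [] :: a₆ ::
        List.replicate (m - (n + 2) ^ d)
        (B.enc true) :: [] :: a₉ :: List.replicate n (B.enc true) :: a₁₁ :: [] :: [] ::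
        [] :: List.replicate (((n + 2) ^ d - m) +
          if tmAccepts MR (List.replicate d true) n then 1 else 0) (B.enc true) :: rest)) (by simp)
        ?_).seq ((runs_drain (by simp)).seq ((runs_drain (by simp)).of_eq rfl rfl)))))).mono ?_
  · simp only [List.getD_cons_succ, List.getD_cons_zero, List.head?_cons, Option.elim_some,
      QR.dec_enc, List.set_cons_succ, List.set_cons_zero, List.tail_cons, tmAccepts_iff]
    by_cases h : (listRun MR (List.replicate d true) n).1 = MR.accept
    · simp only [h, if_true]
      exact (runs_push' (by simp)).of_eq rfl rfl
    · simp only [h, if_false]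
      exact (runs_skip _).mono (by omega)
  · simp only [List.getD_cons_succ, List.getD_cons_zero, List.set_cons_succ, List.set_cons_zero,
      List.length_map]
    omega

def mainProg : Prog Γ :=
  (guardProg B MR SR QR).seq ((expProg (B.enc true) κ).seq ((distProg (B.enc true) c).seq
    ((readAll 1 5 (B.enc true) fun _ => skip).seq
      ((readAll 3 5 (B.enc true) fun b => pop 14 fun o =>
        o.elim skip fun _ => push 16 (B.enc b)).seq
      ((loop 13 fun _ => block 3 fun o => o.elim skip fun b => push 17 (B.enc b)).seq
      ((tapeProg B ML SL).seq ((sim ML SL QL).seq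
        (pop 2 fun q => if q.elim ML.start QL.dec = ML.accept then
          pop 15 fun o => o.elim (push 0 (B.enc true)) fun _ => skip else skip))))))))

theorem runs_mainProg (a₆ a₁₈ : List Γ) (x y z : Bitstring) (d m : ℕ) :
    ∃ m', (mainProg B MR SR QR ML SL QL κ c).Runs
      (mem (stopMark 1 ++ (encWord 3 y ++ (stopMark 3 ++ encWord 3 z)))
        [[], List.replicate x.length (B.enc true), [], [],
        encSym MR SR (List.replicate d true), [], a₆, List.replicate m (B.enc true),
        List.replicate d (B.enc true), x.reverse.map B.enc, List.replicate x.length (B.enc true),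
        List.replicate x.length (B.enc true), [], [], [], [], [], [], a₁₈]) m'
      (d * ((x.length + 2) ^ d * (5 * x.length + 7) + 3) + (x.length + 2) ^ d * 3 +
        (x.length + 1) * (2 ^ (κ * (x.length + 1)) * (2 ^ κ + 3) + 3) +
        2 ^ (κ * (x.length + 1)) * (8 * c + 31) + y.length * 13 + 14 * x.length + d + 8 * c + 100) ∧
      (m'.reg 0 ≠ [] ↔ (x.length + 2) ^ d ≤ m ∧ ¬ tmAccepts MR (List.replicate d true) x.length ∧
        tmAccepts ML (pair x (pair [] (pair (y.take (2 ^ (κ * (x.length + 1))))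
          (z.take (2 ^ (κ * (x.length + 1))))))) (c * 2 ^ (κ * (x.length + 1)) + c)) := by
  classical
  set T := 2 ^ (κ * (x.length + 1)) with hT
  have hfin : ∀ (b : ℕ) (q : Fin (ML.states + 1)) (inp : List Bool) (rs : List (List Γ)),
      2 < rs.length → 15 < rs.length →
      rs.getD 2 [] = [QL.enc q] → rs.getD 0 [] = [] →
      rs.getD 15 [] = List.replicate b (B.enc true) →
      ∃ m', (pop 2 fun q => if q.elim ML.start QL.dec = ML.accept then
          pop 15 fun o => o.elim (push 0 (B.enc true)) fun _ => skip else skip).Runs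
        (mem inp rs) m' 3 ∧ (m'.reg 0 ≠ [] ↔ b = 0 ∧ q = ML.accept) := by
    intro b q inp rs h2 h15 e2 e0 e15
    have hin : ∀ m' t, (if q = ML.accept then
          pop 15 fun o => o.elim (push 0 (B.enc true)) fun _ => skip else skip).Runs
          (mem inp (rs.set 2 [])) m' t → (pop 2 fun q => if q.elim ML.start QL.dec = ML.accept then
          pop 15 fun o => o.elim (push 0 (B.enc true)) fun _ => skip else skip).Runs
        (mem inp rs) m' (t + 1) := by
      intro m' t h
      refine runs_pop' h2 ?_
      rw [e2]
      simpa only [List.head?_cons, Option.elim_some, QL.dec_enc, List.tail_cons] using h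
    have e15' : (rs.set 2 []).getD 15 [] = List.replicate b (B.enc true) := by
      rw [← e15]
      simp [List.getD_eq_getElem?_getD]
    have e0' : rs[0]?.getD [] = [] := by
      rwa [List.getD_eq_getElem?_getD] at e0
    by_cases hq : q = ML.accept
    · rcases b with _ | b
      · refine ⟨mem inp (((rs.set 2 []).set 15 []).set 0 [B.enc true]), hin _ 2 ?_, ?_⟩
        · rw [if_pos hq]
          refine runs_pop' (t := 1) (by simpa using h15) ?_
          rw [e15']
          refine (runs_push' (by simp; omega)).of_eq rfl ?_
          simp [List.getD_eq_getElem?_getD, e0']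
        · simp [List.getD_eq_getElem?_getD, show 0 < rs.length by omega, hq]
      · refine ⟨mem inp ((rs.set 2 []).set 15 (List.replicate b (B.enc true))), hin _ 2 ?_, ?_⟩
        · rw [if_pos hq]
          refine runs_pop' (t := 1) (by simpa using h15) ?_
          rw [e15']
          exact (runs_skip _).mono (by omega)
        · simp [List.getD_eq_getElem?_getD, e0']
    · refine ⟨mem inp (rs.set 2 []), hin _ 2 ?_, ?_⟩
      · rw [if_neg hq]
        exact (runs_skip _).mono (by omega)
      · simp [List.getD_eq_getElem?_getD, e0', hq]
  set w := pair x (pair [] (pair (y.take T) (z.take T))) with hw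
  set b := ((x.length + 2) ^ d - m) + if tmAccepts MR (List.replicate d true) x.length then 1 else 0
    with hb
  obtain ⟨m', h1, h2⟩ := hfin b (listRun ML w (c * T + c)).1 (encWord 3 (z.drop T))
    [[], [], [QL.enc (listRun ML w (c * T + c)).1],
      (listRun ML w (c * T + c)).2.1.map SL.enc, (listRun ML w (c * T + c)).2.2.map SL.enc,
      [], a₆, List.replicate (m - (x.length + 2) ^ d) (B.enc true), [], [],
      List.replicate x.length (B.enc true), [], [], [],
      List.replicate (T - y.length) (B.enc true), List.replicate b (B.enc true), [], [], a₁₈]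
    (by simp) (by simp) rfl rfl rfl
  have hnil : (readAll 1 5 (B.enc true) fun _ => skip).Runs
      (mem (stopMark 1 ++ (encWord 3 y ++ (stopMark 3 ++ encWord 3 z)))
        [[], List.replicate (c * T + c) (B.enc true), [], [], [], [], a₆,
          List.replicate (m - (x.length + 2) ^ d) (B.enc true), [], x.reverse.map B.enc,
          List.replicate x.length (B.enc true), [], [], List.replicate T (B.enc true),
          List.replicate T (B.enc true), List.replicate b (B.enc true), [], [], a₁₈])
      (mem (encWord 3 y ++ (stopMark 3 ++ encWord 3 z))
        [[], List.replicate (c * T + c) (B.enc true), [], [], [], [], a₆,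
          List.replicate (m - (x.length + 2) ^ d) (B.enc true), [], x.reverse.map B.enc,
          List.replicate x.length (B.enc true), [], [], List.replicate T (B.enc true),
          List.replicate T (B.enc true), List.replicate b (B.enc true), [], [], a₁₈]) 7 :=
    (runs_readAll (fl := 5) (.inl rfl) (fun _ : Unit => (mem []
      [[], List.replicate (c * T + c) (B.enc true), [], [], [], [], a₆,
          List.replicate (m - (x.length + 2) ^ d) (B.enc true), [], x.reverse.map B.enc,
          List.replicate x.length (B.enc true), [], [], List.replicate T (B.enc true),
          List.replicate T (B.enc true), List.replicate b (B.enc true), [], [], a₁₈]).reg)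
      (fun _ _ => ()) 0 (fun _ => rfl) (fun _ b inp => (runs_skip _).of_eq rfl rfl) [] ()).mono
      (by simp)
  refine ⟨m', ((runs_guardProg B MR SR QR _ _ _ _ _ _ _ _).seq ((runs_expProg _ κ _ _ _ _ _ _ _ _ _
    _ _ _ _ _).seq ((runs_distProg _ c _ _ _ _ _ _ _ _ _ _ _ _ _ _).seq (hnil.seq
      ((runs_readY B (.inl rfl) _ _ _ _ _ _ _ _ _ _ _ _ _ _ _ T y).seq
      ((runs_readZ B _ _ _ _ _ _ _ _ _ _ _ _ _ _ _ _ _ T z).seq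
      ((runs_tapeProg B ML SL _ _ _ _ _ _ _ _ _ _ _ _ _ _ _ _ x (y.take T) (z.take T)).seq
      ((runs_sim ML SL QL _ _ _ _ _ _).seq h1)))))))).mono ?_, ?_⟩
  · rw [← hT]
    have h3 : (y.take T).length ≤ T := by simp
    have h4 : (z.take T).length ≤ T := by simp
    nlinarith
  · rw [h2, ← tmAccepts_iff, hb]
    split_ifs with h <;> simp [h, Nat.sub_eq_zero_iff_le]

end Main

end Prog

theorem parse_append (w v : Bitstring) : parse (w ++ v) = v.foldl PSt.step (parse w) :=
  List.foldl_append

theorem parse_invariant (w : Bitstring) : (parse w).w = w.reverse ∧ (parse w).d ≤ w.length ∧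
    (parse w).x.length ≤ w.length := by
  induction w using List.reverseRecOn with
  | nil => simp [parse]
  | append_singleton w b ih =>
    rw [parse_append, List.foldl_cons, List.foldl_nil, List.length_append, List.reverse_append]
    generalize parse w = s at *
    obtain ⟨v, d, x, ph⟩ := s
    obtain ⟨h1, h2, h3⟩ := ih
    simp only at h1 h2 h3
    subst h1
    rcases ph with _ | _ | _ <;> cases b <;> simp [PSt.step] <;> first | exact ⟨h2, h3⟩ | omega

/-- The number in the first part of a padded string. -/
def num (w : Bitstring) : ℕ := (parse w).d

/-- The string in the last part of a padded string. -/
def body (w : Bitstring) : Bitstring := (parse w).x.reverse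

theorem num_le (w : Bitstring) : num w ≤ w.length := (parse_invariant w).2.1

theorem length_body_le (w : Bitstring) : (body w).length ≤ w.length := by
  rw [body, List.length_reverse]
  exact (parse_invariant w).2.2

theorem parse_replicate (d : ℕ) : parse (List.replicate d true) =
    ⟨List.replicate d true, d, [], none⟩ := by
  induction d with
  | zero => rfl
  | succ d ih =>
    rw [List.replicate_succ', parse_append, ih, ← List.replicate_succ', List.replicate_succ]
    rfl

theorem parse_padded (d r : ℕ) (x : Bitstring) :
    num (List.replicate d true ++ false :: List.replicate r true ++ false :: x) = d ∧
      body (List.replicate d true ++ false :: List.replicate r true ++ false :: x) = x := by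
  have h1 : ∀ (r : ℕ) (w : List Bool), ((List.replicate r true).foldl PSt.step
      ⟨w, d, [], some false⟩) = ⟨List.replicate r true ++ w, d, [], some false⟩ := by
    intro r
    induction r with
    | zero => intro w; rfl
    | succ r ih =>
      intro w
      rw [List.replicate_succ, List.foldl_cons, List.cons_append, ← List.cons_append,
        ← List.replicate_succ, List.replicate_succ', List.append_assoc]
      exact ih (true :: w)
  have h2 : ∀ (x w v : List Bool), x.foldl PSt.step ⟨w, d, v, some true⟩ =
      ⟨x.reverse ++ w, d, x.reverse ++ v, some true⟩ := by
    intro x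
    induction x with
    | nil => intro w v; rfl
    | cons b x ih =>
      intro w v
      rw [List.foldl_cons, List.reverse_cons, List.append_assoc, List.append_assoc]
      exact ih (b :: w) (b :: v)
  have h3 : parse (List.replicate d true ++ false :: List.replicate r true ++ false :: x) =
      x.foldl PSt.step ⟨false :: (List.replicate r true ++ false :: List.replicate d true), d, [],
        some true⟩ := by
    rw [List.append_assoc, parse_append, parse_replicate, List.cons_append, List.foldl_cons]
    change (List.replicate r true ++ false :: x).foldl PSt.step
      ⟨false :: List.replicate d true, d, [], some false⟩ = _
    rw [List.foldl_append, h1]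
    rfl
  rw [num, body, h3, h2]
  simp

/-- The predicate decided by the verifier. -/
def VerAcc (MR ML : TM) (κ c m₀ : ℕ) (A : Language) (w y z : Bitstring) : Prop :=
  (w.length < m₀ ∧ w ∈ A) ∨ (m₀ ≤ w.length ∧ ((body w).length + 2) ^ num w ≤ w.length ∧
    ¬ tmAccepts MR (List.replicate (num w) true) (body w).length ∧
    tmAccepts ML (pair (body w) (pair [] (pair (y.take (2 ^ (κ * ((body w).length + 1))))
      (z.take (2 ^ (κ * ((body w).length + 1))))))) (c * 2 ^ (κ * ((body w).length + 1)) + c))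

/-- The size governing the running time of the verifier. -/
def verSize (κ : ℕ) (w y : Bitstring) : ℕ :=
  w.length + 2 ^ (κ * ((body w).length + 1)) + ((body w).length + 2) ^ num w + y.length + 1

namespace Prog

variable {Γ : Type}

open Classical in
/-- The program of the verifier. -/
noncomputable def verProg (B : Coding Γ Bool)
    (MR : TM) (SR : Coding Γ (Fin (MR.symbols + 3))) (QR : Coding Γ (Fin (MR.states + 1)))
    (ML : TM) (SL : Coding Γ (Fin (ML.symbols + 3))) (QL : Coding Γ (Fin (ML.states + 1)))
    (κ c m₀ : ℕ) (A : Language) : Prog Γ :=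
  (readAll 0 5 (B.enc true) (parseBit B (SR.enc (MR.sym true)))).seq
    (lookup B (fun v => if v ∈ A then push 0 (B.enc true) else skip)
      (mainProg B MR SR QR ML SL QL κ c) m₀ [])

theorem runs_verProg (B : Coding Γ Bool)
    (MR : TM) (SR : Coding Γ (Fin (MR.symbols + 3))) (QR : Coding Γ (Fin (MR.states + 1)))
    (ML : TM) (SL : Coding Γ (Fin (ML.symbols + 3))) (QL : Coding Γ (Fin (ML.states + 1)))
    (κ c m₀ : ℕ) (A : Language) (w y z : Bitstring) :
    ∃ m', (verProg B MR SR QR ML SL QL κ c m₀ A).Runs ⟨pair w (pair [] (pair y z)), fun _ => []⟩ m'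
        ((2 * 2 ^ κ + 16 * c + m₀ + 250) * verSize κ w y ^ 3) ∧
      (m'.reg 0 ≠ [] ↔ VerAcc MR ML κ c m₀ A w y z) := by
  classical
  obtain ⟨hw, -, -⟩ := parse_invariant w
  have hn := length_body_le w
  have hd := num_le w
  have hx : (parse w).x = (body w).reverse := by rw [body, List.reverse_reverse]
  set x := body w with hxdef
  have hmem : parseMem B (SR.enc (MR.sym true)) (stopMark 1 ++ (encWord 3 y ++ (stopMark 3 ++
      encWord 3 z))) (parse w) = mem (stopMark 1 ++ (encWord 3 y ++ (stopMark 3 ++ encWord 3 z)))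
        [[], List.replicate x.length (B.enc true), [], [],
        encSym MR SR (List.replicate (num w) true), [], w.reverse.map B.enc,
        List.replicate w.length (B.enc true),
        List.replicate (num w) (B.enc true), x.reverse.map B.enc,
        List.replicate x.length (B.enc true), List.replicate x.length (B.enc true), [], [], [], [],
        [], [], (parse w).ph.toList.map B.enc] := by
    simp only [parseMem, hx, hw, encSym, List.map_replicate, List.length_reverse, num]
  have h0 := runs_parse B (SR.enc (MR.sym true)) w
    (stopMark 1 ++ (encWord 3 y ++ (stopMark 3 ++ encWord 3 z)))
  rw [← pair_nil_pair, hmem] at h0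
  have htime : ∀ n d P T W Y q : ℕ, n ≤ W → d ≤ W →
      (W + 1) * 13 + (d * (P * (5 * n + 7) + 3) + P * 3 + (n + 1) * (T * (q + 3) + 3) +
        T * (8 * c + 31) + Y * 13 + 14 * n + d + 8 * c + 100 + m₀) ≤
          (2 * q + 16 * c + m₀ + 250) * (W + T + P + Y + 1) ^ 3 := by
    intro n d P T W Y q hn hd
    set N := W + T + P + Y + 1 with hN
    have hN1 : 1 ≤ N := by omega
    have hNK : N ≤ N ^ 3 := Nat.le_self_pow (by omega) N
    have h2K : N * N ≤ N ^ 3 := by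
      rw [← sq]
      exact Nat.pow_le_pow_right hN1 (by omega)
    have e1 : d * P * n ≤ N ^ 3 := by
      rw [pow_succ, sq]
      exact Nat.mul_le_mul (Nat.mul_le_mul (by omega) (by omega)) (by omega)
    have e2 : d * P ≤ N ^ 3 := (Nat.mul_le_mul (by omega) (by omega)).trans h2K
    have e3 : n * T ≤ N ^ 3 := (Nat.mul_le_mul (by omega) (by omega)).trans h2K
    have e4 : T ≤ N ^ 3 := by omega
    generalize N ^ 3 = K at *
    have e5 := Nat.mul_le_mul_right q e3
    have e6 := Nat.mul_le_mul_right q e4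
    have e7 := Nat.mul_le_mul_right c e4
    have e8 := Nat.mul_le_mul_right c (hN1.trans hNK)
    have e9 := Nat.mul_le_mul_right m₀ (hN1.trans hNK)
    nlinarith
  have ht := htime x.length (num w) ((x.length + 2) ^ num w) (2 ^ (κ * (x.length + 1))) w.length
    y.length (2 ^ κ) hn hd
  by_cases hm : w.length < m₀
  · have hv : VerAcc MR ML κ c m₀ A w y z ↔ w ∈ A := by
      simp [VerAcc, hm, Nat.not_le.mpr hm]
    rw [hv]
    have hshort : ∀ (inp : List Bool) (rs : List (List Γ)), ∃ m',
        (if w ∈ A then push 0 (B.enc true) else skip : Prog Γ).Runs (mem inp ([] :: rs)) m' 1 ∧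
          (m'.reg 0 ≠ [] ↔ w ∈ A) := by
      intro inp rs
      by_cases hA : w ∈ A
      · rw [if_pos hA]
        exact ⟨_, runs_push' (by simp), by simp [hA]⟩
      · rw [if_neg hA]
        exact ⟨_, (runs_skip _).mono (by omega), by simp [hA]⟩
    obtain ⟨m', h1, h2⟩ := hshort (stopMark 1 ++ (encWord 3 y ++ (stopMark 3 ++ encWord 3 z)))
      [List.replicate x.length (B.enc true), [], [],
        encSym MR SR (List.replicate (num w) true), [], [],
        List.replicate w.length (B.enc true),
        List.replicate (num w) (B.enc true), x.reverse.map B.enc,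
        List.replicate x.length (B.enc true), List.replicate x.length (B.enc true), [], [], [], [],
        [], [], (parse w).ph.toList.map B.enc]
    refine ⟨m', (h0.seq (runs_lookup m₀ [] w.reverse (t := 1) (fun _ => ?_) (fun h => ?_))).mono
        (le_trans ?_ ht), h2⟩
    · rw [List.reverse_reverse, List.append_nil]
      exact h1
    · rw [List.length_reverse] at h
      omega
    · refine Nat.add_le_add_left (Nat.add_le_add_right ?_ _) _
      omega
  · have hv : VerAcc MR ML κ c m₀ A w y z ↔ ((body w).length + 2) ^ num w ≤ w.length ∧
        ¬ tmAccepts MR (List.replicate (num w) true) (body w).length ∧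
        tmAccepts ML (pair (body w) (pair [] (pair (y.take (2 ^ (κ * ((body w).length + 1))))
          (z.take (2 ^ (κ * ((body w).length + 1)))))))
          (c * 2 ^ (κ * ((body w).length + 1)) + c) := by
      simp [VerAcc, hm, Nat.not_lt.mp hm]
    rw [hv]
    obtain ⟨m', h1, h2⟩ := runs_mainProg B MR SR QR ML SL QL κ c
      ((w.reverse.drop m₀).map B.enc) ((parse w).ph.toList.map B.enc) x y z (num w) w.length
    refine ⟨m', (h0.seq (runs_lookup m₀ [] w.reverse (fun h => ?_) (fun h => h1))).mono ht, h2⟩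
    rw [List.length_reverse] at h
    omega

end Prog

open Prog in
theorem exists_TM_verifier (MR ML : TM) (κ c m₀ : ℕ) (A : Language) :
    ∃ (M : TM) (C : ℕ), ∀ w y z : Bitstring,
      (VerAcc MR ML κ c m₀ A w y z → ∀ τ, C * verSize κ w y ^ 6 ≤ τ →
        tmAccepts M (pair w (pair [] (pair y z))) τ) ∧
      (¬ VerAcc MR ML κ c m₀ A w y z → ∀ τ, ¬ tmAccepts M (pair w (pair [] (pair y z))) τ) := by
  let Γ := Bool × (Fin (MR.symbols + 3) × Fin (MR.states + 1)) ×
    (Fin (ML.symbols + 3) × Fin (ML.states + 1))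
  have hfin : Finite Γ := inferInstance
  let B : Coding Γ Bool := ⟨fun b => (b, (0, 0), (0, 0)), fun g => g.1, fun _ => rfl⟩
  let SR : Coding Γ (Fin (MR.symbols + 3)) :=
    ⟨fun s => (false, (s, 0), (0, 0)), fun g => g.2.1.1, fun _ => rfl⟩
  let QR : Coding Γ (Fin (MR.states + 1)) :=
    ⟨fun s => (false, (0, s), (0, 0)), fun g => g.2.1.2, fun _ => rfl⟩
  let SL : Coding Γ (Fin (ML.symbols + 3)) :=
    ⟨fun s => (false, (0, 0), (s, 0)), fun g => g.2.2.1, fun _ => rfl⟩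
  let QL : Coding Γ (Fin (ML.states + 1)) :=
    ⟨fun s => (false, (0, 0), (0, s)), fun g => g.2.2.2, fun _ => rfl⟩
  have hR := runs_verProg B MR SR QR ML SL QL κ c m₀ A
  obtain ⟨M, hM⟩ := exists_TM_of_prog (verProg B MR SR QR ML SL QL κ c m₀ A)
  generalize 2 * 2 ^ κ + 16 * c + m₀ + 250 = C at hR
  refine ⟨M, 2 * (C + 1) ^ 2 + 3, fun w y z => ?_⟩
  obtain ⟨m', h1, h2⟩ := hR w y z
  obtain ⟨h3, h4, -⟩ := hM _ _ _ h1
  refine ⟨fun h τ hτ => h3 (h2.mpr h) τ (le_trans ?_ hτ), fun h τ => h4 (not_not.mp fun h' =>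
    h (h2.mp h')) τ⟩
  have hN : 1 ≤ verSize κ w y ^ 3 := Nat.one_le_pow _ _ (Nat.le_add_left 1 _)
  rw [show verSize κ w y ^ 6 = (verSize κ w y ^ 3) ^ 2 by ring]
  generalize verSize κ w y ^ 3 = K at *
  have : C * K + 1 ≤ (C + 1) * K := by nlinarith
  have := Nat.pow_le_pow_left this 2
  rw [mul_pow] at this
  have : 1 ≤ K ^ 2 := Nat.one_le_pow _ _ hN
  nlinarith

/-- A language of padded strings is decided by a `Σ₂` machine in any time bound dominating the
exponential time needed for the strings accepted by the guard. -/
theorem mem_sigma2Time_of_guard {A : Language} {MR ML : TM} {κ c : ℕ} (hA : ∀ w, w ∈ A ↔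
      ((body w).length + 2) ^ num w ≤ w.length ∧
      ¬ tmAccepts MR (List.replicate (num w) true) (body w).length ∧
      Sig2Accepts ML c (2 ^ (κ * ((body w).length + 1))) (body w) [])
    {t : ℕ → ℕ} (m₀ : ℕ) (ht : ∀ w : Bitstring, m₀ ≤ w.length →
      ((body w).length + 2) ^ num w ≤ w.length →
      ¬ tmAccepts MR (List.replicate (num w) true) (body w).length →
      (w.length + 2 ^ (κ * ((body w).length + 1)) + 1) ^ 6 ≤ t w.length) :
    A ∈ Sigma2Time t := by
  obtain ⟨M, C, hM⟩ := exists_TM_verifier MR ML κ c m₀ A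
  set K := C * (m₀ + 2 ^ (κ * (m₀ + 1)) + (m₀ + 2) ^ m₀ + 1) ^ 6 with hK
  refine ⟨C * 2 ^ 6 + K, M, fun _ => [], fun _ => le_rfl, fun w => ?_⟩
  have hacc : ∀ y z τ, tmAccepts M (pair w (pair [] (pair y z))) τ →
      VerAcc MR ML κ c m₀ A w y z := fun y z τ h => by
    by_contra hv
    exact (hM w y z).2 hv τ h
  have hn := length_body_le w
  have hd := num_le w
  rcases Nat.lt_or_ge w.length m₀ with hm | hm
  · constructor
    · intro hw
      refine ⟨[], by simp, fun z _ => (hM w [] z).1 (.inl ⟨hm, hw⟩) _ ?_⟩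
      have h1 : verSize κ w [] ≤ m₀ + 2 ^ (κ * (m₀ + 1)) + (m₀ + 2) ^ m₀ + 1 := by
        have e1 : 2 ^ (κ * ((body w).length + 1)) ≤ 2 ^ (κ * (m₀ + 1)) :=
          Nat.pow_le_pow_right (by omega) (Nat.mul_le_mul_left κ (by omega))
        have e2 : ((body w).length + 2) ^ num w ≤ (m₀ + 2) ^ m₀ :=
          (Nat.pow_le_pow_left (by omega) _).trans (Nat.pow_le_pow_right (by omega) (by omega))
        rw [verSize, List.length_nil]
        omega
      have h2 := Nat.mul_le_mul_left C (Nat.pow_le_pow_left h1 6)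
      rw [← hK] at h2
      omega
    · rintro ⟨y, -, h⟩
      rcases hacc _ _ _ (h [] (by simp)) with h | h
      · exact h.2
      · omega
  · by_cases hg : ((body w).length + 2) ^ num w ≤ w.length ∧
      ¬ tmAccepts MR (List.replicate (num w) true) (body w).length
    · have hT := ht w hm hg.1 hg.2
      rw [hA]
      simp only [hg, true_and, not_false_eq_true]
      set T := 2 ^ (κ * ((body w).length + 1)) with hTdef
      have hTt : T ≤ t w.length := by
        refine le_trans ?_ hT
        exact (show T ≤ w.length + T + 1 by omega).trans (Nat.le_self_pow (by omega) _)
      constructor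
      · rintro ⟨y, hy, h⟩
        refine ⟨y, hy.trans hTt, fun z _ => (hM w y z).1 (.inr ⟨hm, hg.1, hg.2, ?_⟩) _ ?_⟩
        · rw [← hTdef, List.take_of_length_le hy]
          exact h _ (by simp)
        · have h1 : verSize κ w y ≤ 2 * (w.length + T + 1) := by
            rw [verSize, ← hTdef]
            have := hg.1
            omega
          have h2 := Nat.mul_le_mul_left C (Nat.pow_le_pow_left h1 6)
          rw [mul_pow] at h2
          have h3 := Nat.mul_le_mul_left (C * 2 ^ 6) hT
          rw [← mul_assoc] at h2
          rw [add_mul]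
          omega
      · rintro ⟨y, -, h⟩
        refine ⟨y.take T, by simp, fun z hz => ?_⟩
        rcases hacc _ _ _ (h z (hz.trans hTt)) with h | h
        · omega
        · rw [← hTdef, List.take_of_length_le hz] at h
          exact h.2.2.2
    · constructor
      · intro hw
        have := (hA w).mp hw
        exact absurd ⟨this.1, this.2.1⟩ hg
      · rintro ⟨y, -, h⟩
        rcases hacc _ _ _ (h [] (by simp)) with h | h
        · omega
        · exact absurd ⟨h.2.1, h.2.2.1⟩ hg

/-! ## The separation -/

/-- A language with infinitely many slices of polynomial complexity is in i.o.-`NP/poly`. -/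
theorem mem_ioClass_of_compact {L : Language} {e : ℕ}
    (h : {n : ℕ | Compact L n ((n + 2) ^ e)}.Infinite) : L ∈ ioClass NPpoly := by
  classical
  obtain ⟨M, hM⟩ := exists_TM_check
  set adv : ℕ → Bitstring := fun n => if hn : Compact L n ((n + 2) ^ e) then hn.choose else []
    with hadv
  have hlen : ∀ n, (adv n).length ≤ (n + 2) ^ e := by
    intro n
    simp only [hadv]
    split_ifs with hn
    · exact hn.choose_spec.1
    · simp
  have hpow : ∀ n, (n + 2) ^ e ≤ (n + 2) ^ (4 * (e + 1) + 18) := fun n =>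
    Nat.pow_le_pow_right (by omega) (by omega)
  refine ⟨{x | ∃ y : Bitstring, y.length ≤ (x.length + 2) ^ (4 * (e + 1) + 18) ∧
    tmAccepts M (pair x (pair (adv x.length) y)) ((x.length + 2) ^ (4 * (e + 1) + 18))},
    ⟨4 * (e + 1) + 18, M, adv, fun n => (hlen n).trans (hpow n), fun x => Iff.rfl⟩,
    h.mono fun n hn x hx => ?_⟩
  have hn' : Compact L n ((n + 2) ^ e) := hn
  have hchoose : adv n = hn'.choose := by
    simp only [hadv]
    rw [dif_pos hn']
  rw [hn'.choose_spec.2 x hx, ← hchoose]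
  subst hx
  constructor
  · rintro ⟨y, hy, hc⟩
    refine ⟨y, hy.trans (hpow _), (hM _ _ _).1 hc _ ?_⟩
    have ha := hlen x.length
    set q := x.length + 2 with hq
    have h1 : x.length + (adv x.length).length + y.length + 1 ≤ 3 * q ^ (e + 1) := by
      have h2 : 1 ≤ q ^ e := Nat.one_le_pow _ _ (by omega)
      rw [pow_succ]
      nlinarith
    have h2 : 1 ≤ q ^ (e + 1) := Nat.one_le_pow _ _ (by omega)
    have h3 : 2 ^ 18 ≤ q ^ 18 := Nat.pow_le_pow_left (by omega) 18
    rw [pow_add, mul_comm 4, pow_mul]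
    generalize q ^ (e + 1) = u at *
    have h4 := Nat.pow_le_pow_left h1 2
    have h5 : 1 ≤ u ^ 2 := Nat.one_le_pow _ _ h2
    have h6 : 40 * (x.length + (adv x.length).length + y.length + 1) ^ 2 + 1 ≤ 361 * u ^ 2 := by
      rw [mul_pow] at h4
      omega
    have h7 := Nat.pow_le_pow_left h6 2
    have h8 : 1 ≤ u ^ 4 := Nat.one_le_pow _ _ h2
    have h9 := Nat.mul_le_mul_left (u ^ 4) h3
    rw [mul_pow, ← pow_mul] at h7
    norm_num at h7 h9
    omega
  · rintro ⟨y, -, hacc⟩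
    have hc : check (x ++ y) (adv x.length) = true := by
      by_contra hc
      exact (hM _ _ _).2 (by simpa using hc) _ hacc
    have h1 := length_le_of_check hc
    rw [List.length_append] at h1
    exact ⟨y, by have := hlen x.length; omega, hc⟩

open Filter Asymptotics in
theorem eventually_le_texp (κ B : ℕ) {ε : ℝ} (hε : 0 < ε) :
    ∃ m₀ : ℕ, ∀ m n : ℕ, m₀ ≤ m → (n + 1 : ℝ) ≤ B + (m : ℝ) ^ (ε / 2) →
      (m + 2 ^ (κ * (n + 1)) + 1) ^ 6 ≤ texp ε m := by
  have h1 : ∀ᶠ m : ℕ in atTop, Real.log m ≤ Real.log 2 / 24 * (m : ℝ) ^ ε := by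
    have h := (isLittleO_log_rpow_atTop hε).bound (show (0 : ℝ) < Real.log 2 / 24 by positivity)
    filter_upwards [tendsto_natCast_atTop_atTop.eventually h] with m hm
    rw [Real.norm_eq_abs, Real.norm_eq_abs, abs_of_nonneg (Real.rpow_nonneg (by positivity) ε)] at hm
    exact (le_abs_self _).trans hm
  have h2 : ∀ᶠ m : ℕ in atTop, 12 * κ * (B + 1) + 1 ≤ (m : ℝ) ^ (ε / 2) :=
    ((tendsto_rpow_atTop (half_pos hε)).comp tendsto_natCast_atTop_atTop).eventually_ge_atTop _
  obtain ⟨m₀, h⟩ := (h1.and (h2.and (eventually_ge_atTop 2))).exists_forall_of_atTop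
  refine ⟨m₀, fun m n hm hn => ?_⟩
  obtain ⟨h3, h4, h5⟩ := h m hm
  have hl : 0 < Real.log 2 := Real.log_pos (by norm_num)
  have h6 : m + 2 ^ (κ * (n + 1)) + 1 ≤ m ^ 2 * 2 ^ (κ * (n + 1)) := by
    have : 1 ≤ 2 ^ (κ * (n + 1)) := Nat.one_le_two_pow
    nlinarith [Nat.mul_le_mul h5 h5]
  refine (Nat.pow_le_pow_left h6 6).trans ?_
  rw [texp, ← Nat.cast_le (α := ℝ)]
  push_cast
  have hm0 : (0 : ℝ) < m := by
    have : 0 < m := by omega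
    exact_mod_cast this
  rw [← Real.log_le_log_iff (by positivity) (by positivity)]
  rw [Real.log_pow, Real.log_pow, Real.log_mul (by positivity) (by positivity), Real.log_pow,
    Real.log_pow]
  push_cast
  have h7 := Nat.le_ceil ((m : ℝ) ^ ε)
  have h8 : (m : ℝ) ^ ε = (m : ℝ) ^ (ε / 2) * (m : ℝ) ^ (ε / 2) := by
    rw [← Real.rpow_add hm0, add_halves]
  have h9 : 6 * (κ * (n + 1 : ℝ)) ≤ (m : ℝ) ^ ε / 2 := by
    rw [h8]
    generalize (m : ℝ) ^ (ε / 2) = s at *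
    have hκ : (0 : ℝ) ≤ κ := Nat.cast_nonneg κ
    have hB : (0 : ℝ) ≤ B := Nat.cast_nonneg B
    have hs : 1 ≤ s := by
      have : (0 : ℝ) ≤ 12 * κ * (B + 1) := by positivity
      linarith
    have e1 := mul_le_mul_of_nonneg_left hn hκ
    have e2 := mul_le_mul_of_nonneg_left h4 (zero_le_one.trans hs)
    have e3 := mul_le_mul_of_nonneg_left hs (mul_nonneg hκ hB)
    nlinarith
  have h10 := mul_le_mul_of_nonneg_right h9 hl.le
  have h11 := mul_le_mul_of_nonneg_right h7 hl.le
  nlinarith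

theorem primrecRel_not_compact {L : Language} (hL : PrimrecPred fun x => x ∈ L) (k : ℕ) :
    PrimrecRel fun i d : ℕ => d ≤ i ∧ ¬ Compact L i ((i + 2) ^ (7 * (k * (d + 2) + 2))) := by
  have h1 : Primrec fun p : ℕ × ℕ => (p.1 + 2) ^ (7 * (k * (p.2 + 2) + 2)) :=
    primrec_pow.comp (Primrec.nat_add.comp Primrec.fst (Primrec.const 2))
      (Primrec.nat_mul.comp (Primrec.const 7) (Primrec.nat_add.comp (Primrec.nat_mul.comp
        (Primrec.const k) (Primrec.nat_add.comp Primrec.snd (Primrec.const 2))) (Primrec.const 2)))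
  exact (Primrec.nat_le.comp Primrec.snd Primrec.fst).and
    ((primrecRel_compact hL).comp Primrec.fst h1).not

theorem padded_bound {n d k m : ℕ} (hd : d ≤ n) (hm : m = d + 1 + (n + 2) ^ d + 1 + n) :
    (n + m ^ k + 2) ^ 7 ≤ (n + 2) ^ (7 * (k * (d + 2) + 2)) := by
  have h1 : m ≤ (n + 2) ^ (d + 2) := by
    have : 1 ≤ (n + 2) ^ d := Nat.one_le_pow _ _ (by omega)
    rw [pow_add, hm]
    generalize (n + 2) ^ d = p at this
    have h := Nat.mul_le_mul_right (n ^ 2 + 4 * n + 3) this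
    nlinarith
  have h2 : m ^ k ≤ (n + 2) ^ (k * (d + 2)) := by
    rw [mul_comm, pow_mul]
    exact Nat.pow_le_pow_left h1 k
  rw [mul_comm 7, pow_mul]
  refine Nat.pow_le_pow_left ?_ 7
  have : 1 ≤ (n + 2) ^ (k * (d + 2)) := Nat.one_le_pow _ _ (by omega)
  rw [pow_add]
  generalize (n + 2) ^ (k * (d + 2)) = q at this h2
  have h := Nat.mul_le_mul_right (n ^ 2 + 4 * n + 3) this
  nlinarith

/-- If `Σ₂E ⊄ i.o.-NP/poly`, then for every `k` there is a language
`A ∈ Σ₂SubEXP` with `A ∉ NSIZE(n^k)`. -/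
theorem downward_separation :
    ¬ (Sigma2E ⊆ ioClass NPpoly) →
      ∀ k : ℕ, ∃ A ∈ Sigma2SubEXP, ¬ NSIZE (fun n => n ^ k) A := by
  intro hsub k
  obtain ⟨L, ⟨κ, c, ML, adv, hadv, hL⟩, hio⟩ := Set.not_subset.mp hsub
  have hadv' : ∀ n, adv n = [] := fun n => List.length_eq_zero_iff.mp (Nat.le_zero.mp (hadv n))
  simp only [hadv'] at hL
  have hprim : PrimrecPred fun x => x ∈ L := (primrecPred_sig2 ML c κ).of_eq fun x => (hL x).symm
  obtain ⟨MR, hMR⟩ := Prog.exists_TM_search (primrecRel_not_compact hprim k) fun d => by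
    have hfin : {n : ℕ | Compact L n ((n + 2) ^ (7 * (k * (d + 2) + 2)))}.Finite := by
      by_contra h
      exact hio (mem_ioClass_of_compact h)
    obtain ⟨i, hi, hdi⟩ := hfin.infinite_compl.exists_gt d
    exact ⟨i, hdi.le, hi⟩
  set A : Language := {w | ((body w).length + 2) ^ num w ≤ w.length ∧
    ¬ tmAccepts MR (List.replicate (num w) true) (body w).length ∧ body w ∈ L} with hA
  refine ⟨A, fun ε hε => ?_, ?_⟩
  · have hT : ∀ d, ∃ T, ∀ τ, T ≤ τ → tmAccepts MR (List.replicate d true) τ := fun d => by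
      obtain ⟨i, -, h, -⟩ := hMR d
      exact h
    choose T hT using hT
    obtain ⟨e, he⟩ := exists_nat_ge (2 / ε)
    have he1 : 1 ≤ e * (ε / 2) := by
      rw [div_le_iff₀ hε] at he
      linarith
    have he0 : e ≠ 0 := by
      rintro rfl
      norm_num at he1
    obtain ⟨m₀, hm₀⟩ := eventually_le_texp κ ((Finset.range e).sup T) hε
    refine mem_sigma2Time_of_guard (MR := MR) (ML := ML) (κ := κ) (c := c) (fun w => ?_) (m₀ + 1)
      fun w hw hg hacc => hm₀ _ _ (by omega) ?_
    · rw [← hL]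
      rfl
    · rcases Nat.lt_or_ge (num w) e with h | h
      · have h1 : (body w).length < T (num w) := by
          by_contra h1
          exact hacc (hT _ _ (not_lt.mp h1))
        have h2 : (body w).length + 1 ≤ (Finset.range e).sup T :=
          h1.trans_le (Finset.le_sup (f := T) (Finset.mem_range.mpr h))
        have h3 : ((body w).length + 1 : ℝ) ≤ ((Finset.range e).sup T : ℕ) := by
          exact_mod_cast h2
        have h4 : 0 ≤ (w.length : ℝ) ^ (ε / 2) := by positivity
        linarith
      · have h1 : ((body w).length + 2) ^ e ≤ w.length :=
          (Nat.pow_le_pow_right (by omega) h).trans hg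
        have h2 : ((body w).length + 2 : ℝ) ^ e ≤ w.length := by exact_mod_cast h1
        have h3 : (1 : ℝ) ≤ w.length := by
          have : 1 ≤ w.length := by omega
          exact_mod_cast this
        have h4 : ((body w).length + 2 : ℝ) ≤ (w.length : ℝ) ^ (ε / 2) := by
          refine le_of_pow_le_pow_left₀ he0 (by positivity) (h2.trans ?_)
          rw [← Real.rpow_natCast, ← Real.rpow_mul (by positivity), mul_comm]
          calc (w.length : ℝ) = (w.length : ℝ) ^ (1 : ℝ) := (Real.rpow_one _).symm
            _ ≤ _ := Real.rpow_le_rpow_of_exponent_le h3 he1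
        have h5 : (0 : ℝ) ≤ ((Finset.range e).sup T : ℕ) := Nat.cast_nonneg _
        linarith
  · rintro ⟨D, ⟨n₀, hsize⟩, hD⟩
    obtain ⟨n, ⟨hdn, hcomp⟩, -, hrej⟩ := hMR n₀
    set m := n₀ + 1 + (n + 2) ^ n₀ + 1 + n with hm
    refine hcomp ((compact_of_circuit L n (m ^ k)
      (List.replicate n₀ true ++ false :: List.replicate ((n + 2) ^ n₀) true ++ [false]) (D m)
      (hsize m (by omega)) fun x hx => ?_).mono (padded_bound hdn hm))
    obtain ⟨h1, h2⟩ := parse_padded n₀ ((n + 2) ^ n₀) x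
    rw [List.append_assoc, List.singleton_append]
    have hlen : (List.replicate n₀ true ++ false :: List.replicate ((n + 2) ^ n₀) true ++
        false :: x).length = m := by
      simp only [List.length_append, List.length_cons, List.length_replicate, hx, hm]
      omega
    rw [← hD m _ hlen, hA, Set.mem_ofPred_eq, h1, h2, hlen, hx]
    have hle : (n + 2) ^ n₀ ≤ m := by omega
    simp [hle, hrej n le_rfl]

end Paper
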